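/- In the discharging of H defined by rules R1–R5 applied to the initial charge (every j-face charged with weight j), every minor 8-face f of H has final weight w(f) ≥ 10/3. -/

import Mathlib

open scoped Classical

noncomputable section

/-- A plane embedding (drawing) of a simple graph: vertices are mapped to distinct
points of the plane, every edge is drawn as a simple arc joining the points of its two
endvertices, arcs contain no vertex points other than their endpoints, and two distinct
arcs meet only in common endpoints. -/
structure PlaneEmbedding {V : Type*} (G : SimpleGraph V) where
  pos : V → ℝ × ℝ
  arc : V → V → Set (ℝ × ℝ)
  pos_injective : Function.Injective pos
  arc_symm : ∀ u v, arc u v = arc v u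
  arc_curve : ∀ u v, G.Adj u v → ∃ γ : ℝ → ℝ × ℝ,
      ContinuousOn γ (Set.Icc 0 1) ∧ Set.InjOn γ (Set.Icc 0 1) ∧
      γ 0 = pos u ∧ γ 1 = pos v ∧ γ '' Set.Icc 0 1 = arc u v
  arc_vertex : ∀ u v, G.Adj u v → ∀ w, pos w ∈ arc u v → w = u ∨ w = v
  arc_inter : ∀ u v x y, G.Adj u v → G.Adj x y → s(u, v) ≠ s(x, y) →
      arc u v ∩ arc x y ⊆ Set.range pos

/-- A graph is planar if it admits a plane embedding. -/
def SimpleGraph.IsPlanar {V : Type*} (G : SimpleGraph V) : Prop :=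
  Nonempty (PlaneEmbedding G)

/-- A graph is 3-connected if it has at least four vertices and deleting any set of at
most two vertices leaves a connected graph. -/
def ThreeConnected {V : Type*} [Fintype V] (G : SimpleGraph V) : Prop :=
  4 ≤ Fintype.card V ∧
    ∀ S : Finset V, S.card ≤ 2 → (G.induce ((↑S : Set V)ᶜ)).Connected

/-- `S` is a separator of `G`: deleting it leaves a disconnected graph. -/
def IsSeparator {V : Type*} [Fintype V] (G : SimpleGraph V) (S : Finset V) : Prop :=
  ¬ (G.induce ((↑S : Set V)ᶜ)).Connected

/-- A separator `S` is trivial if some component of `G - S` is a single vertex, i.e.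
some vertex outside `S` has all of its neighbours inside `S`. -/
def TrivialSeparator {V : Type*} [Fintype V] (G : SimpleGraph V) (S : Finset V) : Prop :=
  ∃ v : V, v ∉ S ∧ ∀ w : V, G.Adj v w → w ∈ S

/-- A graph is essentially 4-connected if it is 3-connected and every 3-separator is
trivial. -/
def EssentiallyFourConnected {V : Type*} [Fintype V] (G : SimpleGraph V) : Prop :=
  ThreeConnected G ∧
    ∀ S : Finset V, S.card = 3 → IsSeparator G S → TrivialSeparator G S

/-- A cycle `C` of `G` is isolating if every component of `G - V(C)` is a single vertex
of degree 3 in `G`, i.e. every vertex not on `C` has degree 3 in `G` and all of its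
neighbours on `C`. -/
def IsIsolating {V : Type*} [Fintype V] (G : SimpleGraph V) {x : V} (C : G.Walk x x) : Prop :=
  ∀ v : V, v ∉ C.support →
    (Finset.univ.filter fun w => G.Adj v w).card = 3 ∧ ∀ w : V, G.Adj v w → w ∈ C.support

/-- `C` is a longest isolating cycle of `G`. -/
def IsLongestIsolatingCycle {V : Type*} [Fintype V] (G : SimpleGraph V) {x : V}
    (C : G.Walk x x) : Prop :=
  C.IsCycle ∧ IsIsolating G C ∧
    ∀ (y : V) (C' : G.Walk y y), C'.IsCycle → IsIsolating G C' → C'.length ≤ C.length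

section PlaneSetup

variable {V : Type*} [Fintype V] {G : SimpleGraph V}

/-- The chords of the cycle `C`: edges of `G` not on `C` joining two vertices of `C`. -/
def chordSet {x : V} (C : G.Walk x x) : Set (Sym2 V) :=
  {e | e ∈ G.edgeSet ∧ e ∉ C.edges ∧ ∀ v ∈ e, v ∈ C.support}

/-- The plane graph `H` obtained from `G` by deleting all chords of `C`. -/
def Hgraph {x : V} (C : G.Walk x x) : SimpleGraph V :=
  G.deleteEdges (chordSet C)

/-- The arc drawing an edge, as a function of the unordered edge. -/
def arcSet (emb : PlaneEmbedding G) : Sym2 V → Set (ℝ × ℝ) :=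
  Sym2.lift ⟨emb.arc, emb.arc_symm⟩

/-- The point set of the drawing of the subgraph of `H'` induced on the vertex set `s`
(in the embedding `emb` of `G`). -/
def drawingOn (emb : PlaneEmbedding G) (H' : SimpleGraph V) (s : Set V) : Set (ℝ × ℝ) :=
  emb.pos '' s ∪
    ⋃ (u : V) (v : V) (_ : H'.Adj u v) (_ : u ∈ s) (_ : v ∈ s), emb.arc u v

/-- The drawing of `H`. -/
def drawingH (emb : PlaneEmbedding G) {x : V} (C : G.Walk x x) : Set (ℝ × ℝ) :=
  drawingOn emb (Hgraph C) Set.univ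

/-- `f` is a face of the drawing `D`: a connected component of its complement. -/
def IsFaceOf (D : Set (ℝ × ℝ)) (f : Set (ℝ × ℝ)) : Prop :=
  ∃ z : ℝ × ℝ, z ∉ D ∧ f = connectedComponentIn Dᶜ z

/-- The drawing of the cycle `C`. -/
def drawC (emb : PlaneEmbedding G) {x : V} (C : G.Walk x x) : Set (ℝ × ℝ) :=
  ⋃ e ∈ C.edges, arcSet emb e

/-- The open region strictly inside the closed curve given by `C`: the points off the
curve whose connected component in the complement is bounded. -/
def insideC (emb : PlaneEmbedding G) {x : V} (C : G.Walk x x) : Set (ℝ × ℝ) :=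
  {z | z ∉ drawC emb C ∧ Bornology.IsBounded (connectedComponentIn (drawC emb C)ᶜ z)}

/-- The vertices of `G` strictly inside `C`. -/
def Vminus (emb : PlaneEmbedding G) {x : V} (C : G.Walk x x) : Finset V :=
  Finset.univ.filter fun v => v ∉ C.support ∧ emb.pos v ∈ insideC emb C

/-- The vertices of `G` strictly outside `C`:  `V⁺ = V - V(C) - V⁻`. -/
def Vplus (emb : PlaneEmbedding G) {x : V} (C : G.Walk x x) : Finset V :=
  Finset.univ.filter fun v => v ∉ C.support ∧ v ∉ Vminus emb C

/-- A face `f` is incident with the vertex `v`. -/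
def incVertex (emb : PlaneEmbedding G) (f : Set (ℝ × ℝ)) (v : V) : Prop :=
  emb.pos v ∈ closure f

/-- A face `f` is incident with the edge `e` (the arc of `e` lies on the boundary). -/
def incEdge (emb : PlaneEmbedding G) (f : Set (ℝ × ℝ)) (e : Sym2 V) : Prop :=
  arcSet emb e ⊆ closure f

/-- A minor face of the drawing `D`: a face incident with exactly one vertex of
`V⁻ ∪ V⁺`. -/
def MinorFaceOf (emb : PlaneEmbedding G) {x : V} (C : G.Walk x x)
    (D : Set (ℝ × ℝ)) (f : Set (ℝ × ℝ)) : Prop :=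
  IsFaceOf D f ∧ ∃! v : V, v ∈ Vminus emb C ∪ Vplus emb C ∧ incVertex emb f v

/-- `M⁻`: the minor faces of `H⁻ = H - V⁺`. -/
def Mminus (emb : PlaneEmbedding G) {x : V} (C : G.Walk x x) : Set (Set (ℝ × ℝ)) :=
  {f | MinorFaceOf emb C (drawingOn emb (Hgraph C) ((↑(Vplus emb C) : Set V)ᶜ)) f}

/-- `M⁺`: the minor faces of `H⁺ = H - V⁻`. -/
def Mplus (emb : PlaneEmbedding G) {x : V} (C : G.Walk x x) : Set (Set (ℝ × ℝ)) :=
  {f | MinorFaceOf emb C (drawingOn emb (Hgraph C) ((↑(Vminus emb C) : Set V)ᶜ)) f}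

/-- A minor face of `H`. -/
def MinorFaceH (emb : PlaneEmbedding G) {x : V} (C : G.Walk x x) (f : Set (ℝ × ℝ)) : Prop :=
  MinorFaceOf emb C (drawingH emb C) f

/-- A major face of `H`: a face of `H` that is not minor. -/
def MajorFaceH (emb : PlaneEmbedding G) {x : V} (C : G.Walk x x) (f : Set (ℝ × ℝ)) : Prop :=
  IsFaceOf (drawingH emb C) f ∧ ¬ MinorFaceH emb C f

/-- The number of `C`-edges of a face `f` (so `f` is a `j`-face when this equals `j`). -/
def numCEdges (emb : PlaneEmbedding G) {x : V} (C : G.Walk x x) (f : Set (ℝ × ℝ)) : ℕ :=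
  (C.edges.toFinset.filter fun e => incEdge emb f e).card

/-- `m_{f,f'}`: the number of common `C`-edges of the faces `f` and `f'`. -/
def mEdges (emb : PlaneEmbedding G) {x : V} (C : G.Walk x x)
    (f f' : Set (ℝ × ℝ)) : ℕ :=
  (C.edges.toFinset.filter fun e => incEdge emb f e ∧ incEdge emb f' e).card

/-- `f'` is opposite to `f` (with respect to some `C`-edge incident with both). -/
def OppositeFaces (emb : PlaneEmbedding G) {x : V} (C : G.Walk x x)
    (f f' : Set (ℝ × ℝ)) : Prop :=
  f ≠ f' ∧ ∃ e ∈ C.edges, incEdge emb f e ∧ incEdge emb f' e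

/-- `e` is the middle `C`-edge of the face `f` (for a 3-face, the `C`-edge sharing an
endvertex with every other `C`-edge of `f`). -/
def IsMiddleCEdge (emb : PlaneEmbedding G) {x : V} (C : G.Walk x x)
    (f : Set (ℝ × ℝ)) (e : Sym2 V) : Prop :=
  e ∈ C.edges ∧ incEdge emb f e ∧
    ∀ e' ∈ C.edges, incEdge emb f e' → e' ≠ e → ∃ v : V, v ∈ e ∧ v ∈ e'

/-- The total weight sent from the face `f` to the face `f'` by the discharging rules
R1–R5 (each rule applied exactly once). -/
def sendWeight (emb : PlaneEmbedding G) {x : V} (C : G.Walk x x)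
    (f f' : Set (ℝ × ℝ)) : ℚ :=
  -- R1: a major face sends `m_{f,f'}` to every opposite minor face
  (if MajorFaceH emb C f ∧ MinorFaceH emb C f' ∧ OppositeFaces emb C f f'
    then (mEdges emb C f f' : ℚ) else 0)
  -- R2: a minor face sends `(2/3)·m_{f,f'}` to every opposite minor 2-face
  + (if MinorFaceH emb C f ∧ MinorFaceH emb C f' ∧ numCEdges emb C f' = 2 ∧
        OppositeFaces emb C f f'
    then 2 / 3 * (mEdges emb C f f' : ℚ) else 0)
  -- R3: a minor face sends 1 to every minor 3-face opposite with respect to its middle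
  -- `C`-edge
  + (if MinorFaceH emb C f ∧ MinorFaceH emb C f' ∧ numCEdges emb C f' = 3 ∧ f ≠ f' ∧
        (∃ e : Sym2 V, IsMiddleCEdge emb C f' e ∧ incEdge emb f e)
    then 1 else 0)
  -- R4
  + (if MinorFaceH emb C f ∧ 4 ≤ numCEdges emb C f ∧ MinorFaceH emb C f' ∧
        numCEdges emb C f' = 4 ∧ OppositeFaces emb C f' f ∧ mEdges emb C f' f = 2 ∧
        (∃ f₂ : Set (ℝ × ℝ), MinorFaceH emb C f₂ ∧
          (numCEdges emb C f₂ = 2 ∨ numCEdges emb C f₂ = 3) ∧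
          OppositeFaces emb C f' f₂ ∧ mEdges emb C f' f₂ = 2)
    then 2 / 3 else 0)
  -- R5
  + (if MinorFaceH emb C f ∧ 4 ≤ numCEdges emb C f ∧ MinorFaceH emb C f' ∧
        numCEdges emb C f' = 5 ∧ OppositeFaces emb C f' f ∧ mEdges emb C f' f = 2 ∧
        (∃ g₁ g₂ : Set (ℝ × ℝ), g₁ ≠ g₂ ∧
          MinorFaceH emb C g₁ ∧ numCEdges emb C g₁ = 2 ∧ OppositeFaces emb C f' g₁ ∧
          MinorFaceH emb C g₂ ∧ numCEdges emb C g₂ = 2 ∧ OppositeFaces emb C f' g₂)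
    then 1 / 3 else 0)

/-- The final weight of a face `f` after discharging: the initial charge `j` of a
`j`-face, minus everything sent, plus everything received. -/
def wFace (emb : PlaneEmbedding G) {x : V} (C : G.Walk x x) (f : Set (ℝ × ℝ)) : ℚ :=
  (numCEdges emb C f : ℚ) - (∑ᶠ f' : Set (ℝ × ℝ), sendWeight emb C f f')
    + ∑ᶠ f' : Set (ℝ × ℝ), sendWeight emb C f' f

end PlaneSetup

theorem exists_continuous_log {A : Type*} [TopologicalSpace A] [SimplyConnectedSpace A]
    [LocallyPathConnectedSpace A] {f : A → ℂ} (hf : Continuous f) (h0 : ∀ a, f a ≠ 0) :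
    ∃ L : A → ℂ, Continuous L ∧ ∀ a, Complex.exp (L a) = f a := by
  obtain ⟨a₀⟩ : Nonempty A := inferInstance
  obtain ⟨F, ⟨-, hF⟩, -⟩ := Complex.isCoveringMapOn_exp.existsUnique_continuousMap_lifts
    (⟨f, hf⟩ : C(A, ℂ)) (a₀ := a₀) (e₀ := Complex.log (f a₀)) (Complex.exp_log (h0 a₀))
    (fun a => by simpa using h0 a)
  exact ⟨F, F.continuous, fun a => congrFun hF a⟩

theorem isDiscrete_range_two_pi_I :
    IsDiscrete (Set.range fun n : ℤ => (n : ℂ) * (2 * Real.pi * Complex.I)) := by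
  have h : Topology.IsClosedEmbedding (fun n : ℤ => (n : ℝ) * (2 * Real.pi)) :=
    (Homeomorph.mulRight₀ (2 * Real.pi) (by positivity)).isClosedEmbedding.comp
      Int.isClosedEmbedding_coe_real
  rw [isDiscrete_iff_discreteTopology]
  have h2 : Topology.IsEmbedding (fun n : ℤ => (n : ℂ) * (2 * Real.pi * Complex.I)) := by
    refine Topology.IsEmbedding.of_comp (by fun_prop) Complex.continuous_im ?_
    convert h.isEmbedding using 1
    ext n
    simp
  exact h2.toHomeomorph.symm.isEmbedding.discreteTopology

theorem sub_eq_sub_of_exp_eq {l l' : ℝ → ℂ} (hl : Continuous l) (hl' : Continuous l')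
    (h : ∀ t, Complex.exp (l t) = Complex.exp (l' t)) (s t : ℝ) : l s - l t = l' s - l' t := by
  have := isPreconnected_univ.constant_of_mapsTo isDiscrete_range_two_pi_I
    (f := fun t => l t - l' t) (by fun_prop)
    (fun t _ => by
      obtain ⟨n, hn⟩ := Complex.exp_eq_exp_iff_exists_int.1 (h t)
      exact ⟨n, by simp [hn]⟩) (Set.mem_univ s) (Set.mem_univ t)
  linear_combination this

/-- The total variation over `[0,1]` of a continuous logarithm of `f`. -/
def logVar (f : ℝ → ℂ) : ℂ :=
  if h : ∃ l : ℝ → ℂ, Continuous l ∧ ∀ t, Complex.exp (l t) = f t then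
    h.choose 1 - h.choose 0 else 0

theorem logVar_eq {f l : ℝ → ℂ} (hl : Continuous l) (h : ∀ t, Complex.exp (l t) = f t) :
    logVar f = l 1 - l 0 := by
  have hex : ∃ l : ℝ → ℂ, Continuous l ∧ ∀ t, Complex.exp (l t) = f t := ⟨l, hl, h⟩
  rw [logVar, dif_pos hex]
  exact sub_eq_sub_of_exp_eq hex.choose_spec.1 hl
    (fun t => by rw [hex.choose_spec.2, h]) 1 0

theorem logVar_neg {f : ℝ → ℂ} (hf : Continuous f) (h0 : ∀ t, f t ≠ 0) :
    logVar (fun t => - f t) = logVar f := by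
  obtain ⟨l, hl, h⟩ := exists_continuous_log hf h0
  rw [logVar_eq hl h, logVar_eq (l := fun t => l t + Real.pi * Complex.I) (by fun_prop)]
  · ring
  · intro t; rw [Complex.exp_add, Complex.exp_pi_mul_I, h]; ring

theorem exp_logVar {f : ℝ → ℂ} (hf : Continuous f) (h0 : ∀ t, f t ≠ 0) :
    Complex.exp (logVar f) = f 1 / f 0 := by
  obtain ⟨l, hl, h⟩ := exists_continuous_log hf h0
  rw [logVar_eq hl h, Complex.exp_sub, h, h]

theorem logVar_square {P Q : ℝ → ℂ} (hP : Continuous P) (hQ : Continuous Q)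
    (h : ∀ s t, P s ≠ Q t) :
    logVar (fun s => P s - Q 0) + logVar (fun t => Q t - P 1) =
      logVar (fun t => Q t - P 0) + logVar (fun s => P s - Q 1) := by
  obtain ⟨L, hL, hexp⟩ := exists_continuous_log (A := ℝ × ℝ) (f := fun x => P x.1 - Q x.2)
    (by fun_prop) (fun x => sub_ne_zero.2 (h _ _))
  have e1 := logVar_eq (f := fun s => P s - Q 0) (l := fun s => L (s, 0)) (by fun_prop)
    (fun s => hexp (s, 0))
  have e2 := logVar_eq (f := fun s => P s - Q 1) (l := fun s => L (s, 1)) (by fun_prop)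
    (fun s => hexp (s, 1))
  have e3 := logVar_eq (f := fun t => P 0 - Q t) (l := fun t => L (0, t)) (by fun_prop)
    (fun t => hexp (0, t))
  have e4 := logVar_eq (f := fun t => P 1 - Q t) (l := fun t => L (1, t)) (by fun_prop)
    (fun t => hexp (1, t))
  rw [← logVar_neg (by fun_prop) (fun t => sub_ne_zero.2 (h _ _))] at e3 e4
  simp only [neg_sub] at e3 e4
  rw [e1, e2, e3, e4]
  ring

/-- The complete bipartite graph `K₃,₃` cannot be drawn in the plane so that nonadjacent edges
are disjoint. -/
theorem not_K33_drawing_complex (a b : Fin 3 → ℂ) (S : Fin 3 → Fin 3 → Set ℂ)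
    (hS : ∀ i j, JoinedIn (S i j) (a i) (b j))
    (hd : ∀ i j k l, i ≠ k → j ≠ l → Disjoint (S i j) (S k l)) : False := by
  have hp : ∀ i j, ∃ P : ℝ → ℂ, Continuous P ∧ P 0 = a i ∧ P 1 = b j ∧ ∀ t, P t ∈ S i j := by
    intro i j
    refine ⟨(hS i j).somePath.extend, (hS i j).somePath.continuous_extend, by simp, by simp, ?_⟩
    intro t
    exact (hS i j).somePath_mem _
  choose P hPc hP0 hP1 hPS using hp
  have hne : ∀ {i j k l}, i ≠ k → j ≠ l → ∀ {x y}, x ∈ S i j → y ∈ S k l → x ≠ y :=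
    fun hik hjl x y hx hy e => (Set.disjoint_left.1 (hd _ _ _ _ hik hjl) hx) (e ▸ hy)
  have ha : ∀ i j, a i ∈ S i j := fun i j => (hS i j).source_mem
  have hb : ∀ i j, b j ∈ S i j := fun i j => (hS i j).target_mem
  have hoth : ∀ j : Fin 3, ∃ l, j ≠ l := by decide
  have haa : ∀ i k, i ≠ k → a i - a k ≠ 0 := fun i k h => sub_ne_zero.2 <| by
    exact hne h (by decide : (0 : Fin 3) ≠ 1) (ha i 0) (ha k 1)
  have hbb : ∀ i k, i ≠ k → b i - b k ≠ 0 := fun i k h => sub_ne_zero.2 <| by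
    exact hne (by decide : (0 : Fin 3) ≠ 1) h (hb 0 i) (hb 1 k)
  have hba : ∀ j i, b j - a i ≠ 0 := fun j i => sub_ne_zero.2 <| by
    obtain ⟨k, hk⟩ := hoth i
    obtain ⟨l, hl⟩ := hoth j
    exact hne hk.symm hl (hb k j) (ha i l)
  let X : Fin 3 → Fin 3 → Fin 3 → ℂ := fun k i j => logVar (fun t => P i j t - a k)
  let Y : Fin 3 → Fin 3 → Fin 3 → ℂ := fun l i j => logVar (fun t => P i j t - b l)
  have R : ∀ i j k l, i ≠ k → j ≠ l → X k i j + Y j k l = X i k l + Y l i j := by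
    intro i j k l hik hjl
    have := logVar_square (hPc i j) (hPc k l) (fun s t => hne hik hjl (hPS i j s) (hPS k l t))
    simpa only [hP0, hP1] using this
  have eX : ∀ k i j, k ≠ i → Complex.exp (X k i j) = (b j - a k) / (a i - a k) := by
    intro k i j hki
    obtain ⟨l, hl⟩ := hoth j
    have := exp_logVar (f := fun t => P i j t - a k) (by have := hPc i j; fun_prop)
      (fun t => sub_ne_zero.2 (hne hki.symm hl (hPS i j t) (ha k l)))
    simpa only [hP0, hP1] using this
  have eY : ∀ l i j, l ≠ j → Complex.exp (Y l i j) = (b j - b l) / (a i - b l) := by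
    intro l i j hlj
    obtain ⟨k, hk⟩ := hoth i
    have := exp_logVar (f := fun t => P i j t - b l) (by have := hPc i j; fun_prop)
      (fun t => sub_ne_zero.2 (hne hk hlj.symm (hPS i j t) (hb k l)))
    simpa only [hP0, hP1] using this
  let T : Fin 3 → ℂ := fun i => Y 0 i 1 + Y 0 i 2 + Y 1 i 0 + Y 1 i 2 + Y 2 i 0 + Y 2 i 1
  let W : Fin 3 → Fin 3 → ℂ := fun i k =>
    X k i 0 + X k i 1 + X k i 2 - (X i k 0 + X i k 1 + X i k 2)
  have hW : ∀ i k, i ≠ k → 2 * W i k = T i - T k := by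
    intro i k h
    have h01 := R i 0 k 1 h (by decide)
    have h02 := R i 0 k 2 h (by decide)
    have h10 := R i 1 k 0 h (by decide)
    have h12 := R i 1 k 2 h (by decide)
    have h20 := R i 2 k 0 h (by decide)
    have h21 := R i 2 k 1 h (by decide)
    simp only [W, T]
    linear_combination h01 + h02 + h10 + h12 + h20 + h21
  have h0 : W 0 1 + W 1 2 + W 0 2 - (T 0 - T 2) = 0 := by
    linear_combination (hW 0 1 (by decide)) / 2 + (hW 1 2 (by decide)) / 2 +
      (hW 0 2 (by decide)) / 2
  let B : Fin 3 → ℂ := fun i => (b 0 - a i) * (b 1 - a i) * (b 2 - a i)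
  have hB : ∀ i, B i ≠ 0 := fun i => mul_ne_zero (mul_ne_zero (hba _ _) (hba _ _)) (hba _ _)
  have eW : ∀ i k, i ≠ k → Complex.exp (W i k) = - (B k / B i) := by
    intro i k h
    have h1 := haa i k h
    have h2 := haa k i h.symm
    have h3 := hba 0 i
    have h4 := hba 1 i
    have h5 := hba 2 i
    have h6 : a k - a i = - (a i - a k) := by ring
    simp only [W, B, Complex.exp_sub, Complex.exp_add, eX _ _ _ h, eX _ _ _ h.symm, h6]
    field_simp
  let D : ℂ := ((b 1 - b 0) * (b 2 - b 0) * (b 0 - b 1) * (b 2 - b 1) * (b 0 - b 2) * (b 1 - b 2))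
  have hD : D ≠ 0 := by
    simp only [D]
    refine mul_ne_zero (mul_ne_zero (mul_ne_zero (mul_ne_zero (mul_ne_zero ?_ ?_) ?_) ?_) ?_) ?_ <;>
    exact hbb _ _ (by decide)
  have eT : ∀ i, Complex.exp (T i) = D / (B i) ^ 2 := by
    intro i
    have h3 := hba 0 i
    have h4 := hba 1 i
    have h5 := hba 2 i
    have h6 : ∀ j, a i - b j = - (b j - a i) := fun j => by ring
    simp only [T, B, D, Complex.exp_add, eY 0 i 1 (by decide), eY 0 i 2 (by decide),
      eY 1 i 0 (by decide), eY 1 i 2 (by decide), eY 2 i 0 (by decide), eY 2 i 1 (by decide), h6]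
    field_simp
  clear_value W T B D
  have key := congrArg Complex.exp h0
  rw [Complex.exp_sub, Complex.exp_add, Complex.exp_add, Complex.exp_sub, eW 0 1 (by decide),
    eW 1 2 (by decide), eW 0 2 (by decide), eT, eT, Complex.exp_zero] at key
  have b0 := hB 0
  have b1 := hB 1
  have b2 := hB 2
  field_simp at key
  norm_num at key

theorem false_of_log_of_bounded {K U : Set ℂ} (hK : IsClosed K) (hU : IsOpen U)
    (hb : Bornology.IsBounded U) (hfr : frontier U ⊆ K) {p q : ℂ} (hp : p ∈ U) (hq : q ∉ U)
    (hqK : q ∉ K) {φ : ℂ → ℂ} (hφ : ContinuousOn φ K)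
    (h : ∀ z ∈ K, Complex.exp (φ z) = (z - p) / (z - q)) : False := by
  obtain ⟨g, hg⟩ := ContinuousMap.exists_restrict_eq hK
    (⟨K.domRestrict φ, continuousOn_iff_continuous_domRestrict.1 hφ⟩ : C(K, ℂ))
  have hg' : ∀ z ∈ K, g z = φ z := fun z hz => congrArg (fun f => f ⟨z, hz⟩) hg
  have hqcl : ∀ z ∈ closure U, z - q ≠ 0 := by
    intro z hz
    rw [closure_eq_self_union_frontier] at hz
    refine sub_ne_zero.2 ?_
    rintro rfl
    exact hz.elim hq (fun h => hqK (hfr h))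
  have hpU : ∀ z ∈ Uᶜ, z - p ≠ 0 := fun z hz => sub_ne_zero.2 (by rintro rfl; exact hz hp)
  let H : ℂ → ℂ := fun z => if z ∈ U then Complex.exp (- g z) / (z - q) else 1 / (z - p)
  have hH1 : ContinuousOn H (closure U) := by
    have : ContinuousOn (fun z => Complex.exp (- g z) / (z - q)) (closure U) :=
      ContinuousOn.div (by fun_prop) (by fun_prop) hqcl
    refine this.congr fun z hz => ?_
    by_cases hzU : z ∈ U
    · simp [H, hzU]
    · have hzK : z ∈ K := hfr (by rw [hU.frontier_eq]; exact ⟨hz, hzU⟩)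
      have h1 := hqcl z hz
      have h2 := hpU z hzU
      simp only [H, hzU, if_false, hg' z hzK, Complex.exp_neg, h z hzK]
      field_simp
  have hH2 : ContinuousOn H Uᶜ := by
    have : ContinuousOn (fun z => 1 / (z - p)) Uᶜ :=
      ContinuousOn.div (by fun_prop) (by fun_prop) hpU
    exact this.congr fun z hz => by simp only [H, if_neg (show z ∉ U from hz)]
  have hH : Continuous H := by
    rw [← continuousOn_univ]
    refine (hH1.union_of_isClosed hH2 isClosed_closure hU.isClosed_compl).mono fun z _ => ?_
    by_cases hz : z ∈ U
    · exact Or.inl (subset_closure hz)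
    · exact Or.inr hz
  have hH0 : ∀ z, H z ≠ 0 := by
    intro z
    by_cases hz : z ∈ U
    · simp only [H, hz, if_true]
      exact div_ne_zero (Complex.exp_ne_zero _) (hqcl z (subset_closure hz))
    · simp only [H, hz, if_false]
      exact one_div_ne_zero (hpU z hz)
  obtain ⟨L, hL, hexp⟩ := exists_continuous_log hH hH0
  obtain ⟨R, hR0, hR⟩ := hb.subset_ball_lt 0 p
  let c : ℝ → ℂ := fun t => p + R * Complex.exp (t * Complex.I)
  have hc : Continuous c := by fun_prop
  have hcU : ∀ t, c t ∉ U := by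
    intro t ht
    have := hR ht
    simp [c, Complex.norm_exp_ofReal_mul_I, abs_of_pos hR0] at this
  have key := sub_eq_sub_of_exp_eq (l := fun t => - L (c t))
    (l' := fun t => Real.log R + t * Complex.I) (by fun_prop) (by fun_prop) (fun t => by
      rw [Complex.exp_neg, hexp, Complex.exp_add, ← Complex.ofReal_exp, Real.exp_log hR0]
      simp only [H, if_neg (hcU t), c]
      simp) (2 * Real.pi) 0
  have : c (2 * Real.pi) = c 0 := by simp [c, Complex.exp_two_pi_mul_I]
  rw [this] at key
  simp [Real.pi_ne_zero] at key

theorem isPreconnected_compl_closedBall_complex (R : ℝ) :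
    IsPreconnected (Metric.closedBall (0 : ℂ) R)ᶜ := by
  have h : (Metric.closedBall (0 : ℂ) R)ᶜ =
      (fun x : ℝ × ℝ => (x.1 : ℂ) * Complex.exp (x.2 * Complex.I)) '' (Set.Ioi R ×ˢ Set.univ) := by
    ext z
    simp only [Set.mem_compl_iff, Metric.mem_closedBall, dist_zero_right, not_le, Set.mem_image,
      Set.mem_prod, Set.mem_Ioi, Set.mem_univ, and_true, Prod.exists]
    constructor
    · intro hz
      exact ⟨‖z‖, Complex.arg z, hz, Complex.norm_mul_exp_arg_mul_I z⟩
    · rintro ⟨r, θ, hr, rfl⟩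
      rw [norm_mul, Complex.norm_exp_ofReal_mul_I, mul_one, Complex.norm_real, Real.norm_eq_abs]
      exact hr.trans_le (le_abs_self r)
  rw [h]
  exact (isPreconnected_Ioi.prod isPreconnected_univ).image _ (by fun_prop)

theorem frontier_connectedComponentIn_subset {X : Type*} [TopologicalSpace X]
    [LocallyConnectedSpace X] {D : Set X} (hD : IsClosed D) (z : X) :
    frontier (connectedComponentIn Dᶜ z) ⊆ D := by
  intro y hy
  by_contra hyD
  have ho : IsOpen (connectedComponentIn Dᶜ y) := hD.isOpen_compl.connectedComponentIn
  have hyy : y ∈ connectedComponentIn Dᶜ y := mem_connectedComponentIn hyD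
  obtain ⟨w, hw1, hw2⟩ := mem_closure_iff.1 hy.1 _ ho hyy
  have e : connectedComponentIn Dᶜ z = connectedComponentIn Dᶜ y :=
    (connectedComponentIn_eq hw2).trans (connectedComponentIn_eq hw1).symm
  rw [hD.isOpen_compl.connectedComponentIn.frontier_eq] at hy
  exact hy.2 (e ▸ hyy)

/-- Borsuk's criterion. -/
theorem mem_connectedComponentIn_of_log {K : Set ℂ} (hK : IsCompact K) {p q : ℂ} (hp : p ∉ K)
    (hq : q ∉ K) {φ : ℂ → ℂ} (hφ : ContinuousOn φ K)
    (h : ∀ z ∈ K, Complex.exp (φ z) = (z - p) / (z - q)) :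
    q ∈ connectedComponentIn Kᶜ p := by
  by_contra hn
  have hop : ∀ x, IsOpen (connectedComponentIn Kᶜ x) := fun x =>
    hK.isClosed.isOpen_compl.connectedComponentIn
  have hpp : p ∈ connectedComponentIn Kᶜ p := mem_connectedComponentIn hp
  have hqq : q ∈ connectedComponentIn Kᶜ q := mem_connectedComponentIn hq
  have hn' : p ∉ connectedComponentIn Kᶜ q := fun h' =>
    hn (by rw [← connectedComponentIn_eq h']; exact hqq)
  by_cases hbp : Bornology.IsBounded (connectedComponentIn Kᶜ p)
  · exact false_of_log_of_bounded hK.isClosed (hop p) hbp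
      (frontier_connectedComponentIn_subset hK.isClosed p) hpp hn hq hφ h
  by_cases hbq : Bornology.IsBounded (connectedComponentIn Kᶜ q)
  · refine false_of_log_of_bounded hK.isClosed (hop q) hbq
      (frontier_connectedComponentIn_subset hK.isClosed q) hqq hn' hp (φ := fun z => - φ z)
      hφ.neg fun z hz => ?_
    rw [Complex.exp_neg, h z hz, inv_div]
  obtain ⟨R, hR0, hR⟩ := hK.isBounded.subset_closedBall_lt 0 0
  have hsub : (Metric.closedBall (0 : ℂ) R)ᶜ ⊆ Kᶜ := Set.compl_subset_compl.2 hR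
  have hex : ∀ x, ¬ Bornology.IsBounded (connectedComponentIn Kᶜ x) →
      ∃ y ∈ connectedComponentIn Kᶜ x, y ∈ (Metric.closedBall (0 : ℂ) R)ᶜ := by
    intro x hx
    by_contra! hcon
    exact hx ((Metric.isBounded_closedBall (x := (0 : ℂ)) (r := R)).subset
      fun y hy => by simpa using hcon y hy)
  obtain ⟨y, hy, hyR⟩ := hex p hbp
  obtain ⟨y', hy', hyR'⟩ := hex q hbq
  have := (isPreconnected_compl_closedBall_complex R).subset_connectedComponentIn hyR hsub
    hyR'
  rw [← connectedComponentIn_eq hy] at this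
  have e := (connectedComponentIn_eq this).trans (connectedComponentIn_eq hy').symm
  exact hn (e ▸ hqq)

theorem mem_slitPlane_of_convex {B : Set ℂ} (hB : Convex ℝ B) {s t z : ℂ} (hs : s ∈ B)
    (ht : t ∈ B) (hz : z ∉ B) : (z - s) / (z - t) ∈ Complex.slitPlane := by
  rw [Complex.mem_slitPlane_iff_not_le_zero]
  intro hle
  obtain ⟨x, hx⟩ : ∃ x : ℝ, (z - s) / (z - t) = x := by
    refine ⟨((z - s) / (z - t)).re, ?_⟩
    apply Complex.ext
    · simp
    · simpa using (Complex.le_def.1 hle).2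
  have hx0 : x ≤ 0 := by rw [hx] at hle; exact_mod_cast hle
  have hzt : z - t ≠ 0 := sub_ne_zero.2 (by rintro rfl; exact hz ht)
  rw [div_eq_iff hzt] at hx
  have h1 : (1 - x : ℝ) ≠ 0 := by linarith
  have h1' : (1 - (x : ℂ)) ≠ 0 := by exact_mod_cast h1
  apply hz
  have : z = (1 / (1 - x) : ℝ) • s + (-x / (1 - x) : ℝ) • t := by
    rw [Complex.real_smul, Complex.real_smul]
    push_cast
    field_simp
    linear_combination hx
  rw [this]
  refine hB hs ht (by apply div_nonneg <;> linarith) (by apply div_nonneg <;> linarith) ?_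
  field_simp
  ring

/-- A pendant arc attached to a compact set does not locally separate the plane. -/
theorem mem_component_compl_union_arc_complex {K : Set ℂ} (hK : IsCompact K) {γ : ℝ → ℂ} {r : ℝ}
    (hr : 0 ≤ r) (hγ : ContinuousOn γ (Set.Icc 0 r)) (hinj : Set.InjOn γ (Set.Icc 0 r))
    (hKγ : ∀ τ ∈ Set.Icc 0 r, γ τ ∈ K → τ = 0) {B : Set ℂ} (hB : Convex ℝ B)
    (hBK : Disjoint B K) {s t : ℂ} (hs : s ∈ B) (ht : t ∈ B) (hsγ : s ∉ γ '' Set.Icc 0 r)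
    (htγ : t ∉ γ '' Set.Icc 0 r) :
    t ∈ connectedComponentIn (K ∪ γ '' Set.Icc 0 r)ᶜ s := by
  have hsK := Set.disjoint_left.1 hBK hs
  have htK := Set.disjoint_left.1 hBK ht
  let ψ : ℂ → ℂ := fun z => Complex.log ((z - s) / (z - t))
  have hne : ∀ {u : ℂ} {S : Set ℂ}, u ∉ S → ∀ z ∈ S, z - u ≠ 0 := fun hu z hz =>
    sub_ne_zero.2 (by rintro rfl; exact hu hz)
  have hψ : ContinuousOn ψ K := by
    refine ContinuousOn.clog (ContinuousOn.div (by fun_prop) (by fun_prop) (hne htK)) ?_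
    intro z hz
    exact mem_slitPlane_of_convex hB hs ht (Set.disjoint_right.1 hBK hz)
  let e : Set.Icc 0 r → ℂ := (Set.Icc 0 r).domRestrict γ
  have he : Continuous e := continuousOn_iff_continuous_domRestrict.1 hγ
  have hmem : ∀ x, e x ∈ γ '' Set.Icc 0 r := fun x => Set.mem_image_of_mem _ x.2
  have hcl : Topology.IsClosedEmbedding e := he.isClosedEmbedding (Set.injOn_iff_injective.1 hinj)
  have hf : Continuous fun x : ℝ =>
      (e (Set.projIcc 0 r hr x) - s) / (e (Set.projIcc 0 r hr x) - t) := by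
    refine Continuous.div (by fun_prop) (by fun_prop) fun x => hne htγ _ (hmem _)
  obtain ⟨L, hL, hexp⟩ := exists_continuous_log hf
    (fun x => div_ne_zero (hne hsγ _ (hmem _)) (hne htγ _ (hmem _)))
  let L' : Set.Icc 0 r → ℂ := fun x => L x - L 0 + ψ (γ 0)
  have hL'c : Continuous L' := by fun_prop
  obtain ⟨g, hg⟩ := ContinuousMap.exists_extension hcl (⟨L', hL'c⟩ : C(Set.Icc 0 r, ℂ))
  have hg' : ∀ τ (hτ : τ ∈ Set.Icc 0 r), g (γ τ) = L τ - L 0 + ψ (γ 0) := fun τ hτ =>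
    congrArg (fun f => f ⟨τ, hτ⟩) hg
  have h0 : (0 : ℝ) ∈ Set.Icc 0 r := ⟨le_rfl, hr⟩
  have hexp' : ∀ τ ∈ Set.Icc 0 r, Complex.exp (L τ) = (γ τ - s) / (γ τ - t) := by
    intro τ hτ
    rw [hexp, Set.projIcc_of_mem hr hτ]
    rfl
  have hγ0 : Complex.exp (ψ (γ 0)) = (γ 0 - s) / (γ 0 - t) :=
    Complex.exp_log (div_ne_zero (hne hsγ _ (Set.mem_image_of_mem _ h0))
      (hne htγ _ (Set.mem_image_of_mem _ h0)))
  let φ : ℂ → ℂ := fun z => if z ∈ K then ψ z else g z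
  have hφK : ∀ z ∈ K, φ z = ψ z := fun z hz => if_pos hz
  have hφγ : ∀ τ ∈ Set.Icc 0 r, φ (γ τ) = g (γ τ) := by
    intro τ hτ
    by_cases h : γ τ ∈ K
    · rw [hφK _ h, hg' τ hτ, hKγ τ hτ h]
      ring
    · exact if_neg h
  have hγc : IsCompact (γ '' Set.Icc 0 r) := isCompact_Icc.image_of_continuousOn hγ
  refine mem_connectedComponentIn_of_log (hK.union hγc) (by simp [hsK, hsγ, -Set.mem_image])
    (by simp [htK, htγ, -Set.mem_image]) (φ := φ) ?_ ?_
  · refine (hψ.congr hφK).union_of_isClosed (t := γ '' Set.Icc 0 r)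
      (ContinuousOn.congr (f := g) (by fun_prop) ?_) hK.isClosed hγc.isClosed
    rintro _ ⟨τ, hτ, rfl⟩
    exact hφγ τ hτ
  · rintro z (hz | ⟨τ, hτ, rfl⟩)
    · rw [hφK z hz]
      exact Complex.exp_log (div_ne_zero (hne hsK z hz) (hne htK z hz))
    · rw [hφγ τ hτ, hg' τ hτ, Complex.exp_add, Complex.exp_sub, hexp' τ hτ, hexp' 0 h0, hγ0]
      rw [div_mul_cancel₀]
      exact div_ne_zero (hne hsγ _ (Set.mem_image_of_mem _ h0))
        (hne htγ _ (Set.mem_image_of_mem _ h0))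

theorem not_K33_drawing (a b : Fin 3 → ℝ × ℝ) (S : Fin 3 → Fin 3 → Set (ℝ × ℝ))
    (hS : ∀ i j, JoinedIn (S i j) (a i) (b j))
    (hd : ∀ i j k l, i ≠ k → j ≠ l → Disjoint (S i j) (S k l)) : False := by
  let e := Complex.equivRealProdCLM.symm
  refine not_K33_drawing_complex (fun i => e (a i)) (fun j => e (b j)) (fun i j => e '' S i j)
    (fun i j => (hS i j).map e.continuous) fun i j k l hik hjl => ?_
  exact (Set.disjoint_image_iff e.injective).2 (hd i j k l hik hjl)

theorem mem_component_compl_union_arc {K : Set (ℝ × ℝ)} (hK : IsCompact K) {γ : ℝ → ℝ × ℝ}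
    {r : ℝ} (hr : 0 ≤ r) (hγ : ContinuousOn γ (Set.Icc 0 r)) (hinj : Set.InjOn γ (Set.Icc 0 r))
    (hKγ : ∀ τ ∈ Set.Icc 0 r, γ τ ∈ K → τ = 0) {B : Set (ℝ × ℝ)} (hB : Convex ℝ B)
    (hBK : Disjoint B K) {s t : ℝ × ℝ} (hs : s ∈ B) (ht : t ∈ B) (hsγ : s ∉ γ '' Set.Icc 0 r)
    (htγ : t ∉ γ '' Set.Icc 0 r) :
    t ∈ connectedComponentIn (K ∪ γ '' Set.Icc 0 r)ᶜ s := by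
  let e := Complex.equivRealProdCLM.symm
  have hcomp : ∀ S : Set ℝ, (fun τ => e (γ τ)) '' S = e '' (γ '' S) := fun S => by
    rw [Set.image_image]
  have := mem_component_compl_union_arc_complex (hK.image e.continuous) hr
    (γ := fun τ => e (γ τ)) (e.continuous.comp_continuousOn hγ)
    (fun x hx y hy h => hinj hx hy (e.injective h))
    (fun τ hτ h => hKγ τ hτ ((e.injective.mem_set_image).1 h))
    (B := e '' B) (hB.linear_image e.toLinearEquiv.toLinearMap)
    ((Set.disjoint_image_iff e.injective).2 hBK)
    (Set.mem_image_of_mem e hs) (Set.mem_image_of_mem e ht)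
    (by rw [hcomp, e.injective.mem_set_image]; exact hsγ)
    (by rw [hcomp, e.injective.mem_set_image]; exact htγ)
  rw [hcomp, ← Set.image_union] at this
  have h2 := (ContinuousOn.image_connectedComponentIn_subset e.symm.continuous.continuousOn
    (s := (e '' (K ∪ γ '' Set.Icc 0 r))ᶜ) (a := e s)
    (by
      intro h
      rw [e.injective.mem_set_image] at h
      exact h.elim (Set.disjoint_left.1 hBK hs) hsγ)) (Set.mem_image_of_mem e.symm this)
  rw [← Set.image_compl_eq e.bijective, Set.image_image] at h2
  simpa using h2

section Faces

variable {D D' f g : Set (ℝ × ℝ)}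

theorem IsFaceOf.eq_component (hf : IsFaceOf D f) {z : ℝ × ℝ} (hz : z ∈ f) :
    f = connectedComponentIn Dᶜ z := by
  obtain ⟨w, -, rfl⟩ := hf
  exact connectedComponentIn_eq hz

theorem IsFaceOf.subset_compl (hf : IsFaceOf D f) : f ⊆ Dᶜ := by
  obtain ⟨w, -, rfl⟩ := hf
  exact connectedComponentIn_subset _ _

theorem IsFaceOf.nonempty (hf : IsFaceOf D f) : f.Nonempty := by
  obtain ⟨w, hw, rfl⟩ := hf
  exact ⟨w, mem_connectedComponentIn hw⟩

theorem IsFaceOf.isPreconnected (hf : IsFaceOf D f) : IsPreconnected f := by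
  obtain ⟨w, hw, rfl⟩ := hf
  exact isPreconnected_connectedComponentIn

theorem IsFaceOf.isOpen (hD : IsClosed D) (hf : IsFaceOf D f) : IsOpen f := by
  obtain ⟨w, hw, rfl⟩ := hf
  exact hD.isOpen_compl.connectedComponentIn

theorem IsFaceOf.frontier_subset (hD : IsClosed D) (hf : IsFaceOf D f) : frontier f ⊆ D := by
  obtain ⟨w, hw, rfl⟩ := hf
  exact frontier_connectedComponentIn_subset hD w

theorem IsFaceOf.disjoint (hf : IsFaceOf D f) (hg : IsFaceOf D g) (hfg : f ≠ g) :
    Disjoint f g := by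
  refine Set.disjoint_left.2 fun z hz hz' => hfg ?_
  rw [hf.eq_component hz, hg.eq_component hz']

theorem IsFaceOf.joinedIn (hD : IsClosed D) (hf : IsFaceOf D f) {z w : ℝ × ℝ} (hz : z ∈ f)
    (hw : w ∈ f) : JoinedIn f z w :=
  ((IsOpen.isConnected_iff_isPathConnected (hf.isOpen hD)).1
    ⟨hf.nonempty, hf.isPreconnected⟩).joinedIn z hz w hw

theorem IsFaceOf.subset_of_isPreconnected (hf : IsFaceOf D f) {s : Set (ℝ × ℝ)}
    (hs : IsPreconnected s) (hsD : s ⊆ Dᶜ) {z : ℝ × ℝ} (hz : z ∈ s) (hzf : z ∈ f) : s ⊆ f := by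
  rw [hf.eq_component hzf]
  exact hs.subset_connectedComponentIn hz hsD

theorem exists_isFaceOf_mem {z : ℝ × ℝ} (hz : z ∉ D) : ∃ f, IsFaceOf D f ∧ z ∈ f :=
  ⟨_, ⟨z, hz, rfl⟩, mem_connectedComponentIn hz⟩

/-- A face stays a face when parts of the drawing off its frontier are deleted. -/
theorem IsFaceOf.of_frontier_subset (hD : IsClosed D) (hf : IsFaceOf D f) (hDD' : D' ⊆ D)
    (hfr : frontier f ⊆ D') : IsFaceOf D' f := by
  obtain ⟨z, hz⟩ := hf.nonempty
  have hzD : z ∉ D' := fun h => hf.subset_compl hz (hDD' h)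
  refine ⟨z, hzD, Set.Subset.antisymm ?_ ?_⟩
  · exact hf.isPreconnected.subset_connectedComponentIn hz
      (hf.subset_compl.trans (Set.compl_subset_compl.2 hDD'))
  · refine isPreconnected_connectedComponentIn.subset_of_closure_inter_subset (hf.isOpen hD)
      ⟨z, mem_connectedComponentIn hzD, hz⟩ ?_
    rintro w ⟨hw, hw'⟩
    by_contra hwf
    refine connectedComponentIn_subset _ _ hw' (hfr ?_)
    rw [(hf.isOpen hD).frontier_eq]
    exact ⟨hw, hwf⟩

/-- Near the tip of a pendant arc of its boundary, a face covers the whole plane. -/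
theorem IsFaceOf.exists_isOpen_of_tip (hD : IsClosed D) (hf : IsFaceOf D f)
    {K : Set (ℝ × ℝ)} (hK : IsCompact K) {γ : ℝ → ℝ × ℝ}
    {r : ℝ} (hr : 0 ≤ r) (hγ : ContinuousOn γ (Set.Icc 0 r)) (hinj : Set.InjOn γ (Set.Icc 0 r))
    (hKγ : ∀ τ ∈ Set.Icc 0 r, γ τ ∈ K → τ = 0) (hfr : frontier f ⊆ K ∪ γ '' Set.Icc 0 r)
    (hKD : K ∪ γ '' Set.Icc 0 r ⊆ D) (hrK : γ r ∉ K) (hrf : γ r ∈ closure f) :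
    ∃ B, IsOpen B ∧ γ r ∈ B ∧ B \ γ '' Set.Icc 0 r ⊆ f := by
  have hf' := hf.of_frontier_subset hD hKD hfr
  obtain ⟨ε, hε, hB⟩ := Metric.isOpen_iff.1 hK.isClosed.isOpen_compl (γ r) hrK
  refine ⟨Metric.ball (γ r) ε, Metric.isOpen_ball, Metric.mem_ball_self hε, ?_⟩
  obtain ⟨s, hsB, hsf⟩ := mem_closure_iff.1 hrf _ Metric.isOpen_ball (Metric.mem_ball_self hε)
  rintro t ⟨htB, ht⟩
  rw [hf'.eq_component hsf]
  exact mem_component_compl_union_arc hK hr hγ hinj hKγ (convex_ball _ _)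
    (Set.disjoint_left.2 hB) hsB htB (fun h => hf'.subset_compl hsf (Or.inr h)) ht

theorem IsFaceOf.mem_closure_arc_of_le (hf : IsFaceOf D f) {D₀ : Set (ℝ × ℝ)}
    (hD₀ : IsCompact D₀) {γ : ℝ → ℝ × ℝ} (hγ : ContinuousOn γ (Set.Icc 0 1))
    (hinj : Set.InjOn γ (Set.Icc 0 1)) (hDγ : D = D₀ ∪ γ '' Set.Icc 0 1)
    (h01 : ∀ τ ∈ Set.Icc (0 : ℝ) 1, γ τ ∈ D₀ → τ = 0 ∨ τ = 1) {s₀ s₁ : ℝ} (h₁ : 0 < s₁)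
    (hs : s₁ ≤ s₀) (h₀ : s₀ ≤ 1) (hsf : γ s₁ ∈ closure f) : γ s₀ ∈ closure f := by
  by_contra hcon
  have hcD : IsCompact D := hDγ ▸ hD₀.union (isCompact_Icc.image_of_continuousOn hγ)
  have hsub : Set.Icc s₁ s₀ ⊆ Set.Icc 0 1 := Set.Icc_subset_Icc h₁.le h₀
  have hcl : IsCompact (Set.Icc s₁ s₀ ∩ γ ⁻¹' closure f) :=
    isCompact_Icc.of_isClosed_subset
      ((hγ.mono hsub).preimage_isClosed_of_isClosed isClosed_Icc isClosed_closure)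
      Set.inter_subset_left
  obtain ⟨r, ⟨hr, hrf⟩, hmax⟩ := hcl.exists_isGreatest ⟨s₁, ⟨le_rfl, hs⟩, hsf⟩
  have hrs : r < s₀ := lt_of_le_of_ne hr.2 (by rintro rfl; exact hcon hrf)
  have hr0 : 0 < r := h₁.trans_le hr.1
  have hr1 : Set.Icc 0 r ⊆ Set.Icc 0 1 := Set.Icc_subset_Icc le_rfl (hr.2.trans h₀)
  have h1s : Set.Icc s₀ 1 ⊆ Set.Icc (0 : ℝ) 1 := Set.Icc_subset_Icc (h₁.le.trans hs) le_rfl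
  have hKγ : ∀ τ ∈ Set.Icc 0 r, γ τ ∈ D₀ ∪ γ '' Set.Icc s₀ 1 → τ = 0 := by
    rintro τ hτ (h | ⟨σ, hσ, h⟩)
    · refine (h01 τ (hr1 hτ) h).resolve_right ?_
      have := hτ.2
      intro h
      linarith
    · have := hinj (h1s hσ) (hr1 hτ) h
      have := hτ.2
      have := hσ.1
      linarith
  have hrr : r ∈ Set.Icc 0 r := ⟨hr0.le, le_rfl⟩
  obtain ⟨B, hB, hrB, hBf⟩ := hf.exists_isOpen_of_tip hcD.isClosed
    (K := D₀ ∪ γ '' Set.Icc s₀ 1)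
    (hD₀.union (isCompact_Icc.image_of_continuousOn (hγ.mono h1s))) hr0.le (hγ.mono hr1)
    (hinj.mono hr1) hKγ (by
      intro z hz
      have := hf.frontier_subset hcD.isClosed hz
      rw [hDγ] at this
      obtain h | ⟨τ, hτ, rfl⟩ := this
      · exact Or.inl (Or.inl h)
      · by_cases h1 : τ ≤ r
        · exact Or.inr ⟨τ, ⟨hτ.1, h1⟩, rfl⟩
        · by_cases h2 : s₀ ≤ τ
          · exact Or.inl (Or.inr ⟨τ, ⟨h2, hτ.2⟩, rfl⟩)
          · push Not at h1 h2
            exact absurd (hmax ⟨⟨hr.1.trans h1.le, h2.le⟩, frontier_subset_closure hz⟩)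
              (not_le.2 h1))
    (by
      rw [hDγ]
      refine Set.union_subset (Set.union_subset Set.subset_union_left ?_) ?_
      · exact (Set.image_mono h1s).trans Set.subset_union_right
      · exact (Set.image_mono hr1).trans Set.subset_union_right)
    (fun h => hr0.ne' (hKγ r hrr h)) hrf
  have hcont : ContinuousWithinAt γ (Set.Icc 0 1) r := hγ r (hr1 hrr)
  have hev : ∀ᶠ σ in nhdsWithin r (Set.Ioo r s₀), γ σ ∈ B :=
    (hcont.mono fun σ hσ => ⟨hr0.le.trans hσ.1.le, hσ.2.le.trans h₀⟩).eventually
      (hB.mem_nhds hrB)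
  have : (nhdsWithin r (Set.Ioo r s₀)).NeBot := left_nhdsWithin_Ioo_neBot hrs
  obtain ⟨σ, hσB, hσ⟩ := (hev.and self_mem_nhdsWithin).exists
  have hσ1 : σ ∈ Set.Icc (0 : ℝ) 1 := ⟨hr0.le.trans hσ.1.le, hσ.2.le.trans h₀⟩
  refine hf.subset_compl (hBf ⟨hσB, ?_⟩) (hDγ ▸ Or.inr ⟨σ, hσ1, rfl⟩)
  rintro ⟨τ, hτ, h⟩
  have := hinj (hr1 hτ) hσ1 h
  have := hτ.2
  have := hσ.1
  linarith

/-- If an interior point of an arc lies on the boundary of a face, so does the whole arc. -/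
theorem IsFaceOf.arc_subset_closure (hf : IsFaceOf D f) {D₀ : Set (ℝ × ℝ)}
    (hD₀ : IsCompact D₀) {γ : ℝ → ℝ × ℝ} (hγ : ContinuousOn γ (Set.Icc 0 1))
    (hinj : Set.InjOn γ (Set.Icc 0 1)) (hDγ : D = D₀ ∪ γ '' Set.Icc 0 1)
    (h01 : ∀ τ ∈ Set.Icc (0 : ℝ) 1, γ τ ∈ D₀ → τ = 0 ∨ τ = 1) {s : ℝ} (h₁ : 0 < s)
    (h₂ : s < 1) (hsf : γ s ∈ closure f) : γ '' Set.Icc 0 1 ⊆ closure f := by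
  rintro _ ⟨t, ht, rfl⟩
  obtain h | h := le_total s t
  · exact hf.mem_closure_arc_of_le hD₀ hγ hinj hDγ h01 h₁ h ht.2 hsf
  · have hmaps : Set.MapsTo (fun x : ℝ => 1 - x) (Set.Icc 0 1) (Set.Icc 0 1) :=
      fun x hx => ⟨by linarith [hx.2], by linarith [hx.1]⟩
    have := hf.mem_closure_arc_of_le hD₀ (γ := fun x => γ (1 - x)) (s₁ := 1 - s) (s₀ := 1 - t)
      (hγ.comp (by fun_prop) hmaps)
      (fun x hx y hy hxy => by have := hinj (hmaps hx) (hmaps hy) hxy; linarith) (by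
        rw [hDγ]
        congr 1
        ext z
        constructor
        · rintro ⟨x, hx, rfl⟩
          exact ⟨1 - x, hmaps hx, by simp⟩
        · rintro ⟨x, hx, rfl⟩
          exact ⟨1 - x, hmaps hx, rfl⟩)
      (fun τ hτ hm => by
        have := h01 _ (hmaps hτ) hm
        rcases this with h | h
        · right; linarith
        · left; linarith) (by linarith) (by linarith) (by linarith [ht.1]) (by simpa using hsf)
    simpa using this

/-- Boundary points from which a face is accessible are dense in the boundary. -/
theorem IsFaceOf.exists_accessible (hD : IsClosed D) (hf : IsFaceOf D f) {p : ℝ × ℝ}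
    (hpD : p ∈ D) (hpf : p ∈ closure f) {U : Set (ℝ × ℝ)} (hU : IsOpen U) (hpU : p ∈ U) :
    ∃ p' ∈ U, p' ∈ D ∧ ∀ z ∈ f, JoinedIn (f ∪ {p'}) z p' := by
  obtain ⟨ε, hε, hB⟩ := Metric.isOpen_iff.1 hU p hpU
  obtain ⟨q, hqB, hqf⟩ := mem_closure_iff.1 hpf _ Metric.isOpen_ball (Metric.mem_ball_self hε)
  let l : ℝ → ℝ × ℝ := fun t => AffineMap.lineMap q p t
  have hl : Continuous l := AffineMap.lineMap_continuous
  have hcl : IsCompact (Set.Icc 0 1 ∩ l ⁻¹' D) :=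
    isCompact_Icc.inter_right (hD.preimage hl)
  obtain ⟨r, ⟨hr, hrD⟩, hmin⟩ := hcl.exists_isLeast
    ⟨1, ⟨zero_le_one, le_rfl⟩, by simpa [l] using hpD⟩
  have hl0 : l 0 = q := by simp [l]
  have hsub : l '' Set.Ico 0 r ⊆ f := by
    by_cases hr0 : 0 < r
    · refine hf.subset_of_isPreconnected (isPreconnected_Ico.image _ hl.continuousOn) ?_
        ⟨0, ⟨le_rfl, hr0⟩, hl0⟩ hqf
      rintro _ ⟨t, ht, rfl⟩ htD
      exact absurd (hmin ⟨⟨ht.1, ht.2.le.trans hr.2⟩, htD⟩) (not_le.2 ht.2)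
    · rw [Set.Ico_eq_empty hr0]
      simp
  have hj : JoinedIn (f ∪ {l r}) q (l r) := by
    have : JoinedIn (l '' Set.Icc 0 r) (l 0) (l r) :=
      ((convex_Icc 0 r).isPathConnected ⟨0, le_rfl, hr.1⟩ |>.image hl).joinedIn _
        ⟨0, ⟨le_rfl, hr.1⟩, rfl⟩ _ ⟨r, ⟨hr.1, le_rfl⟩, rfl⟩
    rw [hl0] at this
    refine this.mono ?_
    rintro _ ⟨t, ht, rfl⟩
    obtain h | h := ht.2.lt_or_eq
    · exact Or.inl (hsub ⟨t, ⟨ht.1, h⟩, rfl⟩)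
    · exact Or.inr (h ▸ rfl)
  refine ⟨l r, hB ?_, hrD,
    fun z hz => ((hf.joinedIn hD hz hqf).mono Set.subset_union_left).trans hj⟩
  exact (convex_ball p ε).lineMap_mem hqB (Metric.mem_ball_self hε) hr

end Faces

theorem joinedIn_image_Icc {γ : ℝ → ℝ × ℝ} {a b s t : ℝ} (hγ : ContinuousOn γ (Set.Icc a b))
    (hs : s ∈ Set.Icc a b) (ht : t ∈ Set.Icc a b) : JoinedIn (γ '' Set.Icc a b) (γ s) (γ t) :=
  (((convex_Icc a b).isPathConnected ⟨s, hs⟩).image' hγ).joinedIn _ ⟨s, hs, rfl⟩ _ ⟨t, ht, rfl⟩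

/-- An arc lies on the boundary of at most two faces. -/
theorem false_of_three_faces {D : Set (ℝ × ℝ)} {f : Fin 3 → Set (ℝ × ℝ)}
    (hf : ∀ i, IsFaceOf D (f i)) (hne : Function.Injective f) {D₀ : Set (ℝ × ℝ)}
    (hD₀ : IsCompact D₀) {γ : ℝ → ℝ × ℝ} (hγ : ContinuousOn γ (Set.Icc 0 1))
    (hinj : Set.InjOn γ (Set.Icc 0 1)) (hDγ : D = D₀ ∪ γ '' Set.Icc 0 1)
    (h01 : ∀ τ ∈ Set.Icc (0 : ℝ) 1, γ τ ∈ D₀ → τ = 0 ∨ τ = 1)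
    (hcl : ∀ i, γ '' Set.Icc 0 1 ⊆ closure (f i)) : False := by
  have hcD : IsCompact D := hDγ ▸ hD₀.union (isCompact_Icc.image_of_continuousOn hγ)
  let m : Fin 3 → ℝ := fun j => (j + 1) / 4
  have hm0 : ∀ j, 1 / 4 ≤ m j := by
    intro j
    have : (0 : ℝ) ≤ (j : ℕ) := Nat.cast_nonneg _
    simp only [m]
    linarith
  have hm1 : ∀ j, m j ≤ 3 / 4 := by
    intro j
    have : ((j : ℕ) : ℝ) ≤ 2 := by exact_mod_cast Nat.le_of_lt_succ j.2
    simp only [m]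
    linarith
  let I : Fin 3 → Set ℝ := fun j => Set.Icc (m j - 1 / 16) (m j + 1 / 16)
  have hI : ∀ j, I j ⊆ Set.Icc 0 1 := fun j =>
    Set.Icc_subset_Icc (by linarith [hm0 j]) (by linarith [hm1 j])
  have hID : ∀ j, γ '' I j ⊆ D := fun j =>
    hDγ ▸ (Set.image_mono (hI j)).trans Set.subset_union_right
  have hmI : ∀ j, m j ∈ I j := fun j => ⟨by linarith, by linarith⟩
  choose z hz using fun i => (hf i).nonempty
  refine not_K33_drawing z (fun j => γ (m j)) (fun i j => f i ∪ γ '' I j) ?_ ?_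
  · intro i j
    let L : Set ℝ := Set.Icc 0 (m j - 1 / 16) ∪ Set.Icc (m j + 1 / 16) 1
    have hL : L ⊆ Set.Icc 0 1 := Set.union_subset
      (Set.Icc_subset_Icc le_rfl (by linarith [hm1 j]))
      (Set.Icc_subset_Icc (by linarith [hm0 j]) le_rfl)
    have hK : IsCompact (D₀ ∪ γ '' L) := hD₀.union
      ((isCompact_Icc.union isCompact_Icc).image_of_continuousOn (hγ.mono hL))
    obtain ⟨p, hpU, hpD, hp⟩ := (hf i).exists_accessible hcD.isClosed (p := γ (m j))
      (hID j ⟨_, hmI j, rfl⟩) (hcl i ⟨_, hI j (hmI j), rfl⟩) hK.isClosed.isOpen_compl (by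
        rintro (h | ⟨τ, hτ, h⟩)
        · have := h01 _ (hI j (hmI j)) h
          have := hm0 j
          have := hm1 j
          rcases ‹m j = 0 ∨ m j = 1› with h | h <;> linarith
        · have := hinj (hL hτ) (hI j (hmI j)) h
          rcases hτ with hτ | hτ
          · have := hτ.2
            linarith
          · have := hτ.1
            linarith)
    obtain ⟨τ, hτ, rfl⟩ : p ∈ γ '' I j := by
      rw [hDγ] at hpD
      obtain h | ⟨τ, hτ, rfl⟩ := hpD
      · exact absurd (Or.inl h) hpU
      · refine ⟨τ, ⟨?_, ?_⟩, rfl⟩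
        · by_contra! h
          exact hpU (Or.inr ⟨τ, Or.inl ⟨hτ.1, h.le⟩, rfl⟩)
        · by_contra! h
          exact hpU (Or.inr ⟨τ, Or.inr ⟨h.le, hτ.2⟩, rfl⟩)
    refine ((hp _ (hz i)).mono ?_).trans
      ((joinedIn_image_Icc (hγ.mono (hI j)) hτ (hmI j)).mono Set.subset_union_right)
    exact Set.union_subset_union_right _ (Set.singleton_subset_iff.2 ⟨τ, hτ, rfl⟩)
  · intro i j k l hik hjl
    have hd : ∀ i j, Disjoint (f i) (γ '' I j) := fun i j =>
      Set.disjoint_left.2 fun z hz hz' => (hf i).subset_compl hz (hID j hz')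
    rw [Set.disjoint_union_left, Set.disjoint_union_right, Set.disjoint_union_right]
    refine ⟨⟨(hf i).disjoint (hf k) (hne.ne hik), hd i l⟩, (hd k j).symm, ?_⟩
    rw [Set.disjoint_left]
    rintro _ ⟨σ, hσ, rfl⟩ ⟨τ, hτ, h⟩
    have := hinj (hI l hτ) (hI j hσ) h
    subst this
    apply hjl
    have h1 := hσ.1
    have h2 := hσ.2
    have h3 := hτ.1
    have h4 := hτ.2
    simp only [m] at h1 h2 h3 h4
    have h5 : ((j : ℕ) : ℝ) < (l : ℕ) + 1 := by linarith
    have h6 : ((l : ℕ) : ℝ) < (j : ℕ) + 1 := by linarith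
    norm_cast at h5 h6
    exact Fin.ext (by omega)

section Drawings

variable {V : Type*} {G : SimpleGraph V} {emb : PlaneEmbedding G}
  {J J' : SimpleGraph V} {f : Set (ℝ × ℝ)}

theorem mem_drawing {z : ℝ × ℝ} : z ∈ drawingOn emb J Set.univ ↔
    (∃ v, emb.pos v = z) ∨ ∃ u v, J.Adj u v ∧ z ∈ emb.arc u v := by
  simp [drawingOn]

theorem pos_mem_drawing (v : V) : emb.pos v ∈ drawingOn emb J Set.univ :=
  mem_drawing.2 (Or.inl ⟨v, rfl⟩)

theorem arc_subset_drawing {u v : V} (h : J.Adj u v) :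
    emb.arc u v ⊆ drawingOn emb J Set.univ := fun _ hz => mem_drawing.2 (Or.inr ⟨u, v, h, hz⟩)

theorem drawing_mono (h : J' ≤ J) :
    drawingOn emb J' Set.univ ⊆ drawingOn emb J Set.univ := by
  intro z hz
  rw [mem_drawing] at hz ⊢
  exact hz.imp_right fun ⟨u, v, huv, hz⟩ => ⟨u, v, h huv, hz⟩

theorem isCompact_arc {u v : V} (h : G.Adj u v) : IsCompact (emb.arc u v) := by
  obtain ⟨γ, hγ, -, -, -, him⟩ := emb.arc_curve u v h
  exact him ▸ isCompact_Icc.image_of_continuousOn hγ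

theorem pos_left_mem_arc {u v : V} (h : G.Adj u v) : emb.pos u ∈ emb.arc u v := by
  obtain ⟨γ, -, -, h0, -, him⟩ := emb.arc_curve u v h
  exact him ▸ ⟨0, ⟨le_rfl, zero_le_one⟩, h0⟩

theorem pos_right_mem_arc {u v : V} (h : G.Adj u v) : emb.pos v ∈ emb.arc u v :=
  emb.arc_symm v u ▸ pos_left_mem_arc h.symm

theorem exists_pos_eq_of_mem_arc_arc {u v x y : V} (h : G.Adj u v) (h' : G.Adj x y)
    (hne : s(u, v) ≠ s(x, y)) {z : ℝ × ℝ} (hz : z ∈ emb.arc u v) (hz' : z ∈ emb.arc x y) :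
    ∃ w, emb.pos w = z ∧ (w = u ∨ w = v) ∧ (w = x ∨ w = y) := by
  obtain ⟨w, rfl⟩ := emb.arc_inter u v x y h h' hne ⟨hz, hz'⟩
  exact ⟨w, rfl, emb.arc_vertex u v h w hz, emb.arc_vertex x y h' w hz'⟩

theorem exists_param_approach {u v : V} (h : G.Adj u v) {B : Set (ℝ × ℝ)} (hB : IsOpen B)
    (hu : emb.pos u ∈ B) : ∃ z ∈ B, z ∈ emb.arc u v ∧ ∀ w, emb.pos w ≠ z := by
  obtain ⟨γ, hγ, hinj, h0, h1, him⟩ := emb.arc_curve u v h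
  have hcont : ContinuousWithinAt γ (Set.Icc 0 1) 0 := hγ 0 ⟨le_rfl, zero_le_one⟩
  have hev : ∀ᶠ σ in nhdsWithin 0 (Set.Ioo 0 1), γ σ ∈ B :=
    (hcont.mono Set.Ioo_subset_Icc_self).eventually (hB.mem_nhds (h0 ▸ hu))
  have : (nhdsWithin (0 : ℝ) (Set.Ioo 0 1)).NeBot := left_nhdsWithin_Ioo_neBot zero_lt_one
  obtain ⟨σ, hσB, hσ⟩ := (hev.and self_mem_nhdsWithin).exists
  have hσ' := Set.Ioo_subset_Icc_self hσ
  have hσa : γ σ ∈ emb.arc u v := him ▸ ⟨σ, hσ', rfl⟩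
  refine ⟨γ σ, hσB, hσa, fun w hw => ?_⟩
  rcases emb.arc_vertex u v h w (hw ▸ hσa) with rfl | rfl
  · exact hσ.1.ne (hinj ⟨le_rfl, zero_le_one⟩ hσ' (h0.trans hw))
  · exact hσ.2.ne' (hinj ⟨zero_le_one, le_rfl⟩ hσ' (h1.trans hw))

theorem joinedIn_drawingOn_of_adj (hJ : J ≤ G) {L : Set V} {a b : V} (h : J.Adj a b) (ha : a ∈ L)
    (hb : b ∈ L) : JoinedIn (drawingOn emb J L) (emb.pos a) (emb.pos b) := by
  obtain ⟨γ, hγ, hinj, h0, h1, him⟩ := emb.arc_curve a b (hJ h)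
  have := joinedIn_image_Icc hγ (s := 0) (t := 1) ⟨le_rfl, zero_le_one⟩ ⟨zero_le_one, le_rfl⟩
  rw [h0, h1, him] at this
  refine this.mono fun z hz => Or.inr ?_
  simp only [Set.mem_iUnion]
  exact ⟨a, b, h, ha, hb, hz⟩

theorem joinedIn_drawingOn_refl {L : Set V} {a : V} (ha : a ∈ L) :
    JoinedIn (drawingOn emb J L) (emb.pos a) (emb.pos a) :=
  JoinedIn.refl (Or.inl ⟨a, ha, rfl⟩)

theorem drawingOn_mono {L L' : Set V} (h : L ⊆ L') : drawingOn emb J L ⊆ drawingOn emb J L' := by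
  rintro z (⟨v, hv, rfl⟩ | hz)
  · exact Or.inl ⟨v, h hv, rfl⟩
  · simp only [Set.mem_iUnion] at hz
    obtain ⟨u, v, huv, hu, hv, hz⟩ := hz
    refine Or.inr ?_
    simp only [Set.mem_iUnion]
    exact ⟨u, v, huv, h hu, h hv, hz⟩

theorem eq_of_mem_arc_drawingOn (hJ : J ≤ G) {L : Set V} {u v : V} (huv : G.Adj u v)
    (hv : v ∉ L) {z : ℝ × ℝ} (hz : z ∈ emb.arc u v) (hzL : z ∈ drawingOn emb J L) :
    z = emb.pos u := by
  obtain ⟨w, hw, rfl⟩ | hzL := hzL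
  · rcases emb.arc_vertex u v huv w hz with rfl | rfl
    · rfl
    · exact absurd hw hv
  · simp only [Set.mem_iUnion] at hzL
    obtain ⟨x, y, hxy, hx, hy, hzx⟩ := hzL
    obtain ⟨w, rfl, h1, h2⟩ := exists_pos_eq_of_mem_arc_arc huv (hJ hxy) (by
      intro h
      rcases Sym2.eq_iff.1 h with ⟨-, rfl⟩ | ⟨-, rfl⟩
      · exact hv hy
      · exact hv hx) hz hzx
    rcases h1 with rfl | rfl
    · rfl
    · rcases h2 with rfl | rfl
      · exact absurd hx hv
      · exact absurd hy hv

theorem disjoint_drawingOn (hJ : J ≤ G) {L R : Set V} (hLR : Disjoint L R) :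
    Disjoint (drawingOn emb J L) (drawingOn emb J R) := by
  rw [Set.disjoint_left]
  rintro z hzL (⟨w, hw, rfl⟩ | hzR)
  · obtain ⟨w', hw', h⟩ | hzL := hzL
    · exact Set.disjoint_left.1 hLR hw' (emb.pos_injective h ▸ hw)
    · simp only [Set.mem_iUnion] at hzL
      obtain ⟨x, y, hxy, hx, hy, hz⟩ := hzL
      rcases emb.arc_vertex x y (hJ hxy) w hz with rfl | rfl
      · exact Set.disjoint_left.1 hLR hx hw
      · exact Set.disjoint_left.1 hLR hy hw
  · simp only [Set.mem_iUnion] at hzR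
    obtain ⟨x, y, hxy, hx, hy, hz⟩ := hzR
    have h1 := eq_of_mem_arc_drawingOn hJ (hJ hxy) (Set.disjoint_right.1 hLR hy) hz hzL
    have h2 := eq_of_mem_arc_drawingOn hJ (hJ hxy.symm) (Set.disjoint_right.1 hLR hx)
      (emb.arc_symm x y ▸ hz) hzL
    exact hxy.ne (emb.pos_injective (h1.symm.trans h2))

theorem exists_isFaceOf_of_arc (hJ : J ≤ G) {u v : V} (huv : G.Adj u v) (hn : ¬ J.Adj u v) :
    ∃ h, IsFaceOf (drawingOn emb J Set.univ) h ∧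
      (∀ z ∈ emb.arc u v, (∀ w, emb.pos w ≠ z) → z ∈ h) ∧ emb.arc u v ⊆ closure h := by
  obtain ⟨γ, hγ, hinj, h0, h1, him⟩ := emb.arc_curve u v huv
  have hmem : ∀ τ ∈ Set.Icc (0 : ℝ) 1, γ τ ∈ emb.arc u v := fun τ hτ => him ▸ ⟨τ, hτ, rfl⟩
  have hI : Set.Ioo (0 : ℝ) 1 ⊆ Set.Icc 0 1 := Set.Ioo_subset_Icc_self
  have hD : ∀ z ∈ emb.arc u v, (∀ w, emb.pos w ≠ z) → z ∉ drawingOn emb J Set.univ := by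
    intro z hz hzv hzD
    obtain ⟨w, hw⟩ | ⟨x, y, hxy, hzx⟩ := mem_drawing.1 hzD
    · exact hzv w hw
    · obtain ⟨w, hw, -⟩ := exists_pos_eq_of_mem_arc_arc huv (hJ hxy) (by
        intro h
        rcases Sym2.eq_iff.1 h with ⟨rfl, rfl⟩ | ⟨rfl, rfl⟩
        · exact hn hxy
        · exact hn hxy.symm) hz hzx
      exact hzv w hw
  have hV : ∀ τ ∈ Set.Ioo (0 : ℝ) 1, ∀ w, emb.pos w ≠ γ τ := by
    intro τ hτ w hw
    rcases emb.arc_vertex u v huv w (hw ▸ hmem τ (hI hτ)) with rfl | rfl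
    · exact hτ.1.ne (hinj ⟨le_rfl, zero_le_one⟩ (hI hτ) (h0.trans hw))
    · exact hτ.2.ne' (hinj ⟨zero_le_one, le_rfl⟩ (hI hτ) (h1.trans hw))
  have hsub : γ '' Set.Ioo 0 1 ⊆ (drawingOn emb J Set.univ)ᶜ := by
    rintro _ ⟨τ, hτ, rfl⟩
    exact hD _ (hmem τ (hI hτ)) (hV τ hτ)
  have hhalf : (1 / 2 : ℝ) ∈ Set.Ioo (0 : ℝ) 1 := by norm_num
  obtain ⟨h, hh, hm⟩ := exists_isFaceOf_mem (hsub ⟨_, hhalf, rfl⟩)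
  have hsub' : γ '' Set.Ioo 0 1 ⊆ h := hh.subset_of_isPreconnected
    (isPreconnected_Ioo.image _ (hγ.mono hI)) hsub ⟨_, hhalf, rfl⟩ hm
  refine ⟨h, hh, ?_, ?_⟩
  · intro z hz hzv
    rw [← him] at hz
    obtain ⟨τ, hτ, rfl⟩ := hz
    refine hsub' ⟨τ, ⟨lt_of_le_of_ne hτ.1 ?_, lt_of_le_of_ne hτ.2 ?_⟩, rfl⟩
    · rintro rfl
      exact hzv u h0.symm
    · rintro rfl
      exact hzv v h1.symm
  · rw [← him, ← closure_Ioo (zero_ne_one (α := ℝ))]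
    refine (ContinuousOn.image_closure ?_).trans (closure_mono hsub')
    rwa [closure_Ioo (zero_ne_one (α := ℝ))]

variable [Fintype V]

theorem isCompact_drawingOn (hJ : J ≤ G) (s : Set V) : IsCompact (drawingOn emb J s) := by
  refine (s.toFinite.image _).isCompact.union ?_
  refine isCompact_iUnion fun u => isCompact_iUnion fun v => isCompact_iUnion fun h =>
    isCompact_iUnion fun _ => isCompact_iUnion fun _ => isCompact_arc (hJ h)

theorem exists_arc_param (hJ : J ≤ G) {u v : V} (h : J.Adj u v) :
    ∃ (γ : ℝ → ℝ × ℝ) (D₀ : Set (ℝ × ℝ)), ContinuousOn γ (Set.Icc 0 1) ∧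
      Set.InjOn γ (Set.Icc 0 1) ∧ γ 0 = emb.pos u ∧ γ 1 = emb.pos v ∧
      γ '' Set.Icc 0 1 = emb.arc u v ∧ IsCompact D₀ ∧
      drawingOn emb J Set.univ = D₀ ∪ γ '' Set.Icc 0 1 ∧
      ∀ τ ∈ Set.Icc (0 : ℝ) 1, γ τ ∈ D₀ → τ = 0 ∨ τ = 1 := by
  obtain ⟨γ, hγ, hinj, h0, h1, him⟩ := emb.arc_curve u v (hJ h)
  refine ⟨γ, drawingOn emb (J.deleteEdges {s(u, v)}) Set.univ, hγ, hinj, h0, h1, him,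
    isCompact_drawingOn ((SimpleGraph.deleteEdges_le _).trans hJ) _, ?_, ?_⟩
  · rw [him]
    refine Set.Subset.antisymm ?_ (Set.union_subset (drawing_mono (SimpleGraph.deleteEdges_le _))
      (arc_subset_drawing h))
    intro z hz
    rw [mem_drawing] at hz
    obtain hz | ⟨x, y, hxy, hz⟩ := hz
    · exact Or.inl (mem_drawing.2 (Or.inl hz))
    · by_cases he : s(x, y) = s(u, v)
      · right
        rcases Sym2.eq_iff.1 he with ⟨rfl, rfl⟩ | ⟨rfl, rfl⟩
        · exact hz
        · exact emb.arc_symm _ _ ▸ hz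
      · exact Or.inl (mem_drawing.2 (Or.inr
          ⟨x, y, by simp [SimpleGraph.deleteEdges_adj, hxy, he], hz⟩))
  · intro τ hτ hz
    have hτa : γ τ ∈ emb.arc u v := him ▸ ⟨τ, hτ, rfl⟩
    have key : ∀ w, emb.pos w = γ τ → τ = 0 ∨ τ = 1 := by
      intro w hw
      rcases emb.arc_vertex u v (hJ h) w (hw ▸ hτa) with rfl | rfl
      · exact Or.inl (hinj hτ ⟨le_rfl, zero_le_one⟩ (hw.symm.trans h0.symm))
      · exact Or.inr (hinj hτ ⟨zero_le_one, le_rfl⟩ (hw.symm.trans h1.symm))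
    rw [mem_drawing] at hz
    obtain ⟨w, hw⟩ | ⟨x, y, hxy, hz⟩ := hz
    · exact key w hw
    · rw [SimpleGraph.deleteEdges_adj] at hxy
      obtain ⟨w, hw, -⟩ := exists_pos_eq_of_mem_arc_arc (hJ h) (hJ hxy.1) (Ne.symm hxy.2) hτa hz
      exact key w hw

theorem arc_subset_closure_of_mem (hJ : J ≤ G) (hf : IsFaceOf (drawingOn emb J Set.univ) f)
    {u v : V} (h : J.Adj u v) {z : ℝ × ℝ} (hz : z ∈ emb.arc u v) (hzf : z ∈ closure f)
    (hzv : ∀ w, emb.pos w ≠ z) : emb.arc u v ⊆ closure f := by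
  obtain ⟨γ, D₀, hγ, hinj, h0, h1, him, hD₀, hD, h01⟩ := exists_arc_param (emb := emb) hJ h
  rw [← him] at hz ⊢
  obtain ⟨τ, hτ, rfl⟩ := hz
  refine hf.arc_subset_closure hD₀ hγ hinj hD h01 (lt_of_le_of_ne hτ.1 ?_)
    (lt_of_le_of_ne hτ.2 ?_) hzf
  · rintro rfl
    exact hzv u h0.symm
  · rintro rfl
    exact hzv v h1.symm

theorem IsFaceOf.of_le (hJ : J ≤ G) (hf : IsFaceOf (drawingOn emb J Set.univ) f) (hJ' : J' ≤ J)
    (h : ∀ u v, J.Adj u v → emb.arc u v ⊆ closure f → J'.Adj u v) :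
    frontier f ⊆ drawingOn emb J' Set.univ ∧ IsFaceOf (drawingOn emb J' Set.univ) f := by
  have hc := (isCompact_drawingOn (emb := emb) hJ Set.univ).isClosed
  have key : frontier f ⊆ drawingOn emb J' Set.univ := by
    intro z hz
    have hzD := hf.frontier_subset hc hz
    rw [mem_drawing] at hzD ⊢
    by_cases hv : ∃ v, emb.pos v = z
    · exact Or.inl hv
    · obtain ⟨u, v, huv, hzu⟩ := hzD.resolve_left hv
      exact Or.inr ⟨u, v, h u v huv (arc_subset_closure_of_mem hJ hf huv hzu
        (frontier_subset_closure hz) (not_exists.1 hv)), hzu⟩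
  exact ⟨key, hf.of_frontier_subset hc (drawing_mono hJ') key⟩

/-- A vertex of degree at least two on the boundary of a face lies on two boundary edges. -/
theorem exists_arc_subset_closure (hJ : J ≤ G) (hf : IsFaceOf (drawingOn emb J Set.univ) f)
    {y w₀ w₁ : V} (h₀ : J.Adj y w₀) (h₁ : J.Adj y w₁) (hne : w₁ ≠ w₀)
    (hy : emb.pos y ∈ closure f) : ∃ w, w ≠ w₀ ∧ J.Adj y w ∧ emb.arc y w ⊆ closure f := by
  by_contra! hcon
  let E : Set (Sym2 V) := {e | y ∈ e ∧ e ≠ s(y, w₀)}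
  have hE : J.deleteEdges E ≤ J := SimpleGraph.deleteEdges_le _
  have hfr := (hf.of_le hJ hE fun u v huv ha => by
    rw [SimpleGraph.deleteEdges_adj]
    refine ⟨huv, ?_⟩
    rintro ⟨hyu, he⟩
    rcases Sym2.mem_iff.1 hyu with rfl | rfl
    · exact hcon v (by rintro rfl; exact he rfl) huv ha
    · exact hcon u (by rintro rfl; exact he Sym2.eq_swap) huv.symm (emb.arc_symm u _ ▸ ha)).1
  have hc := (isCompact_drawingOn (emb := emb) hJ Set.univ).isClosed
  obtain ⟨γ, hγ, hinj, h0, h1, him⟩ := emb.arc_curve w₀ y (hJ h₀.symm)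
  have h1m : (1 : ℝ) ∈ Set.Icc (0 : ℝ) 1 := ⟨zero_le_one, le_rfl⟩
  let K : Set (ℝ × ℝ) := drawingOn emb J {y}ᶜ
  have hKy : emb.pos y ∉ K := by
    rintro (⟨v, hv, h⟩ | h)
    · exact hv (emb.pos_injective h)
    · simp only [Set.mem_iUnion] at h
      obtain ⟨u, v, huv, hu, hv, h⟩ := h
      rcases emb.arc_vertex u v (hJ huv) y h with rfl | rfl
      · exact hu rfl
      · exact hv rfl
  have hKD : K ⊆ drawingOn emb J Set.univ := by
    rintro z (⟨v, -, rfl⟩ | h)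
    · exact pos_mem_drawing v
    · simp only [Set.mem_iUnion] at h
      obtain ⟨u, v, huv, -, -, h⟩ := h
      exact arc_subset_drawing huv h
  obtain ⟨B, hB, hyB, hBf⟩ := hf.exists_isOpen_of_tip hc (K := K) (isCompact_drawingOn hJ _)
    zero_le_one hγ hinj (by
      intro τ hτ hK
      have hτa : γ τ ∈ emb.arc w₀ y := him ▸ ⟨τ, hτ, rfl⟩
      have key : ∀ w, emb.pos w = γ τ → τ = 0 := by
        intro w hw
        rcases emb.arc_vertex w₀ y (hJ h₀.symm) w (hw ▸ hτa) with rfl | rfl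
        · exact hinj hτ ⟨le_rfl, zero_le_one⟩ (hw.symm.trans h0.symm)
        · exact absurd (hw ▸ hK) hKy
      rcases hK with ⟨v, -, hv⟩ | h
      · exact key v hv
      · simp only [Set.mem_iUnion] at h
        obtain ⟨u, v, huv, hu, hv, h⟩ := h
        obtain ⟨w, hw, -⟩ := exists_pos_eq_of_mem_arc_arc (hJ huv) (hJ h₀.symm) (by
          intro h
          rcases Sym2.eq_iff.1 h with ⟨-, rfl⟩ | ⟨rfl, -⟩
          · exact hv rfl
          · exact hu rfl) h hτa
        exact key w hw) (by
      intro z hz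
      have := hfr hz
      rw [mem_drawing] at this
      rw [him]
      obtain ⟨v, rfl⟩ | ⟨u, v, huv, hzu⟩ := this
      · by_cases hv : v = y
        · exact Or.inr (by rw [hv]; exact pos_right_mem_arc (hJ h₀.symm))
        · exact Or.inl (Or.inl ⟨v, hv, rfl⟩)
      · rw [SimpleGraph.deleteEdges_adj] at huv
        by_cases hyu : y ∈ s(u, v)
        · right
          have : s(u, v) = s(y, w₀) := by
            by_contra h
            exact huv.2 ⟨hyu, h⟩
          rcases Sym2.eq_iff.1 this with ⟨rfl, rfl⟩ | ⟨rfl, rfl⟩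
          · exact emb.arc_symm _ _ ▸ hzu
          · exact hzu
        · left
          right
          simp only [Set.mem_iUnion]
          refine ⟨u, v, huv.1, ?_, ?_, hzu⟩
          · rintro rfl
            exact hyu (Sym2.mem_mk_left _ _)
          · rintro rfl
            exact hyu (Sym2.mem_mk_right _ _)) (by
      rw [him]
      exact Set.union_subset hKD (arc_subset_drawing h₀.symm)) (h1 ▸ hKy) (h1 ▸ hy)
  rw [him] at hBf
  rw [h1] at hyB
  obtain ⟨z, hzB, hza, hzv⟩ := exists_param_approach (hJ h₁) hB hyB
  refine hf.subset_compl (hBf ⟨hzB, fun hz => ?_⟩) (arc_subset_drawing h₁ hza)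
  obtain ⟨w, hw', -⟩ := exists_pos_eq_of_mem_arc_arc (hJ h₁) (hJ h₀.symm) (by
    intro h
    rcases Sym2.eq_iff.1 h with ⟨rfl, -⟩ | ⟨-, h⟩
    · exact h₀.ne rfl
    · exact hne h) hza hz
  exact hzv w hw'

theorem eq_or_eq_of_arc_subset_closure (hJ : J ≤ G) {f g h : Set (ℝ × ℝ)}
    (hf : IsFaceOf (drawingOn emb J Set.univ) f) (hg : IsFaceOf (drawingOn emb J Set.univ) g)
    (hh : IsFaceOf (drawingOn emb J Set.univ) h) (hfg : f ≠ g) {u v : V} (huv : J.Adj u v)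
    (h₁ : emb.arc u v ⊆ closure f) (h₂ : emb.arc u v ⊆ closure g)
    (h₃ : emb.arc u v ⊆ closure h) : h = f ∨ h = g := by
  by_contra! hcon
  obtain ⟨γ, D₀, hγ, hinj, h0, h1, him, hD₀, hD, h01⟩ := exists_arc_param (emb := emb) hJ huv
  refine false_of_three_faces (f := ![f, g, h]) ?_ ?_ hD₀ hγ hinj hD h01 ?_
  · intro i
    fin_cases i <;> assumption
  · intro i j hij
    fin_cases i <;> fin_cases j <;> simp_all [eq_comm]
  · rw [him]
    intro i
    fin_cases i <;> assumption

/-- A bond meets the boundary of a face in at most two edges. -/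
theorem false_of_bond (hJ : J ≤ G) (hf : IsFaceOf (drawingOn emb J Set.univ) f) {L R : Set V}
    (hLR : Disjoint L R)
    (hL : ∀ a ∈ L, ∀ b ∈ L, JoinedIn (drawingOn emb J L) (emb.pos a) (emb.pos b))
    (hR : ∀ a ∈ R, ∀ b ∈ R, JoinedIn (drawingOn emb J R) (emb.pos a) (emb.pos b))
    {l r : Fin 3 → V} (hl : ∀ j, l j ∈ L) (hr : ∀ j, r j ∈ R) (hadj : ∀ j, J.Adj (l j) (r j))
    (hne : ∀ j k, j ≠ k → s(l j, r j) ≠ s(l k, r k))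
    (hcl : ∀ j, emb.arc (l j) (r j) ⊆ closure f) : False := by
  have hc := (isCompact_drawingOn (emb := emb) hJ Set.univ).isClosed
  have hlR : ∀ j, l j ∉ R := fun j => Set.disjoint_left.1 hLR (hl j)
  have hrL : ∀ j, r j ∉ L := fun j => Set.disjoint_right.1 hLR (hr j)
  choose γ D₀ hγ hinj h0 h1 him hD₀ hD h01 using fun j => exists_arc_param (emb := emb) hJ (hadj j)
  have hhalf : (1 / 2 : ℝ) ∈ Set.Icc (0 : ℝ) 1 := by norm_num
  have hacc : ∀ j, ∃ τ : ℝ, 0 < τ ∧ τ < 1 ∧ ∀ z ∈ f, JoinedIn (f ∪ {γ j τ}) z (γ j τ) := by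
    intro j
    have hmem : γ j (1 / 2) ∈ emb.arc (l j) (r j) := him j ▸ ⟨_, hhalf, rfl⟩
    obtain ⟨p, hpU, hpD, hp⟩ := hf.exists_accessible hc (arc_subset_drawing (hadj j) hmem)
      (hcl j hmem)
      (((hD₀ j).union (Set.toFinite {γ j 0, γ j 1}).isCompact).isClosed.isOpen_compl) (by
        rintro (h | h | h)
        · rcases h01 j _ hhalf h with h | h <;> norm_num at h
        · have := hinj j hhalf ⟨le_rfl, zero_le_one⟩ h
          norm_num at this
        · have := hinj j hhalf ⟨zero_le_one, le_rfl⟩ h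
          norm_num at this)
    rw [hD j] at hpD
    obtain h | ⟨τ, hτ, rfl⟩ := hpD
    · exact absurd (Or.inl h) hpU
    · refine ⟨τ, lt_of_le_of_ne hτ.1 ?_, lt_of_le_of_ne hτ.2 ?_, hp⟩
      · rintro rfl
        exact hpU (by simp)
      · rintro rfl
        exact hpU (by simp)
  choose τ hτ0 hτ1 hτ using hacc
  have hIl : ∀ j, Set.Icc 0 (τ j) ⊆ Set.Icc 0 1 := fun j => Set.Icc_subset_Icc le_rfl (hτ1 j).le
  have hIr : ∀ j, Set.Icc (τ j) 1 ⊆ Set.Icc 0 1 := fun j => Set.Icc_subset_Icc (hτ0 j).le le_rfl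
  have hal : ∀ j, γ j '' Set.Icc 0 (τ j) ⊆ emb.arc (l j) (r j) := fun j =>
    him j ▸ Set.image_mono (hIl j)
  have har : ∀ j, γ j '' Set.Icc (τ j) 1 ⊆ emb.arc (l j) (r j) := fun j =>
    him j ▸ Set.image_mono (hIr j)
  have hnl : ∀ j, emb.pos (r j) ∉ γ j '' Set.Icc 0 (τ j) := by
    rintro j ⟨σ, hσ, h⟩
    have := hinj j (hIl j hσ) ⟨zero_le_one, le_rfl⟩ (h.trans (h1 j).symm)
    linarith [hσ.2, hτ1 j]
  have hnr : ∀ j, emb.pos (l j) ∉ γ j '' Set.Icc (τ j) 1 := by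
    rintro j ⟨σ, hσ, h⟩
    have := hinj j (hIr j hσ) ⟨le_rfl, zero_le_one⟩ (h.trans (h0 j).symm)
    linarith [hσ.1, hτ0 j]
  have hτm : ∀ j, τ j ∈ Set.Icc 0 1 := fun j => ⟨(hτ0 j).le, (hτ1 j).le⟩
  have hpa : ∀ j, γ j (τ j) ∈ emb.arc (l j) (r j) := fun j => him j ▸ ⟨_, hτm j, rfl⟩
  have hpv : ∀ j w, emb.pos w ≠ γ j (τ j) := by
    intro j w hw
    rcases emb.arc_vertex _ _ (hJ (hadj j)) w (hw ▸ hpa j) with rfl | rfl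
    · exact hnr j ⟨τ j, ⟨le_rfl, (hτ1 j).le⟩, hw.symm⟩
    · exact hnl j ⟨τ j, ⟨(hτ0 j).le, le_rfl⟩, hw.symm⟩
  have hsubD : ∀ L : Set V, drawingOn emb J L ⊆ drawingOn emb J Set.univ := fun L =>
    drawingOn_mono (Set.subset_univ L)
  obtain ⟨z, hz⟩ := hf.nonempty
  let S₀ : Fin 3 → Set (ℝ × ℝ) := fun j => drawingOn emb J L ∪ γ j '' Set.Icc 0 (τ j)
  let S₁ : Fin 3 → Set (ℝ × ℝ) := fun j => drawingOn emb J R ∪ γ j '' Set.Icc (τ j) 1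
  let S₂ : Fin 3 → Set (ℝ × ℝ) := fun j => f ∪ {γ j (τ j)}
  have hLa : ∀ j, ∀ z ∈ emb.arc (l j) (r j), z ∈ drawingOn emb J L → z = emb.pos (l j) :=
    fun j z hz hzL => eq_of_mem_arc_drawingOn hJ (hJ (hadj j)) (hrL j) hz hzL
  have hRa : ∀ j, ∀ z ∈ emb.arc (l j) (r j), z ∈ drawingOn emb J R → z = emb.pos (r j) :=
    fun j z hz hzR => eq_of_mem_arc_drawingOn hJ (hJ (hadj j).symm) (hlR j)
      (emb.arc_symm (l j) (r j) ▸ hz) hzR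
  have d01 : ∀ j k, j ≠ k → Disjoint (S₀ j) (S₁ k) := by
    intro j k hjk
    rw [Set.disjoint_left]
    rintro z (h | h) (h' | h')
    · exact Set.disjoint_left.1 (disjoint_drawingOn hJ hLR) h h'
    · exact hnr k (hLa k z (har k h') h ▸ h')
    · exact hnl j (hRa j z (hal j h) h' ▸ h)
    · obtain ⟨w, rfl, h2, h3⟩ := exists_pos_eq_of_mem_arc_arc (hJ (hadj j)) (hJ (hadj k))
        (hne j k hjk) (hal j h) (har k h')
      rcases h2 with rfl | rfl
      · rcases h3 with h3 | h3
        · exact hnr k (h3 ▸ h')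
        · exact hrL k (h3 ▸ hl j)
      · exact hnl j h
  have daux : ∀ j k, j ≠ k → ∀ z ∈ emb.arc (l j) (r j), z ≠ γ k (τ k) := by
    rintro j k hjk z hz rfl
    obtain ⟨w, hw, -⟩ := exists_pos_eq_of_mem_arc_arc (hJ (hadj j)) (hJ (hadj k))
      (hne j k hjk) hz (hpa k)
    exact hpv k w hw
  have d02 : ∀ j k, j ≠ k → Disjoint (S₀ j) (S₂ k) := by
    intro j k hjk
    rw [Set.disjoint_left]
    rintro z (h | h) (h' | rfl)
    · exact hf.subset_compl h' (hsubD L h)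
    · exact hpv k _ (hLa k _ (hpa k) h).symm
    · exact hf.subset_compl h' (arc_subset_drawing (hadj j) (hal j h))
    · exact daux j k hjk _ (hal j h) rfl
  have d12 : ∀ j k, j ≠ k → Disjoint (S₁ j) (S₂ k) := by
    intro j k hjk
    rw [Set.disjoint_left]
    rintro z (h | h) (h' | rfl)
    · exact hf.subset_compl h' (hsubD R h)
    · exact hpv k _ (hRa k _ (hpa k) h).symm
    · exact hf.subset_compl h' (arc_subset_drawing (hadj j) (har j h))
    · exact daux j k hjk _ (har j h) rfl
  refine not_K33_drawing ![emb.pos (l 0), emb.pos (r 0), z] (fun j => γ j (τ j))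
    ![S₀, S₁, S₂] ?_ ?_
  · intro i j
    fin_cases i
    · refine ((hL _ (hl 0) _ (hl j)).mono Set.subset_union_left).trans
        (JoinedIn.mono ?_ Set.subset_union_right)
      rw [← h0 j]
      exact joinedIn_image_Icc ((hγ j).mono (hIl j)) ⟨le_rfl, (hτ0 j).le⟩ ⟨(hτ0 j).le, le_rfl⟩
    · refine ((hR _ (hr 0) _ (hr j)).mono Set.subset_union_left).trans
        (JoinedIn.mono ?_ Set.subset_union_right)
      rw [← h1 j]
      exact joinedIn_image_Icc ((hγ j).mono (hIr j)) ⟨(hτ1 j).le, le_rfl⟩ ⟨le_rfl, (hτ1 j).le⟩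
    · exact hτ j z hz
  · intro i j k m hik hjm
    fin_cases i <;> fin_cases k
    · exact absurd rfl hik
    · exact d01 j m hjm
    · exact d02 j m hjm
    · exact (d01 m j hjm.symm).symm
    · exact absurd rfl hik
    · exact d12 j m hjm
    · exact (d02 m j hjm.symm).symm
    · exact (d12 m j hjm.symm).symm
    · exact absurd rfl hik

end Drawings

section Enumeration

variable {V : Type*} {G : SimpleGraph V} {x : V} {C : G.Walk x x} {u : ℤ → V}

/-- `u` lists the vertices of the cycle `C` periodically, in cyclic order. -/
structure CycEnum (C : G.Walk x x) (u : ℤ → V) : Prop where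
  three_le : 3 ≤ C.length
  eq_iff : ∀ a b, u a = u b ↔ (C.length : ℤ) ∣ b - a
  mem_support : ∀ v, v ∈ C.support ↔ ∃ k, u k = v
  mem_edges : ∀ e, e ∈ C.edges ↔ ∃ k, e = s(u k, u (k + 1))

theorem exists_cycEnum (hC : C.IsCycle) : ∃ u, CycEnum C u := by
  have h3 := hC.three_le_length
  have hn : (0 : ℤ) < C.length := by omega
  set n := C.length with hndef
  have hmod : ∀ k : ℤ, ((k % n).toNat : ℤ) = k % n := fun k =>
    Int.toNat_of_nonneg (Int.emod_nonneg _ hn.ne')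
  have hlt : ∀ k : ℤ, (k % n).toNat < n := fun k => by
    have := Int.emod_lt_of_pos k hn
    have := hmod k
    omega
  have hsucc : ∀ k : ℤ, C.getVert (((k + 1) % n).toNat) = C.getVert ((k % n).toNat + 1) := by
    intro k
    have h1 := hmod k
    have h2 := hmod (k + 1)
    have h3 := hlt k
    have h5 := Int.emod_add_mul_ediv k n
    by_cases h : (k % n).toNat + 1 < n
    · have : (k + 1) % n = k % n + 1 := by
        rw [Int.add_emod, Int.emod_eq_of_lt (b := n) (a := 1) (by omega) (by omega),
          Int.emod_eq_of_lt (by omega) (by omega)]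
      congr 1
      omega
    · have h4 : (k % n).toNat + 1 = n := by omega
      have h6 : k + 1 = n * (k / n + 1) := by
        have : k % n = n - 1 := by omega
        linear_combination -h5 + this
      rw [h4, h6]
      simp [hndef]
  refine ⟨fun k => C.getVert (k % n).toNat, h3, fun a b => ⟨fun h => ?_, fun h => ?_⟩,
    fun v => ?_, fun e => ?_⟩
  · have := hC.getVert_injOn' (by have := hlt a; simp; omega) (by have := hlt b; simp; omega) h
    have h1 := hmod a
    have h2 := hmod b
    exact Int.ModEq.dvd (show a % n = b % n by omega)
  · have : a % n = b % n := Int.modEq_iff_dvd.2 h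
    simp only [this]
  · rw [SimpleGraph.Walk.mem_support_iff_exists_getVert]
    constructor
    · rintro ⟨i, rfl, hi⟩
      rcases hi.lt_or_eq with hi | rfl
      · exact ⟨i, by rw [Int.emod_eq_of_lt (by omega) (by omega)]; simp⟩
      · exact ⟨0, by simp⟩
    · rintro ⟨k, rfl⟩
      exact ⟨_, rfl, (hlt k).le⟩
  · simp only [hsucc]
    constructor
    · intro he
      rw [SimpleGraph.Walk.edges, List.mem_map] at he
      obtain ⟨d, hd, rfl⟩ := he
      obtain ⟨i, hi, rfl⟩ := List.mem_iff_getElem.1 hd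
      rw [SimpleGraph.Walk.length_darts] at hi
      refine ⟨i, ?_⟩
      rw [Int.emod_eq_of_lt (by omega) (by omega), SimpleGraph.Walk.darts_getElem_eq_getVert]
      simp [SimpleGraph.Dart.edge]
    · rintro ⟨k, rfl⟩
      have := SimpleGraph.Walk.toSubgraph_adj_getVert C (hlt k)
      exact (SimpleGraph.Walk.mem_edges_toSubgraph C).1 this

namespace CycEnum

theorem adj (hu : CycEnum C u) (k : ℤ) : G.Adj (u k) (u (k + 1)) :=
  C.adj_of_mem_edges ((hu.mem_edges _).2 ⟨k, rfl⟩)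

theorem mem (hu : CycEnum C u) (k : ℤ) : u k ∈ C.support := (hu.mem_support _).2 ⟨k, rfl⟩

theorem shift (hu : CycEnum C u) (i : ℤ) : CycEnum C fun k => u (i + k) where
  three_le := hu.three_le
  eq_iff a b := by rw [hu.eq_iff, add_sub_add_left_eq_sub]
  mem_support v := by
    rw [hu.mem_support]
    exact ⟨fun ⟨k, hk⟩ => ⟨k - i, by simpa using hk⟩, fun ⟨k, hk⟩ => ⟨i + k, hk⟩⟩
  mem_edges e := by
    rw [hu.mem_edges]
    refine ⟨fun ⟨k, hk⟩ => ⟨k - i, ?_⟩, fun ⟨k, hk⟩ => ⟨i + k, ?_⟩⟩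
    · rw [hk]; ring_nf
    · rw [hk]; ring_nf

theorem reverse (hu : CycEnum C u) (i : ℤ) : CycEnum C fun k => u (i - k) where
  three_le := hu.three_le
  eq_iff a b := by
    rw [hu.eq_iff, ← dvd_neg]
    ring_nf
  mem_support v := by
    rw [hu.mem_support]
    exact ⟨fun ⟨k, hk⟩ => ⟨i - k, by simpa using hk⟩, fun ⟨k, hk⟩ => ⟨i - k, hk⟩⟩
  mem_edges e := by
    rw [hu.mem_edges]
    refine ⟨fun ⟨k, hk⟩ => ⟨i - k - 1, ?_⟩, fun ⟨k, hk⟩ => ⟨i - k - 1, ?_⟩⟩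
    · rw [hk, Sym2.eq_swap]; ring_nf
    · rw [hk, Sym2.eq_swap]; ring_nf

theorem eq_of_lt (hu : CycEnum C u) {a b : ℤ} (h : u a = u b) (h1 : a - b < C.length)
    (h2 : b - a < C.length) : a = b := by
  have h := (hu.eq_iff a b).1 h
  have := Int.eq_zero_of_abs_lt_dvd h (abs_lt.2 ⟨by omega, by omega⟩)
  omega

theorem exists_lt (hu : CycEnum C u) (k i : ℤ) :
    ∃ l, i ≤ l ∧ l < i + C.length ∧ (C.length : ℤ) ∣ k - l := by
  have h3 := hu.three_le
  have h1 := Int.emod_nonneg (k - i) (b := C.length) (by omega)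
  have h2 := Int.emod_lt_of_pos (k - i) (b := C.length) (by omega)
  refine ⟨i + (k - i) % C.length, by omega, by omega, ?_⟩
  have := Int.emod_add_mul_ediv (k - i) C.length
  exact ⟨(k - i) / C.length, by linear_combination -this⟩

theorem eq_of_dvd (hu : CycEnum C u) {a b : ℤ} (h : (C.length : ℤ) ∣ b - a) : u a = u b :=
  (hu.eq_iff _ _).2 h

theorem ne_of_not_mem (hu : CycEnum C u) {w : V} (hw : w ∉ C.support) (k : ℤ) : w ≠ u k :=
  fun h => hw (h ▸ hu.mem k)

theorem ne (hu : CycEnum C u) {a b : ℤ} (hab : a ≠ b) (h1 : a - b < C.length)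
    (h2 : b - a < C.length) : u a ≠ u b := fun h => hab (hu.eq_of_lt h h1 h2)

theorem edge_eq_iff (hu : CycEnum C u) (a b : ℤ) :
    s(u a, u (a + 1)) = s(u b, u (b + 1)) ↔ (C.length : ℤ) ∣ b - a := by
  rw [Sym2.eq_iff]
  constructor
  · rintro (⟨h, -⟩ | ⟨h, h'⟩)
    · exact (hu.eq_iff _ _).1 h
    · have h1 := (hu.eq_iff _ _).1 h
      have h2 := (hu.eq_iff _ _).1 h'
      have h3 := Int.le_of_dvd (by norm_num) (show (C.length : ℤ) ∣ 2 by
        have := dvd_sub h1 h2; ring_nf at this; exact this)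
      have := hu.three_le
      omega
  · intro h
    exact Or.inl ⟨hu.eq_of_dvd h, hu.eq_of_dvd (by simpa using h)⟩

end CycEnum

variable [Fintype V]

theorem IsLongestIsolatingCycle.false_of_list (hC : IsLongestIsolatingCycle G C) {l : List V}
    (hnd : l.Nodup) (hch : l.IsChain G.Adj)
    (hcl : ∀ a ∈ l.getLast?, ∀ b ∈ l.head?, G.Adj a b) (hcov : ∀ v ∈ C.support, v ∈ l)
    (hlen : C.length < l.length) : False := by
  have h3 := hC.1.three_le_length
  have hne : l ≠ [] := by rintro rfl; simp at hlen
  have hadj : G.Adj (l.getLast hne) (l.head hne) :=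
    hcl _ (List.getLast?_eq_some_getLast hne) _ (List.head?_eq_some_head hne)
  set p := SimpleGraph.Walk.ofSupport l hne hch with hp
  have hps : p.support = l := SimpleGraph.Walk.support_ofSupport ..
  have hpl : p.length + 1 = l.length := by
    rw [← SimpleGraph.Walk.length_support, hps]
  have hpath : p.IsPath := by rw [SimpleGraph.Walk.isPath_def, hps]; exact hnd
  have hcyc : (SimpleGraph.Walk.cons hadj p).IsCycle := by
    rw [SimpleGraph.Walk.cons_isCycle_iff]
    refine ⟨hpath, fun hmem => ?_⟩
    have := hpath.length_eq_one_of_mem_edges (by rwa [Sym2.eq_swap] at hmem)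
    omega
  have := hC.2.2 _ _ hcyc ?_
  · rw [SimpleGraph.Walk.length_cons] at this
    omega
  · intro v hv
    rw [SimpleGraph.Walk.support_cons, hps] at hv
    have hvl : v ∉ C.support := fun h => hv (List.mem_cons_of_mem _ (hcov v h))
    refine ⟨(hC.2.1 v hvl).1, fun w hw => ?_⟩
    rw [SimpleGraph.Walk.support_cons, hps]
    exact List.mem_cons_of_mem _ (hcov w ((hC.2.1 v hvl).2 w hw))

namespace CycEnum

theorem false_of_detour (hu : CycEnum C u) (hC : IsLongestIsolatingCycle G C) {pre : List V}
    {m : ℕ} (hm : m + 1 < C.length) (hhead : pre.head? = some (u 0))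
    (hlast : ∀ a ∈ pre.getLast?, G.Adj a (u (m + 1))) (hnd : pre.Nodup)
    (hch : pre.IsChain G.Adj)
    (hpre : ∀ a ∈ pre, a ∉ C.support ∨ ∃ k : ℤ, 0 ≤ k ∧ k ≤ m ∧ u k = a)
    (hcov : ∀ k : ℤ, 0 ≤ k → k ≤ m → u k ∈ pre) (hlen : m + 1 < pre.length) : False := by
  refine hC.false_of_list
    (l := pre ++ (List.range (C.length - m - 1)).map fun t : ℕ => u (m + 1 + t)) ?_ ?_ ?_ ?_ ?_
  · rw [List.nodup_append]
    refine ⟨hnd, List.Nodup.map_on ?_ List.nodup_range, ?_⟩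
    · intro a ha b hb hab
      simp only [List.mem_range] at ha hb
      have := hu.eq_of_lt hab (by omega) (by omega)
      omega
    · intro a ha b hb hab
      simp only [List.mem_map, List.mem_range] at hb
      obtain ⟨t, ht, rfl⟩ := hb
      rcases hpre a ha with h | ⟨k, h0, h1, rfl⟩
      · exact h (hab ▸ hu.mem _)
      · have := hu.eq_of_lt hab (by omega) (by omega)
        omega
  · rw [List.isChain_append]
    refine ⟨hch, ?_, ?_⟩
    · rw [List.isChain_map, List.isChain_range]
      intro t ht
      have := hu.adj (m + 1 + t)
      push_cast
      rwa [add_assoc ((m : ℤ) + 1)] at this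
    · intro a ha b hb
      rw [List.head?_map, List.head?_range] at hb
      have : C.length - m - 1 ≠ 0 := by omega
      simp [this] at hb
      subst hb
      exact hlast a ha
  · intro a ha b hb
    have hne : C.length - m - 1 ≠ 0 := by omega
    rw [List.head?_append, hhead] at hb
    simp only [Option.some_or, Option.mem_def, Option.some.injEq] at hb
    rw [List.getLast?_append, List.getLast?_map, List.getLast?_range] at ha
    simp only [hne, if_false, Option.map_some, Option.some_or, Option.mem_def,
      Option.some.injEq] at ha
    subst ha hb
    have := hu.adj (m + 1 + ((C.length - m - 1 - 1 : ℕ) : ℤ))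
    rwa [← hu.eq_of_dvd (b := m + 1 + ((C.length - m - 1 - 1 : ℕ) : ℤ) + 1) (a := 0)
      ⟨1, by omega⟩] at this
  · intro v hv
    obtain ⟨k, rfl⟩ := (hu.mem_support v).1 hv
    obtain ⟨l, h0, h1, h2⟩ := hu.exists_lt k 0
    rw [← hu.eq_of_dvd h2]
    rw [List.mem_append]
    by_cases h : l ≤ m
    · exact Or.inl (hcov l h0 h)
    · refine Or.inr (List.mem_map.2 ⟨(l - m - 1).toNat, List.mem_range.2 (by omega), ?_⟩)
      congr 1
      omega
  · simp
    omega

/-- The cycle can be rerouted through `w` when `w` sees both neighbours of `u 1` on the cycle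
and `u 1` sees `u 3`. -/
theorem not_adj_add_two (hu : CycEnum C u) (hC : IsLongestIsolatingCycle G C)
    (hn : 5 ≤ C.length) {w : V} (hw : w ∉ C.support) {c : ℤ} (h0 : G.Adj w (u (c - 1)))
    (h2 : G.Adj w (u (c + 1))) : ¬ G.Adj (u c) (u (c + 2)) := by
  intro h
  have hu' := hu.shift (c - 1)
  have h01 := hu.ne (a := c - 1) (b := c) (by omega) (by omega) (by omega)
  have h02 := hu.ne (a := c - 1) (b := c + 1) (by omega) (by omega) (by omega)
  have h12 := hu.ne (a := c) (b := c + 1) (by omega) (by omega) (by omega)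
  have hwu := hu.ne_of_not_mem hw
  refine hu'.false_of_detour hC (pre := [u (c - 1), w, u (c + 1), u c]) (m := 2) (by omega)
    (by simp) ?_ ?_ ?_ ?_ ?_ (by simp)
  · simp only [List.getLast?_cons_cons, List.getLast?_singleton, Option.mem_def,
      Option.some.injEq]
    rintro _ rfl
    have : c - 1 + ((2 : ℕ) + 1) = c + 2 := by push_cast; ring
    rwa [this]
  · simp [hwu, (hwu _).symm, h01, h02, h12.symm]
  · simp [h0.symm, h2, (hu.adj c).symm]
  · simp only [List.mem_cons, List.not_mem_nil, or_false]
    rintro a (rfl | rfl | rfl | rfl)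
    · exact Or.inr ⟨0, by simp⟩
    · exact Or.inl hw
    · exact Or.inr ⟨2, by norm_num, by norm_num, by ring_nf⟩
    · exact Or.inr ⟨1, by norm_num, by norm_num, by ring_nf⟩
  · intro k hk hk'
    have : k = 0 ∨ k = 1 ∨ k = 2 := by push_cast at hk'; omega
    rcases this with rfl | rfl | rfl
    · simp
    · simp
    · simp [show c - 1 + 2 = c + 1 by ring]

theorem not_adj_sub_two (hu : CycEnum C u) (hC : IsLongestIsolatingCycle G C)
    (hn : 5 ≤ C.length) {w : V} (hw : w ∉ C.support) {c : ℤ} (h0 : G.Adj w (u (c - 1)))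
    (h2 : G.Adj w (u (c + 1))) : ¬ G.Adj (u c) (u (c - 2)) := by
  have := (hu.reverse (2 * c)).not_adj_add_two hC hn hw (c := c)
    (by ring_nf at h2 ⊢; exact h2) (by ring_nf at h0 ⊢; exact h0)
  ring_nf at this ⊢
  exact this

theorem not_adj_of_overlap (hu : CycEnum C u) (hC : IsLongestIsolatingCycle G C)
    (hn : 7 ≤ C.length) {w : V} (hw : w ∉ C.support) {c : ℤ} (h3 : G.Adj w (u (c + 3)))
    (h5 : G.Adj w (u (c + 5))) (h02 : G.Adj (u c) (u (c + 2))) :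
    ¬ G.Adj (u (c + 1)) (u (c + 4)) := by
  intro h
  have hu' := hu.shift c
  have hne : ∀ a b : ℤ, 0 ≤ a → a ≤ 4 → 0 ≤ b → b ≤ 4 → a ≠ b → u (c + a) ≠ u (c + b) :=
    fun a b _ _ _ _ hab => hu.ne (by omega) (by omega) (by omega)
  have hwu := hu.ne_of_not_mem hw
  have h23 := hu.adj (c + 1)
  have h34 := hu.adj (c + 3)
  rw [show c + 1 + 1 = c + 2 by ring] at h23
  rw [show c + 3 + 1 = c + 4 by ring] at h34
  refine hu'.false_of_detour hC
    (pre := [u c, u (c + 2), u (c + 1), u (c + 4), u (c + 3), w]) (m := 4) (by omega)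
    (by simp) ?_ ?_ ?_ ?_ ?_ (by simp)
  · simp only [List.getLast?_cons_cons, List.getLast?_singleton, Option.mem_def,
      Option.some.injEq]
    rintro _ rfl
    rw [show c + ((4 : ℕ) + 1) = c + 5 by push_cast; ring]
    exact h5
  · have e := hne 0
    rw [add_zero] at e
    have e1 := e 1; have e2 := e 2; have e3 := e 3; have e4 := e 4
    norm_num at e1 e2 e3 e4
    have := hne 2 1; have := hne 2 4; have := hne 2 3
    have := hne 1 4; have := hne 1 3; have := hne 4 3
    norm_num at *
    simp_all [eq_comm]
  · simp [h02, h23.symm, h, h34.symm, h3.symm]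
  · simp only [List.mem_cons, List.not_mem_nil, or_false]
    rintro a (rfl | rfl | rfl | rfl | rfl | rfl)
    · exact Or.inr ⟨0, by simp⟩
    · exact Or.inr ⟨2, by norm_num, by norm_num, rfl⟩
    · exact Or.inr ⟨1, by norm_num, by norm_num, rfl⟩
    · exact Or.inr ⟨4, by norm_num, by norm_num, rfl⟩
    · exact Or.inr ⟨3, by norm_num, by norm_num, rfl⟩
    · exact Or.inl hw
  · intro k hk hk'
    have : k = 0 ∨ k = 1 ∨ k = 2 ∨ k = 3 ∨ k = 4 := by push_cast at hk'; omega
    rcases this with rfl | rfl | rfl | rfl | rfl <;> simp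

end CycEnum

end Enumeration

section HGraphFacts

variable {V : Type*} {G : SimpleGraph V} {emb : PlaneEmbedding G} {J : SimpleGraph V}
  {f g : Set (ℝ × ℝ)}

theorem joinedIn_drawingOn_insert (hJ : J ≤ G) {L : Set V}
    (hL : ∀ a ∈ L, ∀ b ∈ L, JoinedIn (drawingOn emb J L) (emb.pos a) (emb.pos b)) {v w : V}
    (hw : w ∈ L) (hvw : J.Adj v w) :
    ∀ a ∈ insert v L, ∀ b ∈ insert v L,
      JoinedIn (drawingOn emb J (insert v L)) (emb.pos a) (emb.pos b) := by
  have hsub := drawingOn_mono (emb := emb) (J := J) (Set.subset_insert v L)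
  have key : ∀ a ∈ insert v L, JoinedIn (drawingOn emb J (insert v L)) (emb.pos a) (emb.pos w) := by
    rintro a (rfl | ha)
    · exact joinedIn_drawingOn_of_adj hJ hvw (Set.mem_insert _ _) (Set.mem_insert_of_mem _ hw)
    · exact (hL a ha w hw).mono hsub
  exact fun a ha b hb => (key a ha).trans (key b hb).symm

variable {x : V} {C : G.Walk x x} {u : ℤ → V}

theorem joinedIn_drawingOn_image_Icc {u : ℤ → V} (hJ : J ≤ G)
    (hcyc : ∀ k, J.Adj (u k) (u (k + 1))) (p q : ℤ) :
    ∀ a ∈ u '' Set.Icc p q, ∀ b ∈ u '' Set.Icc p q,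
      JoinedIn (drawingOn emb J (u '' Set.Icc p q)) (emb.pos a) (emb.pos b) := by
  have key : ∀ t, p ≤ t → t ≤ q →
      JoinedIn (drawingOn emb J (u '' Set.Icc p q)) (emb.pos (u p)) (emb.pos (u t)) := by
    intro t hpt
    induction t, hpt using Int.leInduction with
    | base => exact fun h => joinedIn_drawingOn_refl ⟨p, ⟨le_rfl, h⟩, rfl⟩
    | succ t hpt ih =>
      intro h
      exact (ih (by omega)).trans (joinedIn_drawingOn_of_adj hJ (hcyc t)
        ⟨t, ⟨hpt, by omega⟩, rfl⟩ ⟨t + 1, ⟨by omega, h⟩, rfl⟩)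
  rintro _ ⟨a, ha, rfl⟩ _ ⟨b, hb, rfl⟩
  exact (key a ha.1 ha.2).symm.trans (key b hb.1 hb.2)

theorem CycEnum.disjoint_Icc (hu : CycEnum C u) (p q : ℤ) :
    Disjoint (u '' Set.Icc (p + 1) q) (u '' Set.Icc (q + 1) (p + C.length)) := by
  rw [Set.disjoint_left]
  rintro _ ⟨a, ⟨ha, ha'⟩, rfl⟩ ⟨b, ⟨hb, hb'⟩, hab⟩
  have := hu.eq_of_lt hab (by omega) (by omega)
  omega

theorem Hgraph_le : Hgraph C ≤ G := SimpleGraph.deleteEdges_le _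

theorem Hgraph_adj_of_not_mem {v w : V} (hv : v ∉ C.support) (h : G.Adj v w) :
    (Hgraph C).Adj v w := by
  rw [Hgraph, SimpleGraph.deleteEdges_adj]
  exact ⟨h, fun hc => hv (hc.2.2 v (Sym2.mem_mk_left _ _))⟩

theorem CycEnum.Hgraph_adj (hu : CycEnum C u) (k : ℤ) : (Hgraph C).Adj (u k) (u (k + 1)) := by
  rw [Hgraph, SimpleGraph.deleteEdges_adj]
  exact ⟨hu.adj k, fun hc => hc.2.1 ((hu.mem_edges _).2 ⟨k, rfl⟩)⟩

theorem CycEnum.Hgraph_adj' (hu : CycEnum C u) (k : ℤ) : (Hgraph C).Adj (u k) (u (k - 1)) := by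
  have := (hu.Hgraph_adj (k - 1)).symm
  rwa [sub_add_cancel] at this

theorem CycEnum.eq_of_Hgraph_adj (hu : CycEnum C u) {k : ℤ} {w : V}
    (h : (Hgraph C).Adj (u k) w) (hw : w ∈ C.support) : w = u (k - 1) ∨ w = u (k + 1) := by
  rw [Hgraph, SimpleGraph.deleteEdges_adj] at h
  by_cases he : s(u k, w) ∈ C.edges
  · obtain ⟨l, hl⟩ := (hu.mem_edges _).1 he
    rcases Sym2.eq_iff.1 hl with ⟨h1, rfl⟩ | ⟨h1, rfl⟩
    · right
      exact hu.eq_of_dvd (by have := (hu.eq_iff _ _).1 h1.symm; ring_nf at this ⊢; exact this)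
    · left
      exact hu.eq_of_dvd (by have := (hu.eq_iff _ _).1 h1.symm; ring_nf at this ⊢; exact this)
  · refine absurd ⟨h.1, he, ?_⟩ h.2
    intro v hv
    rcases Sym2.mem_iff.1 hv with rfl | rfl
    · exact hu.mem k
    · exact hw

theorem CycEnum.ne_sub_add (hu : CycEnum C u) (k : ℤ) : u (k + 1) ≠ u (k - 1) := by
  have := hu.three_le
  exact hu.ne (by omega) (by omega) (by omega)

theorem arc_sub_one (u : ℤ → V) (k : ℤ) :
    emb.arc (u k) (u (k - 1)) = emb.arc (u (k - 1)) (u (k - 1 + 1)) := by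
  rw [sub_add_cancel, emb.arc_symm]

theorem CycEnum.arc_congr (hu : CycEnum C u) {k l : ℤ} (h : (C.length : ℤ) ∣ l - k) :
    emb.arc (u k) (u (k + 1)) = emb.arc (u l) (u (l + 1)) := by
  rw [hu.eq_of_dvd h, hu.eq_of_dvd (a := k + 1) (b := l + 1) (by simpa using h)]

theorem CycEnum.card_filter_edges (hu : CycEnum C u) (i : ℤ) (Q : Sym2 V → Prop) [DecidablePred Q] :
    (C.edges.toFinset.filter Q).card =
      ((Finset.Ico i (i + C.length)).filter fun k => Q s(u k, u (k + 1))).card := by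
  symm
  refine Finset.card_bij (fun k _ => s(u k, u (k + 1))) ?_ ?_ ?_
  · intro k hk
    rw [Finset.mem_filter] at hk ⊢
    exact ⟨List.mem_toFinset.2 ((hu.mem_edges _).2 ⟨k, rfl⟩), hk.2⟩
  · intro k hk l hl h
    rw [Finset.mem_filter, Finset.mem_Ico] at hk hl
    have := Int.eq_zero_of_abs_lt_dvd ((hu.edge_eq_iff _ _).1 h) (abs_lt.2 ⟨by omega, by omega⟩)
    omega
  · intro e he
    rw [Finset.mem_filter, List.mem_toFinset] at he
    obtain ⟨k, rfl⟩ := (hu.mem_edges _).1 he.1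
    obtain ⟨l, h1, h2, h3⟩ := hu.exists_lt k i
    have := (hu.edge_eq_iff l k).2 h3
    exact ⟨l, by rw [Finset.mem_filter, Finset.mem_Ico, this]; exact ⟨⟨h1, h2⟩, he.2⟩, this⟩

variable [Fintype V]

theorem MinorFaceH.isFaceOf (hg : MinorFaceH emb C g) :
    IsFaceOf (drawingOn emb (Hgraph C) Set.univ) g := hg.1

theorem mem_Vminus_union_Vplus {v : V} : v ∈ Vminus emb C ∪ Vplus emb C ↔ v ∉ C.support := by
  simp only [Vplus, Finset.mem_union, Finset.mem_filter, Finset.mem_univ, true_and]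
  constructor
  · rintro (h | h)
    · exact (Finset.mem_filter.1 h).2.1
    · exact h.1
  · intro h
    by_cases h' : v ∈ Vminus emb C
    · exact Or.inl h'
    · exact Or.inr ⟨h, h'⟩

theorem MinorFaceH.exists_vertex (hg : MinorFaceH emb C g) :
    ∃ v, v ∉ C.support ∧ emb.pos v ∈ closure g ∧
      ∀ w, w ∉ C.support → emb.pos w ∈ closure g → w = v := by
  obtain ⟨v, ⟨h1, h2⟩, h3⟩ := hg.2
  exact ⟨v, mem_Vminus_union_Vplus.1 h1, h2,
    fun w hw hw' => h3 w ⟨mem_Vminus_union_Vplus.2 hw, hw'⟩⟩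

theorem CycEnum.false_of_bond (hu : CycEnum C u) (hJ : J ≤ G)
    (hcyc : ∀ k, J.Adj (u k) (u (k + 1)))
    (hf : IsFaceOf (drawingOn emb J Set.univ) f) {p q : ℤ} (hpq : p < q)
    (hqp : q < p + C.length) (hp : emb.arc (u p) (u (p + 1)) ⊆ closure f)
    (hq : emb.arc (u q) (u (q + 1)) ⊆ closure f) {L R : Set V} (hLR : Disjoint L R)
    (hL : ∀ a ∈ L, ∀ b ∈ L, JoinedIn (drawingOn emb J L) (emb.pos a) (emb.pos b))
    (hR : ∀ a ∈ R, ∀ b ∈ R, JoinedIn (drawingOn emb J R) (emb.pos a) (emb.pos b))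
    (hLs : u '' Set.Icc (p + 1) q ⊆ L) (hRs : u '' Set.Icc (q + 1) (p + C.length) ⊆ R)
    {a b : V} (ha : a ∈ L) (hb : b ∈ R) (hab : J.Adj a b) (habf : emb.arc a b ⊆ closure f)
    (hap : s(a, b) ≠ s(u p, u (p + 1))) (haq : s(a, b) ≠ s(u q, u (q + 1))) : False := by
  have hup : u p = u (p + C.length) := hu.eq_of_dvd (by simp)
  have hpe : s(u p, u (p + 1)) ≠ s(u q, u (q + 1)) := by
    rw [Ne, hu.edge_eq_iff]
    intro h
    have := Int.le_of_dvd (by omega) h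
    omega
  refine _root_.false_of_bond hJ hf hLR hL hR (l := ![u (p + 1), u q, a])
    (r := ![u p, u (q + 1), b]) ?_ ?_ ?_ ?_ ?_
  · intro j
    fin_cases j
    · exact hLs ⟨_, ⟨le_rfl, by omega⟩, rfl⟩
    · exact hLs ⟨_, ⟨by omega, le_rfl⟩, rfl⟩
    · exact ha
  · intro j
    fin_cases j
    · exact hRs ⟨_, ⟨by omega, le_rfl⟩, hup.symm⟩
    · exact hRs ⟨_, ⟨le_rfl, by omega⟩, rfl⟩
    · exact hb
  · intro j
    fin_cases j
    · exact (hcyc p).symm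
    · exact hcyc q
    · exact hab
  · intro j k hjk
    fin_cases j <;> fin_cases k <;> first | exact absurd rfl hjk | skip
    · simpa [Sym2.eq_swap (a := u (p + 1))] using hpe
    · simpa [Sym2.eq_swap (a := u (p + 1))] using hap.symm
    · simpa [Sym2.eq_swap (a := u (p + 1))] using hpe.symm
    · exact haq.symm
    · simpa [Sym2.eq_swap (a := u (p + 1))] using hap
    · exact haq
  · intro j
    fin_cases j
    · simpa [emb.arc_symm (u (p + 1))] using hp
    · exact hq
    · exact habf

/-- The boundary of the minor face `g` meets the cycle in the path from `u i` to `u (i + j)`,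
whose two ends are joined to the unique vertex `v` off the cycle incident with `g`. -/
structure MinorWindow (emb : PlaneEmbedding G) (C : G.Walk x x) (u : ℤ → V)
    (g : Set (ℝ × ℝ)) (v : V) (i j : ℤ) : Prop where
  not_mem : v ∉ C.support
  eq_of_mem_closure : ∀ w, w ∉ C.support → emb.pos w ∈ closure g → w = v
  adj_left : G.Adj v (u i)
  adj_right : G.Adj v (u (i + j))
  not_adj : ∀ k, i < k → k < i + j → ¬ G.Adj v (u k)
  pos : 0 < j
  le : j + 2 ≤ C.length
  edge_iff : ∀ k, emb.arc (u k) (u (k + 1)) ⊆ closure g ↔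
    ∃ l, i ≤ l ∧ l < i + j ∧ (C.length : ℤ) ∣ k - l
  exists_of_mem_closure : ∀ k, emb.pos (u k) ∈ closure g →
    ∃ l, i ≤ l ∧ l ≤ i + j ∧ (C.length : ℤ) ∣ k - l

theorem CycEnum.false_of_two_edges (hu : CycEnum C u)
    (hg : IsFaceOf (drawingOn emb (Hgraph C) Set.univ) g) {v : V} (hv : v ∉ C.support)
    {p q a b r : ℤ}
    (hpq : p < q) (hqp : q < p + C.length) (hp : emb.arc (u p) (u (p + 1)) ⊆ closure g)
    (hq : emb.arc (u q) (u (q + 1)) ⊆ closure g) (ha : p + 1 ≤ a) (haq : a ≤ q)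
    (hva : G.Adj v (u a)) (hb : q + 1 ≤ b) (hbp : b ≤ p + C.length) (hvb : G.Adj v (u b))
    (hvr : G.Adj v (u r)) (hr : emb.arc v (u r) ⊆ closure g) : False := by
  have hvH : ∀ {k}, G.Adj v (u k) → (Hgraph C).Adj v (u k) := Hgraph_adj_of_not_mem hv
  have hL := joinedIn_drawingOn_image_Icc (emb := emb) Hgraph_le hu.Hgraph_adj (p + 1) q
  have hR := joinedIn_drawingOn_image_Icc (emb := emb) Hgraph_le hu.Hgraph_adj
    (q + 1) (p + C.length)
  have hLR := hu.disjoint_Icc p q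
  have hvn : ∀ s : Set ℤ, v ∉ u '' s := by
    rintro s ⟨k, -, rfl⟩
    exact hv (hu.mem k)
  have hne : ∀ k y, s(v, y) ≠ s(u k, u (k + 1)) := by
    intro k y h
    rcases Sym2.eq_iff.1 h with h | h
    · exact hv (h.1 ▸ hu.mem k)
    · exact hv (h.1 ▸ hu.mem _)
  obtain ⟨r', h1, h2, h3⟩ := hu.exists_lt r (p + 1)
  rw [hu.eq_of_dvd (a := r) (b := r') ((dvd_sub_comm).1 h3)] at hvr hr
  by_cases h : r' ≤ q
  · refine hu.false_of_bond Hgraph_le hu.Hgraph_adj hg hpq hqp hp hq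
      (L := u '' Set.Icc (p + 1) q) (R := insert v (u '' Set.Icc (q + 1) (p + C.length)))
      (Set.disjoint_insert_right.2 ⟨hvn _, hLR⟩) hL
      (joinedIn_drawingOn_insert Hgraph_le hR ⟨b, ⟨hb, hbp⟩, rfl⟩ (hvH hvb))
      subset_rfl (Set.subset_insert _ _) ⟨r', ⟨h1, h⟩, rfl⟩ (Set.mem_insert _ _)
      (hvH hvr).symm (by rwa [emb.arc_symm]) ?_ ?_
    · rw [Sym2.eq_swap]; exact hne _ _
    · rw [Sym2.eq_swap]; exact hne _ _
  · exact hu.false_of_bond Hgraph_le hu.Hgraph_adj hg hpq hqp hp hq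
      (L := insert v (u '' Set.Icc (p + 1) q)) (R := u '' Set.Icc (q + 1) (p + C.length))
      (Set.disjoint_insert_left.2 ⟨hvn _, hLR⟩)
      (joinedIn_drawingOn_insert Hgraph_le hL ⟨a, ⟨ha, haq⟩, rfl⟩ (hvH hva)) hR
      (Set.subset_insert _ _) subset_rfl (Set.mem_insert _ _)
      ⟨r', ⟨by omega, by omega⟩, rfl⟩ (hvH hvr) hr (hne _ _) (hne _ _)

omit [Fintype V] in
theorem MinorWindow.numCEdges_eq (hu : CycEnum C u) {v : V} {i j : ℤ}
    (hw : MinorWindow emb C u g v i j) : (numCEdges emb C g : ℤ) = j := by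
  have h1 := hw.pos
  have h2 := hw.le
  rw [numCEdges, hu.card_filter_edges i]
  have : ((Finset.Ico i (i + C.length)).filter fun k => incEdge emb g s(u k, u (k + 1))) =
      Finset.Ico i (i + j) := by
    ext k
    rw [Finset.mem_filter, Finset.mem_Ico, Finset.mem_Ico]
    constructor
    · rintro ⟨⟨h3, h4⟩, h5⟩
      obtain ⟨l, h6, h7, h8⟩ := (hw.edge_iff k).1 h5
      have := Int.eq_zero_of_abs_lt_dvd h8 (abs_lt.2 ⟨by omega, by omega⟩)
      omega
    · rintro ⟨h3, h4⟩
      exact ⟨⟨h3, by omega⟩, (hw.edge_iff k).2 ⟨k, h3, h4, by simp⟩⟩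
  rw [this]
  simp
  omega

end HGraphFacts

section Windows

variable {V : Type*} [Fintype V] {G : SimpleGraph V} {emb : PlaneEmbedding G} {J : SimpleGraph V}
  {f g : Set (ℝ × ℝ)} {x : V} {C : G.Walk x x} {u : ℤ → V}

theorem MinorFaceH.exists_window (hu : CycEnum C u) (hiso : IsIsolating G C)
    (hg : MinorFaceH emb C g) (hj : 1 ≤ numCEdges emb C g) :
    ∃ v i j, MinorWindow emb C u g v i j := by
  obtain ⟨v, hv, hvg, hvu⟩ := hg.exists_vertex
  have hgf := hg.isFaceOf
  have h3n := hu.three_le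
  have hper : ∀ {k l : ℤ}, (C.length : ℤ) ∣ k - l → G.Adj v (u k) → G.Adj v (u l) := by
    intro k l h hk
    rwa [← hu.eq_of_dvd (a := k) (b := l) (dvd_sub_comm.1 h)]
  have hnb : ∀ k w, (Hgraph C).Adj (u k) w → emb.arc (u k) w ⊆ closure g →
      w = u (k - 1) ∨ w = u (k + 1) ∨ w = v := by
    intro k w hw hwg
    by_cases hwC : w ∈ C.support
    · rcases hu.eq_of_Hgraph_adj hw hwC with h | h <;> simp [h]
    · exact Or.inr (Or.inr (hvu w hwC (hwg (pos_right_mem_arc (Hgraph_le hw)))))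
  have hclo : ∀ k w, emb.arc (u k) w ⊆ closure g → G.Adj (u k) w → emb.pos (u k) ∈ closure g :=
    fun k w h hk => h (pos_left_mem_arc hk)
  have hnext : ∀ k, emb.arc (u k) (u (k + 1)) ⊆ closure g →
      emb.arc (u (k + 1)) (u (k + 1 + 1)) ⊆ closure g ∨ G.Adj v (u (k + 1)) := by
    intro k hk
    obtain ⟨w, hw, hwH, hwg⟩ := exists_arc_subset_closure Hgraph_le hgf (hu.Hgraph_adj' (k + 1))
      (hu.Hgraph_adj (k + 1)) (hu.ne_sub_add _) (hk (pos_right_mem_arc (hu.adj k)))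
    rcases hnb _ w hwH hwg with rfl | rfl | rfl
    · exact absurd rfl hw
    · exact Or.inl hwg
    · exact Or.inr (Hgraph_le hwH).symm
  have hprev : ∀ k, emb.arc (u k) (u (k + 1)) ⊆ closure g →
      emb.arc (u (k - 1)) (u (k - 1 + 1)) ⊆ closure g ∨ G.Adj v (u k) := by
    intro k hk
    obtain ⟨w, hw, hwH, hwg⟩ := exists_arc_subset_closure Hgraph_le hgf (hu.Hgraph_adj k)
      (hu.Hgraph_adj' k) (hu.ne_sub_add _).symm (hk (pos_left_mem_arc (hu.adj k)))
    rcases hnb _ w hwH hwg with rfl | rfl | rfl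
    · left
      rwa [arc_sub_one] at hwg
    · exact absurd rfl hw
    · exact Or.inr (Hgraph_le hwH).symm
  obtain ⟨r, hvr, hr⟩ : ∃ r, G.Adj v (u r) ∧ emb.arc v (u r) ⊆ closure g := by
    obtain ⟨a, ha, b, hb, hab⟩ := Finset.one_lt_card.1
      (show 1 < (Finset.univ.filter fun w => G.Adj v w).card by rw [(hiso v hv).1]; norm_num)
    simp only [Finset.mem_filter, Finset.mem_univ, true_and] at ha hb
    obtain ⟨w, -, hwH, hwg⟩ := exists_arc_subset_closure Hgraph_le hgf
      (Hgraph_adj_of_not_mem hv ha) (Hgraph_adj_of_not_mem hv hb) hab.symm hvg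
    obtain ⟨r, rfl⟩ := (hu.mem_support w).1 ((hiso v hv).2 w (Hgraph_le hwH))
    exact ⟨r, Hgraph_le hwH, hwg⟩
  obtain ⟨k₀, hk₀⟩ : ∃ k, emb.arc (u k) (u (k + 1)) ⊆ closure g := by
    obtain ⟨e, he⟩ := Finset.card_pos.1 (show 0 < _ from hj)
    rw [Finset.mem_filter, List.mem_toFinset] at he
    obtain ⟨k, rfl⟩ := (hu.mem_edges _).1 he.1
    exact ⟨k, he.2⟩
  obtain ⟨i, ⟨hik, hvi⟩, hi⟩ := Int.exists_greatest_of_bdd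
    (P := fun z => z ≤ k₀ ∧ G.Adj v (u z)) ⟨k₀, fun z hz => hz.1⟩ (by
      obtain ⟨l, h1, h2, h3⟩ := hu.exists_lt r (k₀ + 1 - C.length)
      exact ⟨l, by omega, hper h3 hvr⟩)
  obtain ⟨m, ⟨hkm, hvm⟩, hm⟩ := Int.exists_least_of_bdd
    (P := fun z => k₀ + 1 ≤ z ∧ G.Adj v (u z)) ⟨k₀ + 1, fun z hz => hz.1⟩ (by
      obtain ⟨l, h1, h2, h3⟩ := hu.exists_lt r (k₀ + 1)
      exact ⟨l, by omega, hper h3 hvr⟩)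
  have hnot : ∀ k, i < k → k < m → ¬ G.Adj v (u k) := by
    intro k h1 h2 h
    by_cases hk : k ≤ k₀
    · have := hi k ⟨hk, h⟩
      omega
    · have := hm k ⟨by omega, h⟩
      omega
  have hmi : m + 2 ≤ i + C.length := by
    by_contra hcon
    have : (Finset.univ.filter fun w => G.Adj v w) ⊆ {u i, u m} := by
      intro w hw
      simp only [Finset.mem_filter, Finset.mem_univ, true_and] at hw
      obtain ⟨k, rfl⟩ := (hu.mem_support w).1 ((hiso v hv).2 w hw)
      obtain ⟨l, h1, h2, h3⟩ := hu.exists_lt k i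
      rw [hu.eq_of_dvd (a := k) (b := l) (dvd_sub_comm.1 h3)] at hw ⊢
      by_cases hl : l = i
      · simp [hl]
      · have : l = m := by
          by_contra hlm
          exact hnot l (by omega) (by omega) hw
        simp [this]
    have := (Finset.card_le_card this).trans Finset.card_le_two
    rw [(hiso v hv).1] at this
    omega
  have hup : ∀ k, k₀ ≤ k → k < m → emb.arc (u k) (u (k + 1)) ⊆ closure g := by
    intro k hk
    induction k, hk using Int.leInduction with
    | base => exact fun _ => hk₀
    | succ k hk ih =>
      intro h
      exact (hnext k (ih (by omega))).resolve_right (hnot _ (by omega) h)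
  have hdown : ∀ k, k ≤ k₀ → i ≤ k → emb.arc (u k) (u (k + 1)) ⊆ closure g := by
    intro k hk
    induction k, hk using Int.leInductionDown with
    | base => exact fun _ => hk₀
    | pred k hk ih =>
      intro h
      exact (hprev k (ih (by omega))).resolve_right (hnot _ (by omega) (by omega))
  have hedge : ∀ k, emb.arc (u k) (u (k + 1)) ⊆ closure g ↔
      ∃ l, i ≤ l ∧ l < i + (m - i) ∧ (C.length : ℤ) ∣ k - l := by
    intro k
    constructor
    · intro hk
      obtain ⟨l, h1, h2, h3⟩ := hu.exists_lt k i
      refine ⟨l, h1, ?_, h3⟩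
      by_contra hl
      rw [hu.arc_congr (dvd_sub_comm.1 h3)] at hk
      exact hu.false_of_two_edges hgf hv (p := k₀) (q := l) (a := m) (b := i + C.length)
        (by omega) (by omega) hk₀ hk hkm (by omega) hvm (by omega) (by omega)
        (hper (k := i) (by simp) hvi) hvr hr
    · rintro ⟨l, h1, h2, h3⟩
      rw [hu.arc_congr (dvd_sub_comm.1 h3)]
      by_cases hl : l ≤ k₀
      · exact hdown l hl h1
      · exact hup l (by omega) (by omega)
  have hcc : ∀ k, emb.pos (u k) ∈ closure g → emb.arc (u k) (u (k + 1)) ⊆ closure g ∨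
      emb.arc (u (k - 1)) (u (k - 1 + 1)) ⊆ closure g := by
    intro k hk
    obtain ⟨w, hw, hwH, hwg⟩ := exists_arc_subset_closure Hgraph_le hgf (hu.Hgraph_adj k)
      (hu.Hgraph_adj' k) (hu.ne_sub_add _).symm hk
    rcases hnb _ w hwH hwg with rfl | rfl | rfl
    · right
      rwa [arc_sub_one] at hwg
    · exact Or.inl hwg
    · obtain ⟨w', hw', hwH', hwg'⟩ := exists_arc_subset_closure Hgraph_le hgf hwH
        (hu.Hgraph_adj k) (hu.ne_of_not_mem hv _).symm hk
      rcases hnb _ w' hwH' hwg' with rfl | rfl | rfl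
      · right
        rwa [arc_sub_one] at hwg'
      · exact Or.inl hwg'
      · exact absurd rfl hw'
  refine ⟨v, i, m - i, hv, hvu, hvi, by simpa using hvm, fun k h1 h2 => hnot k h1 (by omega),
    by omega, by omega, hedge, fun k hk => ?_⟩
  rcases hcc k hk with h | h
  · obtain ⟨l, h1, h2, h3⟩ := (hedge _).1 h
    exact ⟨l, h1, h2.le, h3⟩
  · obtain ⟨l, h1, h2, h3⟩ := (hedge _).1 h
    exact ⟨l + 1, by omega, by omega, by ring_nf at h3 ⊢; exact h3⟩

namespace MinorWindow

variable {v : V} {i j : ℤ}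

omit [Fintype V] in
theorem of_dvd (hu : CycEnum C u) (hw : MinorWindow emb C u g v i j) {i' : ℤ}
    (h : (C.length : ℤ) ∣ i' - i) : MinorWindow emb C u g v i' j where
  not_mem := hw.not_mem
  eq_of_mem_closure := hw.eq_of_mem_closure
  adj_left := by rw [← hu.eq_of_dvd h]; exact hw.adj_left
  adj_right := by
    rw [← hu.eq_of_dvd (a := i + j) (by simpa using h)]; exact hw.adj_right
  not_adj k h1 h2 := by
    rw [← hu.eq_of_dvd (a := k - (i' - i)) (by simpa using h)]
    exact hw.not_adj _ (by omega) (by omega)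
  pos := hw.pos
  le := hw.le
  edge_iff k := by
    rw [hw.edge_iff]
    constructor
    · rintro ⟨l, h1, h2, h3⟩
      exact ⟨l + (i' - i), by omega, by omega, by rw [← sub_sub]; exact dvd_sub h3 h⟩
    · rintro ⟨l, h1, h2, h3⟩
      exact ⟨l - (i' - i), by omega, by omega, by
        rw [sub_sub_eq_add_sub, add_sub_right_comm]; exact dvd_add h3 h⟩
  exists_of_mem_closure k hk := by
    obtain ⟨l, h1, h2, h3⟩ := hw.exists_of_mem_closure k hk
    exact ⟨l + (i' - i), by omega, by omega, by rw [← sub_sub]; exact dvd_sub h3 h⟩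

omit [Fintype V] in
theorem reverse (hw : MinorWindow emb C u g v i j) (m : ℤ) :
    MinorWindow emb C (fun k => u (m - k)) g v (m - i - j) j where
  not_mem := hw.not_mem
  eq_of_mem_closure := hw.eq_of_mem_closure
  adj_left := by
    have := hw.adj_right
    rwa [show i + j = m - (m - i - j) by ring] at this
  adj_right := by
    have := hw.adj_left
    rwa [show i = m - (m - i - j + j) by ring] at this
  not_adj k h1 h2 := hw.not_adj _ (by omega) (by omega)
  pos := hw.pos
  le := hw.le
  edge_iff k := by
    rw [emb.arc_symm, show m - k = m - (k + 1) + 1 by ring, hw.edge_iff]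
    constructor
    · rintro ⟨l, h1, h2, h3⟩
      exact ⟨m - l - 1, by omega, by omega, by rw [← dvd_neg]; ring_nf at h3 ⊢; exact h3⟩
    · rintro ⟨l, h1, h2, h3⟩
      exact ⟨m - l - 1, by omega, by omega, by rw [← dvd_neg]; ring_nf at h3 ⊢; exact h3⟩
  exists_of_mem_closure k hk := by
    obtain ⟨l, h1, h2, h3⟩ := hw.exists_of_mem_closure _ hk
    exact ⟨m - l, by omega, by omega, by rw [← dvd_neg]; ring_nf at h3 ⊢; exact h3⟩

omit [Fintype V] in
/-- No edge of `H` other than the two cycle edges leaves an inner vertex of the window along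
the boundary of the face. -/
theorem eq_of_arc_subset (hu : CycEnum C u) (hw : MinorWindow emb C u g v i j) {c : ℤ}
    (h1 : i < c) (h2 : c < i + j) {w : V} (h : (Hgraph C).Adj (u c) w)
    (hwg : emb.arc (u c) w ⊆ closure g) : w = u (c - 1) ∨ w = u (c + 1) := by
  by_cases hwC : w ∈ C.support
  · exact hu.eq_of_Hgraph_adj h hwC
  · have := hw.eq_of_mem_closure w hwC (hwg (pos_right_mem_arc (Hgraph_le h)))
    subst this
    exact absurd (Hgraph_le h).symm (hw.not_adj c h1 h2)

end MinorWindow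

end Windows

section Chords

variable {V : Type*} {G : SimpleGraph V} {emb : PlaneEmbedding G} {J : SimpleGraph V}
  {f g : Set (ℝ × ℝ)} {x : V} {C : G.Walk x x} {u : ℤ → V}

theorem ThreeConnected.exists_adj_ne [Fintype V] (h3 : ThreeConnected G) (a b c : V) (hca : c ≠ a)
    (hcb : c ≠ b) : ∃ y, G.Adj c y ∧ y ≠ a ∧ y ≠ b := by
  have hconn := h3.2 {a, b} Finset.card_le_two
  have hcard := h3.1
  obtain ⟨d, hd⟩ : ∃ d, d ∉ ({a, b, c} : Finset V) := by
    by_contra! h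
    have : (Finset.univ : Finset V) ⊆ {a, b, c} := fun d _ => h d
    have := (Finset.card_le_card this).trans Finset.card_le_three
    rw [Finset.card_univ] at this
    omega
  simp only [Finset.mem_insert, Finset.mem_singleton, not_or] at hd
  have hc' : c ∈ ((({a, b} : Finset V) : Set V)ᶜ) := by simp [hca, hcb]
  have hd' : d ∈ ((({a, b} : Finset V) : Set V)ᶜ) := by simp [hd]
  have : Nontrivial ((({a, b} : Finset V) : Set V)ᶜ : Set V) :=
    ⟨⟨⟨c, hc'⟩, ⟨d, hd'⟩, fun h => hd.2.2 (congrArg Subtype.val h).symm⟩⟩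
  obtain ⟨⟨y, hy⟩, hcy⟩ := hconn.preconnected.exists_adj_of_nontrivial ⟨c, hc'⟩
  simp only [Finset.coe_insert, Finset.coe_singleton, Set.mem_compl_iff, Set.mem_insert_iff,
    Set.mem_singleton_iff, not_or] at hy
  exact ⟨y, hcy, hy.1, hy.2⟩

/-- The edge `a b` of `G` runs inside the face `f`. -/
def RunsInside (emb : PlaneEmbedding G) (f : Set (ℝ × ℝ)) (a b : V) : Prop :=
  G.Adj a b ∧ ∀ z ∈ emb.arc a b, (∀ w, emb.pos w ≠ z) → z ∈ f

theorem RunsInside.symm {a b : V} (h : RunsInside emb f a b) : RunsInside emb f b a :=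
  ⟨h.1.symm, by rw [emb.arc_symm]; exact h.2⟩

theorem exists_inner_point {a b : V} (h : G.Adj a b) :
    ∃ z ∈ emb.arc a b, ∀ w, emb.pos w ≠ z := by
  obtain ⟨z, -, hz, hz'⟩ := exists_param_approach (emb := emb) h isOpen_univ (Set.mem_univ _)
  exact ⟨z, hz, hz'⟩

theorem RunsInside.not_adj {a b : V} (h : RunsInside emb f a b)
    (hf : IsFaceOf (drawingOn emb J Set.univ) f) : ¬ J.Adj a b := by
  intro hab
  obtain ⟨z, hz, hz'⟩ := exists_inner_point (emb := emb) h.1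
  exact hf.subset_compl (h.2 z hz hz') (arc_subset_drawing hab hz)

variable [Fintype V] {v₁ v₂ : V} {i₁ j₁ i₂ j₂ : ℤ}

theorem MinorWindow.exists_runsInside (hu : CycEnum C u)
    (hf : IsFaceOf (drawingOn emb (Hgraph C) Set.univ) f)
    (hg : IsFaceOf (drawingOn emb (Hgraph C) Set.univ) g) (hfg : f ≠ g)
    (wf : MinorWindow emb C u f v₁ i₁ j₁) (wg : MinorWindow emb C u g v₂ i₂ j₂) {c : ℤ}
    (hf₁ : i₁ < c) (hf₂ : c < i₁ + j₁) (hg₁ : i₂ < c) (hg₂ : c < i₂ + j₂) {y : V}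
    (hy : G.Adj (u c) y) (hya : y ≠ u (c - 1)) (hyb : y ≠ u (c + 1)) :
    (∃ k, i₁ ≤ k ∧ k ≤ i₁ + j₁ ∧ u k = y ∧ RunsInside emb f (u c) (u k)) ∨
      ∃ k, i₂ ≤ k ∧ k ≤ i₂ + j₂ ∧ u k = y := by
  set J : SimpleGraph V :=
    { Adj := fun a b => (Hgraph C).Adj a b ∧ (a = u c → b = u (c - 1) ∨ b = u (c + 1)) ∧
        (b = u c → a = u (c - 1) ∨ a = u (c + 1))
      symm := ⟨fun a b h => ⟨h.1.symm, h.2.2, h.2.1⟩⟩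
      loopless := ⟨fun a h => h.1.ne rfl⟩ } with hJdef
  have hJH : J ≤ Hgraph C := fun a b h => h.1
  have hJ : J ≤ G := hJH.trans Hgraph_le
  have hface : ∀ {g v i j}, IsFaceOf (drawingOn emb (Hgraph C) Set.univ) g →
      MinorWindow emb C u g v i j → i < c → c < i + j → IsFaceOf (drawingOn emb J Set.univ) g := by
    intro g v i j hg hw h1 h2
    refine (hg.of_le Hgraph_le hJH fun a b hab habg => ⟨hab, ?_, ?_⟩).2
    · rintro rfl
      exact hw.eq_of_arc_subset hu h1 h2 hab habg
    · rintro rfl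
      exact hw.eq_of_arc_subset hu h1 h2 hab.symm (by rwa [emb.arc_symm])
  have hfJ := hface hf wf hf₁ hf₂
  have hgJ := hface hg wg hg₁ hg₂
  have hnJ : ¬ J.Adj (u c) y := fun h => by
    rcases h.2.1 rfl with h | h
    · exact hya h
    · exact hyb h
  have hc1 : ∀ k, u (c + k) = u c → (C.length : ℤ) ∣ k := fun k h => by
    have := (hu.eq_iff _ _).1 h.symm
    simpa using this
  have h3 := hu.three_le
  have hadd : J.Adj (u c) (u (c + 1)) := ⟨hu.Hgraph_adj c, fun _ => Or.inr rfl, fun h =>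
    absurd h (hu.ne (by omega) (by omega) (by omega))⟩
  have hsub : J.Adj (u c) (u (c - 1)) := ⟨hu.Hgraph_adj' c, fun _ => Or.inl rfl, fun h =>
    absurd h (hu.ne (by omega) (by omega) (by omega))⟩
  obtain ⟨h, hh, hin, hcl⟩ := exists_isFaceOf_of_arc (emb := emb) hJ hy hnJ
  obtain ⟨w, hw, hwJ, hwh⟩ := exists_arc_subset_closure hJ hh hsub hadd (hu.ne_sub_add c)
    (hcl (pos_left_mem_arc hy))
  rw [(hwJ.2.1 rfl).resolve_left hw] at hwh
  have hedge : ∀ {g v i j}, MinorWindow emb C u g v i j → i < c → c < i + j →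
      emb.arc (u c) (u (c + 1)) ⊆ closure g := fun hw h1 h2 =>
    (hw.edge_iff c).2 ⟨c, h1.le, h2, by simp⟩
  have hfin : ∀ {g v i j}, MinorWindow emb C u g v i j → i < c → c < i + j → h = g →
      ∃ k, i ≤ k ∧ k ≤ i + j ∧ u k = y := by
    rintro g v i j hw h1 h2 rfl
    have hyc := hcl (pos_right_mem_arc hy)
    by_cases hyC : y ∈ C.support
    · obtain ⟨k, rfl⟩ := (hu.mem_support y).1 hyC
      obtain ⟨l, h1, h2, h3⟩ := hw.exists_of_mem_closure k hyc
      exact ⟨l, h1, h2, hu.eq_of_dvd h3⟩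
    · rw [hw.eq_of_mem_closure y hyC hyc] at hy
      exact absurd hy.symm (hw.not_adj c h1 h2)
  rcases eq_or_eq_of_arc_subset_closure hJ hfJ hgJ hh hfg hadd (hedge wf hf₁ hf₂)
    (hedge wg hg₁ hg₂) hwh with rfl | rfl
  · obtain ⟨k, h1, h2, rfl⟩ := hfin wf hf₁ hf₂ rfl
    exact Or.inl ⟨k, h1, h2, rfl, hy, hin⟩
  · exact Or.inr (hfin wg hg₁ hg₂ rfl)

theorem MinorWindow.not_crossing (hu : CycEnum C u)
    (hf : IsFaceOf (drawingOn emb (Hgraph C) Set.univ) f)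
    (wf : MinorWindow emb C u f v₁ i₁ j₁) {a b c d : ℤ} (hia : i₁ ≤ a) (hac : a < c) (hcb : c < b)
    (hbd : b < d) (hd : d ≤ i₁ + j₁) (hab : RunsInside emb f (u a) (u b))
    (hcd : RunsInside emb f (u c) (u d)) : False := by
  have hle := wf.le
  set J : SimpleGraph V :=
    { Adj := fun y z => (Hgraph C).Adj y z ∨ s(y, z) = s(u a, u b)
      symm := ⟨fun y z h => by rwa [SimpleGraph.adj_comm, Sym2.eq_swap]⟩
      loopless := ⟨fun y h => by
        rcases h with h | h
        · exact h.ne rfl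
        · rcases Sym2.eq_iff.1 h with ⟨h1, h2⟩ | ⟨h1, h2⟩
          · exact hab.1.ne (h1.symm.trans h2)
          · exact hab.1.ne (h2.symm.trans h1)⟩ } with hJdef
  have hHJ : Hgraph C ≤ J := fun y z h => Or.inl h
  have hJ : J ≤ G := by
    rintro y z (h | h)
    · exact Hgraph_le h
    · rw [← SimpleGraph.mem_edgeSet, h]
      exact hab.1
  have hne : ∀ {p q}, i₁ ≤ p → p ≤ i₁ + j₁ → i₁ ≤ q → q ≤ i₁ + j₁ → p ≠ q → u p ≠ u q :=
    fun _ _ _ _ h => hu.ne h (by omega) (by omega)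
  have hac' := hne (p := c) (q := a) (by omega) (by omega) (by omega) (by omega) (by omega)
  have hcb' := hne (p := c) (q := b) (by omega) (by omega) (by omega) (by omega) (by omega)
  have had' := hne (p := d) (q := a) (by omega) (by omega) (by omega) (by omega) (by omega)
  have hbd' := hne (p := d) (q := b) (by omega) (by omega) (by omega) (by omega) (by omega)
  have hnotab : ∀ {y}, y ≠ u a → y ≠ u b → ∀ {z}, J.Adj y z → (Hgraph C).Adj y z := by
    intro y h1 h2 z h
    refine h.resolve_right fun h => ?_
    rcases Sym2.eq_iff.1 h with h | h
    · exact h1 h.1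
    · exact h2 h.1
  obtain ⟨h, hh, hin, hcl⟩ := exists_isFaceOf_of_arc (emb := emb) hJ hcd.1
    (fun h => hcd.not_adj hf (hnotab hac' hcb' h))
  have hhf : h ⊆ f := by
    obtain ⟨z, hz, hz'⟩ := exists_inner_point (emb := emb) hcd.1
    exact hf.subset_of_isPreconnected hh.isPreconnected
      (hh.subset_compl.trans (Set.compl_subset_compl.2 (drawing_mono hHJ))) (hin z hz hz')
      (hcd.2 z hz hz')
  have hcc : emb.arc (u c) (u (c + 1)) ⊆ closure h := by
    obtain ⟨w, hw, hwJ, hwh⟩ := exists_arc_subset_closure hJ hh (hHJ (hu.Hgraph_adj' c))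
      (hHJ (hu.Hgraph_adj c)) (hu.ne_sub_add c) (hcl (pos_left_mem_arc hcd.1))
    rwa [(wf.eq_of_arc_subset hu (by omega) (by omega) (hnotab hac' hcb' hwJ)
      (hwh.trans (closure_mono hhf))).resolve_left hw] at hwh
  have hdd : emb.arc (u (d - 1)) (u (d - 1 + 1)) ⊆ closure h := by
    have hdc := hcl (pos_right_mem_arc hcd.1)
    rcases hd.lt_or_eq with hd | rfl
    · obtain ⟨w, hw, hwJ, hwh⟩ := exists_arc_subset_closure hJ hh (hHJ (hu.Hgraph_adj d))
        (hHJ (hu.Hgraph_adj' d)) (hu.ne_sub_add d).symm hdc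
      rwa [(wf.eq_of_arc_subset hu (by omega) (by omega) (hnotab had' hbd' hwJ)
        (hwh.trans (closure_mono hhf))).resolve_right hw, arc_sub_one] at hwh
    · obtain ⟨w, hw, hwJ, hwh⟩ := exists_arc_subset_closure hJ hh
        (hHJ (Hgraph_adj_of_not_mem wf.not_mem wf.adj_right).symm) (hHJ (hu.Hgraph_adj' _))
        (hu.ne_of_not_mem wf.not_mem _).symm hdc
      have hwH := hnotab had' hbd' hwJ
      by_cases hwC : w ∈ C.support
      · rcases hu.eq_of_Hgraph_adj hwH hwC with rfl | rfl
        · rwa [arc_sub_one] at hwh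
        · obtain ⟨l, h1, h2, h3⟩ := (wf.edge_iff _).1 (hwh.trans (closure_mono hhf))
          have := Int.eq_zero_of_abs_lt_dvd h3 (abs_lt.2 ⟨by omega, by omega⟩)
          omega
      · exact absurd (wf.eq_of_mem_closure w hwC (closure_mono hhf
          (hwh (pos_right_mem_arc (Hgraph_le hwH))))) hw
  have habH := hab.not_adj hf
  have hncl : ¬ emb.arc (u b) (u a) ⊆ closure h := by
    intro hcon
    have hnee : ∀ k, s(u b, u a) ≠ s(u k, u (k + 1)) := fun k hk => habH (by
      have := hu.Hgraph_adj k
      rw [← SimpleGraph.mem_edgeSet, ← hk, Sym2.eq_swap] at this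
      exact this)
    refine hu.false_of_bond hJ (fun k => hHJ (hu.Hgraph_adj k)) hh (p := c) (q := d - 1)
      (by omega) (by omega) hcc hdd (hu.disjoint_Icc _ _)
      (joinedIn_drawingOn_image_Icc hJ (fun k => hHJ (hu.Hgraph_adj k)) _ _)
      (joinedIn_drawingOn_image_Icc hJ (fun k => hHJ (hu.Hgraph_adj k)) _ _)
      subset_rfl subset_rfl ⟨b, ⟨by omega, by omega⟩, rfl⟩
      ⟨a + C.length, ⟨by omega, by omega⟩, (hu.eq_of_dvd (by simp)).symm⟩
      (Or.inr Sym2.eq_swap) hcon (hnee _) (hnee _)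
  have hhH : IsFaceOf (drawingOn emb (Hgraph C) Set.univ) h := by
    refine (hh.of_le hJ hHJ fun y z hyz hcon => hyz.resolve_right fun he => hncl ?_).2
    rcases Sym2.eq_iff.1 he with ⟨rfl, rfl⟩ | ⟨rfl, rfl⟩
    · rwa [emb.arc_symm]
    · exact hcon
  have heq : h = f := by
    by_contra hne
    obtain ⟨z, hz⟩ := hhH.nonempty
    exact Set.disjoint_left.1 (hhH.disjoint hf hne) hz (hhf hz)
  obtain ⟨z, hz, hz'⟩ := exists_inner_point (emb := emb) hab.1
  exact hh.subset_compl (heq ▸ hab.2 z hz hz')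
    (arc_subset_drawing (J := J) (Or.inr rfl) hz)

end Chords

section Tilings

variable {V : Type*} [Fintype V] {G : SimpleGraph V} {emb : PlaneEmbedding G}
  {f : Set (ℝ × ℝ)} {x : V} {C : G.Walk x x} {u : ℤ → V} {v : V}

/-- Some face of `H` other than `f` has a window of `j` cycle edges starting at `u a`. -/
def OtherWindow (emb : PlaneEmbedding G) (C : G.Walk x x) (u : ℤ → V) (f : Set (ℝ × ℝ))
    (a j : ℤ) : Prop :=
  ∃ g w, IsFaceOf (drawingOn emb (Hgraph C) Set.univ) g ∧ f ≠ g ∧ MinorWindow emb C u g w a j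

omit [Fintype V] in
theorem OtherWindow.reverse {a j : ℤ} (h : OtherWindow emb C u f a j) (m : ℤ) :
    OtherWindow emb C (fun k => u (m - k)) f (m - a - j) j := by
  obtain ⟨g, w, hg, hfg, hw⟩ := h
  exact ⟨g, w, hg, hfg, hw.reverse m⟩

theorem OtherWindow.exists_chord (hu : CycEnum C u) (hC : IsLongestIsolatingCycle G C)
    (h3 : ThreeConnected G) (hf : IsFaceOf (drawingOn emb (Hgraph C) Set.univ) f) {j : ℤ}
    (wf : MinorWindow emb C u f v 0 j) (hn : 5 ≤ C.length) {c : ℤ} (hc : 0 < c) (hcj : c < j)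
    (h : OtherWindow emb C u f (c - 1) 2) :
    ∃ k, 0 ≤ k ∧ k ≤ j ∧ (k ≤ c - 3 ∨ c + 3 ≤ k) ∧ RunsInside emb f (u c) (u k) := by
  obtain ⟨g, w, hg, hfg, hw⟩ := h
  have h₁ := hu.ne (a := c) (b := c - 1) (by omega) (by omega) (by omega)
  have h₂ := hu.ne (a := c) (b := c + 1) (by omega) (by omega) (by omega)
  obtain ⟨y, hy, hy₁, hy₂⟩ := h3.exists_adj_ne _ _ _ h₁ h₂
  have hr := hw.adj_right
  rw [show c - 1 + 2 = c + 1 by ring] at hr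
  rcases wf.exists_runsInside hu hf hg hfg hw (c := c) (by omega) (by omega) (by omega) (by omega)
    hy hy₁ hy₂ with ⟨k, hk₁, hk₂, rfl, hk⟩ | ⟨k, hk₁, hk₂, rfl⟩
  · refine ⟨k, hk₁, by omega, ?_, hk⟩
    by_contra hcon
    have : k = c - 2 ∨ k = c - 1 ∨ k = c ∨ k = c + 1 ∨ k = c + 2 := by omega
    rcases this with rfl | rfl | rfl | rfl | rfl
    · exact hu.not_adj_sub_two hC hn hw.not_mem hw.adj_left hr hy
    · exact hy₁ rfl
    · exact hy.ne rfl
    · exact hy₂ rfl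
    · exact hu.not_adj_add_two hC hn hw.not_mem hw.adj_left hr hy
  · have : k = c - 1 ∨ k = c ∨ k = c + 1 := by omega
    rcases this with rfl | rfl | rfl
    · exact absurd rfl hy₁
    · exact absurd rfl hy.ne
    · exact absurd rfl hy₂

theorem MinorWindow.false_of_twos_odd (hu : CycEnum C u) (hC : IsLongestIsolatingCycle G C)
    (h3 : ThreeConnected G) (hf : IsFaceOf (drawingOn emb (Hgraph C) Set.univ) f)
    (wf : MinorWindow emb C u f v 0 8) (h₁ : OtherWindow emb C u f 1 2)
    (h₃ : OtherWindow emb C u f 3 2) (h₅ : OtherWindow emb C u f 5 2) : False := by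
  have hn := wf.le
  have cross {a b c d : ℤ} := wf.not_crossing hu hf (a := a) (b := b) (c := c) (d := d)
  obtain ⟨k, hk, hk', h, q⟩ := OtherWindow.exists_chord hu hC h3 hf wf (by omega) (c := 2)
    (by norm_num) (by norm_num) h₁
  obtain ⟨l, hl, hl', h', q'⟩ := OtherWindow.exists_chord hu hC h3 hf wf (by omega) (c := 4)
    (by norm_num) (by norm_num) h₃
  obtain ⟨m, hm, hm', h'', q''⟩ := OtherWindow.exists_chord hu hC h3 hf wf (by omega) (c := 6)
    (by norm_num) (by norm_num) h₅
  rcases h' with h' | h'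
  · exact cross hl (by omega) (by norm_num) (by omega) (by omega) q'.symm q
  · exact cross hm (by omega) (by norm_num) (by omega) (by omega) q''.symm q'

theorem MinorWindow.false_of_twos_even (hu : CycEnum C u) (hC : IsLongestIsolatingCycle G C)
    (h3 : ThreeConnected G) (hf : IsFaceOf (drawingOn emb (Hgraph C) Set.univ) f)
    (wf : MinorWindow emb C u f v 0 8) (h₀ : OtherWindow emb C u f 0 2)
    (h₂ : OtherWindow emb C u f 2 2) (h₄ : OtherWindow emb C u f 4 2)
    (h₆ : OtherWindow emb C u f 6 2) : False := by
  have hn := wf.le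
  have cross {a b c d : ℤ} := wf.not_crossing hu hf (a := a) (b := b) (c := c) (d := d)
  obtain ⟨k, hk, hk', h, q⟩ := OtherWindow.exists_chord hu hC h3 hf wf (by omega) (c := 1)
    (by norm_num) (by norm_num) h₀
  obtain ⟨l, hl, hl', h', q'⟩ := OtherWindow.exists_chord hu hC h3 hf wf (by omega) (c := 3)
    (by norm_num) (by norm_num) h₂
  obtain ⟨m, hm, hm', h'', q''⟩ := OtherWindow.exists_chord hu hC h3 hf wf (by omega) (c := 5)
    (by norm_num) (by norm_num) h₄
  obtain ⟨r, hr, hr', h₇, q₇⟩ := OtherWindow.exists_chord hu hC h3 hf wf (by omega) (c := 7)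
    (by norm_num) (by norm_num) h₆
  rcases h' with h' | h'
  · exact cross hl (by omega) (by norm_num) (by omega) (by omega) q'.symm q
  rcases h'' with h'' | h''
  · exact cross hm (by omega) (by norm_num) (by omega) (by omega) q''.symm q'
  · exact cross hr (by omega) (by norm_num) (by omega) (by omega) q₇.symm q''

theorem MinorWindow.false_of_three_twos (hu : CycEnum C u) (hC : IsLongestIsolatingCycle G C)
    (h3 : ThreeConnected G) (hf : IsFaceOf (drawingOn emb (Hgraph C) Set.univ) f)
    (wf : MinorWindow emb C u f v 0 8) (h₁ : OtherWindow emb C u f (-1) 3)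
    (h₂ : OtherWindow emb C u f 2 2) (h₄ : OtherWindow emb C u f 4 2)
    (h₆ : OtherWindow emb C u f 6 2) : False := by
  have hn := wf.le
  have cross {a b c d : ℤ} := wf.not_crossing hu hf (a := a) (b := b) (c := c) (d := d)
  obtain ⟨l, hl, hl', h', q'⟩ := OtherWindow.exists_chord hu hC h3 hf wf (by omega) (c := 3)
    (by norm_num) (by norm_num) h₂
  obtain ⟨m, hm, hm', h'', q''⟩ := OtherWindow.exists_chord hu hC h3 hf wf (by omega) (c := 5)
    (by norm_num) (by norm_num) h₄
  obtain ⟨r, hr, hr', h₇, q₇⟩ := OtherWindow.exists_chord hu hC h3 hf wf (by omega) (c := 7)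
    (by norm_num) (by norm_num) h₆
  have hl0 : l = 0 := by
    rcases h'' with h'' | h''
    · by_contra hl0
      exact cross hm (by omega) (by norm_num) (by omega) (by omega) q''.symm q'
    · exact (cross hr (by omega) (by norm_num) (by omega) (by omega) q₇.symm q'').elim
  subst hl0
  obtain ⟨g', w', -, -, hw'⟩ := h₂
  obtain ⟨g, w, hg, hfg, hw⟩ := h₁
  obtain ⟨y, hy, hy₁, hy₂⟩ := h3.exists_adj_ne (u 0) (u 2) (u 1)
    (hu.ne (by omega) (by omega) (by omega)) (hu.ne (by omega) (by omega) (by omega))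
  have hlong : G.Adj (u 1) (u (-1)) → False := fun h =>
    hu.not_adj_of_overlap hC (by omega) hw'.not_mem (c := -1) (by simpa using hw'.adj_left)
      (by simpa using hw'.adj_right) (by simpa using h.symm) (by simpa using q'.1.symm)
  rcases wf.exists_runsInside hu hf hg hfg hw (c := 1) (by omega) (by omega) (by omega) (by omega)
    hy hy₁ hy₂ with ⟨k, hk₁, hk₂, rfl, hk⟩ | ⟨k, hk₁, hk₂, rfl⟩
  · have : k = 0 ∨ k = 1 ∨ k = 2 ∨ k = 3 ∨ 3 < k := by omega
    rcases this with rfl | rfl | rfl | rfl | h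
    · exact hy₁ rfl
    · exact hy.ne rfl
    · exact hy₂ rfl
    · exact hu.not_adj_sub_two hC (by omega) hw'.not_mem (c := 3) hw'.adj_left hw'.adj_right
        hy.symm
    · exact cross le_rfl (by norm_num) (by norm_num) h (by omega) q'.symm hk
  · have : k = -1 ∨ k = 0 ∨ k = 1 ∨ k = 2 := by omega
    rcases this with rfl | rfl | rfl | rfl
    · exact hlong hy
    · exact hy₁ rfl
    · exact hy.ne rfl
    · exact hy₂ rfl

theorem OtherWindow.dvd_of_overlap (hu : CycEnum C u)
    (hf : IsFaceOf (drawingOn emb (Hgraph C) Set.univ) f) {a b j l k : ℤ}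
    (hk : emb.arc (u k) (u (k + 1)) ⊆ closure f) (ha : OtherWindow emb C u f a j)
    (hb : OtherWindow emb C u f b l) (hak : a ≤ k) (hka : k < a + j) (hbk : b ≤ k)
    (hkb : k < b + l) : (C.length : ℤ) ∣ b - a ∧ j = l := by
  obtain ⟨g, w, hg, hfg, hw⟩ := ha
  obtain ⟨g', w', hg', hfg', hw'⟩ := hb
  have h := eq_or_eq_of_arc_subset_closure Hgraph_le hf hg hg' hfg (hu.Hgraph_adj k) hk
    ((hw.edge_iff k).2 ⟨k, hak, hka, by simp⟩) ((hw'.edge_iff k).2 ⟨k, hbk, hkb, by simp⟩)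
  have := h.resolve_left (Ne.symm hfg')
  subst this
  have hjl : j = l := (hw.numCEdges_eq hu).symm.trans (hw'.numCEdges_eq hu)
  subst hjl
  have h1 := hw.le
  have h2 := hw.pos
  refine ⟨?_, rfl⟩
  obtain ⟨t, h3, h4, h5⟩ := (hw.edge_iff b).1 ((hw'.edge_iff b).2 ⟨b, le_rfl, by omega, by simp⟩)
  rcases h3.eq_or_lt with rfl | h3
  · exact h5
  · obtain ⟨l, h6, h7, h8⟩ := (hw'.edge_iff (b - 1)).1
      ((hw.edge_iff (b - 1)).2 ⟨t - 1, by omega, by omega, by simpa using h5⟩)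
    have := Int.eq_zero_of_abs_lt_dvd h8 (abs_lt.2 ⟨by omega, by omega⟩)
    omega

/-- The eight cycle edges of a minor 8-face are never covered by opposite 2-faces and at most one
opposite 3-face meeting the 8-face in two edges. -/
theorem MinorWindow.false_of_tiling (hu : CycEnum C u) (hC : IsLongestIsolatingCycle G C)
    (h3 : ThreeConnected G) (hf : IsFaceOf (drawingOn emb (Hgraph C) Set.univ) f)
    (wf : MinorWindow emb C u f v 0 8)
    (hthree : ¬ (OtherWindow emb C u f (-1) 3 ∧ OtherWindow emb C u f 6 3))
    (hcov : ∀ k, 0 ≤ k → k < 8 → OtherWindow emb C u f k 2 ∨ OtherWindow emb C u f (k - 1) 2 ∨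
      (k < 2 ∧ OtherWindow emb C u f (-1) 3) ∨ (6 ≤ k ∧ OtherWindow emb C u f 6 3)) : False := by
  have hn := wf.le
  have hk : ∀ k, 0 ≤ k → k < 8 → emb.arc (u k) (u (k + 1)) ⊆ closure f := fun k h1 h2 =>
    (wf.edge_iff k).2 ⟨k, h1, h2, by simp⟩
  have h22 : ∀ a, -1 ≤ a → a < 7 → OtherWindow emb C u f a 2 →
      ¬ OtherWindow emb C u f (a + 1) 2 := fun a h1 h2 ha hb => by
    have h := (ha.dvd_of_overlap hu hf (hk (a + 1) (by omega) (by omega)) hb (by omega) (by omega)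
      (by omega) (by omega)).1
    have := Int.le_of_dvd (by omega) h
    omega
  have h23 : ∀ a b k, 0 ≤ k → k < 8 → a ≤ k → k < a + 2 → b ≤ k → k < b + 3 →
      OtherWindow emb C u f a 2 → ¬ OtherWindow emb C u f b 3 := by
    intro a b k h1 h2 h3 h4 h5 h6 ha hb
    have h := (ha.dvd_of_overlap hu hf (hk k h1 h2) hb h3 h4 h5 h6).2
    omega
  have c0 := hcov 0 (by norm_num) (by norm_num)
  have c1 := hcov 1 (by norm_num) (by norm_num)
  have c2 := hcov 2 (by norm_num) (by norm_num)
  have c3 := hcov 3 (by norm_num) (by norm_num)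
  have c4 := hcov 4 (by norm_num) (by norm_num)
  have c5 := hcov 5 (by norm_num) (by norm_num)
  have c6 := hcov 6 (by norm_num) (by norm_num)
  have c7 := hcov 7 (by norm_num) (by norm_num)
  have d0 := h22 (-1) (by norm_num) (by norm_num)
  have d1 := h22 0 (by norm_num) (by norm_num)
  have d2 := h22 1 (by norm_num) (by norm_num)
  have d3 := h22 2 (by norm_num) (by norm_num)
  have d4 := h22 3 (by norm_num) (by norm_num)
  have d5 := h22 4 (by norm_num) (by norm_num)
  have d6 := h22 5 (by norm_num) (by norm_num)
  have d7 := h22 6 (by norm_num) (by norm_num)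
  have e0 := h23 (-1) (-1) 0 (by norm_num) (by norm_num) (by norm_num) (by norm_num)
    (by norm_num) (by norm_num)
  have e1 := h23 1 (-1) 1 (by norm_num) (by norm_num) (by norm_num) (by norm_num)
    (by norm_num) (by norm_num)
  have e2 := h23 5 6 6 (by norm_num) (by norm_num) (by norm_num) (by norm_num)
    (by norm_num) (by norm_num)
  have e3 := h23 7 6 7 (by norm_num) (by norm_num) (by norm_num) (by norm_num)
    (by norm_num) (by norm_num)
  have t1 := wf.false_of_twos_odd hu hC h3 hf
  have t2 := wf.false_of_twos_even hu hC h3 hf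
  have t3 := wf.false_of_three_twos hu hC h3 hf
  have t4 : OtherWindow emb C u f 6 3 → OtherWindow emb C u f 4 2 → OtherWindow emb C u f 2 2 →
      OtherWindow emb C u f 0 2 → False := fun h₁ h₂ h₄ h₆ =>
    (wf.reverse 8).false_of_three_twos (hu.reverse 8) hC h3 hf (h₁.reverse 8) (h₂.reverse 8)
      (h₄.reverse 8) (h₆.reverse 8)
  norm_num at c0 c1 c2 c3 c4 c5 c6 c7 d0 d1 d2 d3 d4 d5 d6 d7
  clear hcov h22 h23 hk hu wf hC h3 hf hn
  grind

end Tilings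

section Discharging

variable {V : Type*} [Fintype V] {G : SimpleGraph V} {emb : PlaneEmbedding G}
  {f g : Set (ℝ × ℝ)} {x : V} {C : G.Walk x x} {u : ℤ → V} {v : V}

theorem sendWeight_nonneg : 0 ≤ sendWeight emb C f g := by
  unfold sendWeight
  positivity

omit [Fintype V] in
theorem mEdges_comm : mEdges emb C f g = mEdges emb C g f := by
  simp only [mEdges, and_comm]

theorem sendWeight_cases (hf : MinorFaceH emb C f) (h : sendWeight emb C f g ≠ 0) :
    MinorFaceH emb C g ∧ f ≠ g ∧
      ((numCEdges emb C g = 2 ∧ sendWeight emb C f g = 2 / 3 * mEdges emb C f g) ∨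
        (numCEdges emb C g = 3 ∧ sendWeight emb C f g = 1 ∧
          ∃ e, IsMiddleCEdge emb C g e ∧ incEdge emb f e) ∨
        (numCEdges emb C g = 4 ∧ sendWeight emb C f g = 2 / 3 ∧ mEdges emb C f g = 2) ∨
        (numCEdges emb C g = 5 ∧ sendWeight emb C f g = 1 / 3 ∧ mEdges emb C f g = 2)) := by
  have hmaj : ¬ MajorFaceH emb C f := fun h => h.2 hf
  simp only [sendWeight, hmaj, false_and, if_false, zero_add, mEdges_comm (f := g) (g := f)] at h ⊢
  by_cases h2 : numCEdges emb C g = 2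
  · simp only [h2, Nat.reduceEqDiff, false_and, and_false, if_false, add_zero]
      at h ⊢
    obtain ⟨hc, h⟩ : _ ∧ _ := by simpa only [ne_eq, ite_eq_right_iff, Classical.not_imp] using h
    exact ⟨hc.2.1, hc.2.2.2.1, Or.inl ⟨trivial, if_pos hc⟩⟩
  by_cases h3 : numCEdges emb C g = 3
  · simp only [h3, Nat.reduceEqDiff, false_and, and_false, if_false, add_zero,
      zero_add] at h ⊢
    obtain ⟨hc, h⟩ : _ ∧ _ := by simpa only [ne_eq, ite_eq_right_iff, Classical.not_imp] using h
    exact ⟨hc.2.1, hc.2.2.2.1, Or.inr (Or.inl ⟨trivial, if_pos hc, hc.2.2.2.2⟩)⟩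
  by_cases h4 : numCEdges emb C g = 4
  · simp only [h4, Nat.reduceEqDiff, false_and, and_false, if_false, add_zero,
      zero_add] at h ⊢
    obtain ⟨hc, h⟩ : _ ∧ _ := by simpa only [ne_eq, ite_eq_right_iff, Classical.not_imp] using h
    exact ⟨hc.2.2.1, hc.2.2.2.2.1.1.symm, Or.inr (Or.inr (Or.inl ⟨trivial, if_pos hc,
      hc.2.2.2.2.2.1⟩))⟩
  by_cases h5 : numCEdges emb C g = 5
  · simp only [h5, Nat.reduceEqDiff, false_and, and_false, if_false, add_zero,
      zero_add] at h ⊢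
    obtain ⟨hc, h⟩ : _ ∧ _ := by simpa only [ne_eq, ite_eq_right_iff, Classical.not_imp] using h
    exact ⟨hc.2.2.1, hc.2.2.2.2.1.1.symm, Or.inr (Or.inr (Or.inr ⟨trivial, if_pos hc,
      hc.2.2.2.2.2.1⟩))⟩
  · simp [h2, h3, h4, h5] at h

/-- The cycle edges of a window starting at `u 0` that are incident with `g`. -/
def commonIndices (emb : PlaneEmbedding G) (u : ℤ → V) (j : ℤ) (g : Set (ℝ × ℝ)) : Finset ℤ :=
  (Finset.Ico 0 j).filter fun k => emb.arc (u k) (u (k + 1)) ⊆ closure g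

omit [Fintype V] in
theorem mem_commonIndices {j k : ℤ} : k ∈ commonIndices emb u j g ↔
    (0 ≤ k ∧ k < j) ∧ emb.arc (u k) (u (k + 1)) ⊆ closure g := by
  rw [commonIndices, Finset.mem_filter, Finset.mem_Ico]

namespace MinorWindow

variable {j : ℤ}

omit [Fintype V] in
theorem mEdges_eq (hu : CycEnum C u) (wf : MinorWindow emb C u f v 0 j) :
    mEdges emb C f g = (commonIndices emb u j g).card := by
  rw [mEdges, hu.card_filter_edges 0 fun e => incEdge emb f e ∧ incEdge emb g e]
  congr 1
  ext k
  rw [mem_commonIndices, Finset.mem_filter, Finset.mem_Ico]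
  have hle := wf.le
  constructor
  · rintro ⟨⟨h1, h2⟩, h3, h4⟩
    obtain ⟨l, h5, h6, h7⟩ := (wf.edge_iff k).1 h3
    have := Int.eq_zero_of_abs_lt_dvd h7 (abs_lt.2 ⟨by omega, by omega⟩)
    exact ⟨⟨by omega, by omega⟩, h4⟩
  · rintro ⟨⟨h1, h2⟩, h3⟩
    exact ⟨⟨h1, by omega⟩, (wf.edge_iff k).2 ⟨k, h1, by omega, by simp⟩, h3⟩

theorem eq_of_mem_commonIndices (hu : CycEnum C u) (wf : MinorWindow emb C u f v 0 j)
    (hf : IsFaceOf (drawingOn emb (Hgraph C) Set.univ) f) {g g' : Set (ℝ × ℝ)}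
    (hg : IsFaceOf (drawingOn emb (Hgraph C) Set.univ) g)
    (hg' : IsFaceOf (drawingOn emb (Hgraph C) Set.univ) g') (hfg : f ≠ g) (hfg' : f ≠ g') {k : ℤ}
    (hk : k ∈ commonIndices emb u j g) (hk' : k ∈ commonIndices emb u j g') : g = g' := by
  rw [mem_commonIndices] at hk hk'
  exact ((eq_or_eq_of_arc_subset_closure Hgraph_le hf hg hg' hfg (hu.Hgraph_adj k)
    ((wf.edge_iff k).2 ⟨k, hk.1.1, by omega, by simp⟩) hk.2 hk'.2).resolve_left hfg'.symm).symm

omit [Fintype V] in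
theorem exists_start_of_mem (hu : CycEnum C u) {i j k : ℤ} (hw : MinorWindow emb C u g v i j)
    (hk : emb.arc (u k) (u (k + 1)) ⊆ closure g) :
    ∃ i', i' ≤ k ∧ k < i' + j ∧ MinorWindow emb C u g v i' j := by
  obtain ⟨l, h1, h2, h3⟩ := (hw.edge_iff k).1 hk
  refine ⟨k - (l - i), by omega, by omega, hw.of_dvd hu ?_⟩
  convert h3 using 1
  ring

omit [Fintype V] in
theorem exists_middle (hu : CycEnum C u) (wf : MinorWindow emb C u f v 0 j) {w : V} {i : ℤ}
    (wg : MinorWindow emb C u g w i 3) {e : Sym2 V} (he : IsMiddleCEdge emb C g e)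
    (hef : incEdge emb f e) : ∃ q, 0 ≤ q ∧ q < j ∧ MinorWindow emb C u g w (q - 1) 3 := by
  have hle := wg.le
  obtain ⟨heC, heg, hmid⟩ := he
  obtain ⟨k, rfl⟩ := (hu.mem_edges e).1 heC
  obtain ⟨q, h1, h2, h3⟩ := (wf.edge_iff k).1 hef
  have hkq := (hu.edge_eq_iff q k).2 h3
  rw [← hkq] at heg hmid
  obtain ⟨i', h4, h5, wg'⟩ := wg.exists_start_of_mem hu heg
  refine ⟨q, h1, by omega, ?_⟩
  have hend : ∀ l, i' ≤ l → l < i' + 3 → (q + 2 = l ∨ l + 2 = q) → False := by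
    intro l h6 h7 h8
    obtain ⟨y, hy, hy'⟩ := hmid s(u l, u (l + 1)) ((hu.mem_edges _).2 ⟨l, rfl⟩)
      ((wg'.edge_iff l).2 ⟨l, h6, h7, by simp⟩) (by
        rw [Ne, hu.edge_eq_iff]
        intro h
        have := Int.eq_zero_of_abs_lt_dvd h (abs_lt.2 ⟨by omega, by omega⟩)
        omega)
    rw [Sym2.mem_iff] at hy hy'
    rcases hy with rfl | rfl <;> rcases hy' with h | h <;>
    · have := hu.eq_of_lt h (by omega) (by omega)
      omega
  have : i' = q - 1 := by
    by_contra hne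
    rcases (show i' = q ∨ i' + 2 = q by omega) with h | h
    · exact hend (q + 2) (by omega) (by omega) (Or.inl rfl)
    · exact hend i' (by omega) (by omega) (Or.inr h)
  rwa [← this]

omit [Fintype V] in
theorem commonIndices_eq {w : V} {i l : ℤ}
    (wg : MinorWindow emb C u g w i l) (h₁ : j < i + C.length) (h₂ : i + l ≤ C.length) :
    commonIndices emb u j g = Finset.Ico (max 0 i) (min j (i + l)) := by
  ext k
  rw [mem_commonIndices, wg.edge_iff, Finset.mem_Ico, max_le_iff, lt_min_iff]
  constructor
  · rintro ⟨⟨h1, h2⟩, t, h3, h4, h5⟩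
    have := Int.eq_zero_of_abs_lt_dvd h5 (abs_lt.2 ⟨by omega, by omega⟩)
    omega
  · rintro ⟨⟨h1, h2⟩, h3, h4⟩
    exact ⟨⟨h1, h3⟩, k, h2, h4, by simp⟩

theorem sum_sendWeight_le (hu : CycEnum C u) (hC : IsLongestIsolatingCycle G C)
    (h3 : ThreeConnected G) (hf : MinorFaceH emb C f) (wf : MinorWindow emb C u f v 0 8) :
    ∑ᶠ g, sendWeight emb C f g ≤ 14 / 3 := by
  by_contra! hlt
  have hle := wf.le
  have hfin : (Function.support fun g => sendWeight emb C f g).Finite := by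
    by_contra hinf
    rw [finsum_of_infinite_support hinf] at hlt
    norm_num at hlt
  rw [finsum_eq_sum _ hfin] at hlt
  set F := hfin.toFinset with hF
  have hcases : ∀ g ∈ F, _ := fun g hg =>
    sendWeight_cases (emb := emb) (C := C) (g := g) hf ((hfin.mem_toFinset).1 hg)
  have hwin : ∀ g ∈ F, 1 ≤ numCEdges emb C g →
      ∃ w i, MinorWindow emb C u g w i (numCEdges emb C g) := by
    intro g hg h
    obtain ⟨w, i, l, hw⟩ := (hcases g hg).1.exists_window hu hC.2.1 h
    rw [hw.numCEdges_eq hu]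
    exact ⟨w, i, hw⟩
  have hmid : ∀ g ∈ F, numCEdges emb C g = 3 → ∃ w q, 0 ≤ q ∧ q < 8 ∧
      MinorWindow emb C u g w (q - 1) 3 ∧
      commonIndices emb u 8 g = Finset.Ico (max 0 (q - 1)) (min 8 (q - 1 + 3)) := by
    intro g hg h
    obtain ⟨w, i, hw⟩ := hwin g hg (by omega)
    rw [h] at hw
    obtain ⟨-, -, h' | ⟨-, -, e, he, hef⟩ | h' | h'⟩ := hcases g hg
    · omega
    · obtain ⟨q, h1, h2, hq⟩ := wf.exists_middle hu hw he hef
      exact ⟨w, q, h1, h2, hq, hq.commonIndices_eq (by omega) (by omega)⟩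
    · omega
    · omega
  set T := commonIndices emb u 8 with hT
  have hm : ∀ g, mEdges emb C f g = (T g).card := fun g => wf.mEdges_eq hu
  have hdisj : ∀ g ∈ F, ∀ g' ∈ F, g ≠ g' → Disjoint (T g) (T g') := by
    intro g hg g' hg' hne
    rw [Finset.disjoint_left]
    intro k hk hk'
    exact hne (wf.eq_of_mem_commonIndices hu hf.isFaceOf (hcases g hg).1.isFaceOf
      (hcases g' hg').1.isFaceOf (hcases g hg).2.1 (hcases g' hg').2.1 hk hk')
  have hsum : ∑ g ∈ F, (T g).card = (F.biUnion T).card := (Finset.card_biUnion hdisj).symm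
  have hsub : F.biUnion T ⊆ Finset.Ico 0 8 := by
    intro k hk
    obtain ⟨g, -, hk⟩ := Finset.mem_biUnion.1 hk
    exact Finset.mem_Ico.2 (mem_commonIndices.1 hk).1
  have hcard8 : (F.biUnion T).card ≤ 8 := by simpa using Finset.card_le_card hsub
  have hthreecard : ∀ g ∈ F, numCEdges emb C g = 3 → 2 ≤ (T g).card := by
    intro g hg h
    obtain ⟨w, q, h1, h2, -, h4⟩ := hmid g hg h
    rw [h4, Int.card_Ico]
    omega
  have hbound : ∀ g ∈ F, sendWeight emb C f g ≤ 2 / 3 * ((T g).card : ℚ) ∧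
      (numCEdges emb C g = 3 → sendWeight emb C f g ≤ 2 / 3 * ((T g).card : ℚ) - 1 / 3) ∧
      (¬ (numCEdges emb C g = 2 ∨ (numCEdges emb C g = 3 ∧ (T g).card = 2)) →
        sendWeight emb C f g ≤ 2 / 3 * ((T g).card : ℚ) - 2 / 3) := by
    intro g hg
    have h23 := hthreecard g hg
    obtain ⟨-, -, ⟨h1, h2⟩ | ⟨h1, h2, -⟩ | ⟨h1, h2, h4⟩ | ⟨h1, h2, h4⟩⟩ := hcases g hg
    · rw [h2, hm]
      exact ⟨le_rfl, by omega, by omega⟩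
    · rw [h2]
      have h5 : (2 : ℚ) ≤ (T g).card := by exact_mod_cast h23 h1
      refine ⟨by linarith, fun _ => by linarith, fun h => ?_⟩
      have h6 : 3 ≤ (T g).card := by
        have := h23 h1
        by_contra
        exact h (Or.inr ⟨h1, by omega⟩)
      have h6 : (3 : ℚ) ≤ (T g).card := by exact_mod_cast h6
      linarith
    · rw [hm] at h4
      rw [h2, h4]
      exact ⟨by norm_num, by omega, by norm_num⟩
    · rw [hm] at h4
      rw [h2, h4]
      exact ⟨by norm_num, by omega, by norm_num⟩
  have hkey : ∀ d : Set (ℝ × ℝ) → ℚ,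
      (∀ g ∈ F, sendWeight emb C f g ≤ 2 / 3 * ((T g).card : ℚ) - d g) →
      14 / 3 < 2 / 3 * ((F.biUnion T).card : ℚ) - ∑ g ∈ F, d g := by
    intro d hd
    refine hlt.trans_le ((Finset.sum_le_sum hd).trans ?_)
    rw [Finset.sum_sub_distrib, ← Finset.mul_sum, ← hsum]
    push_cast
    rfl
  have hcard8' : ((F.biUnion T).card : ℚ) ≤ 8 := by exact_mod_cast hcard8
  have hcover : ∀ k, 0 ≤ k → k < 8 → ∃ g ∈ F, k ∈ T g := by
    intro k h1 h2
    by_contra! hcon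
    have hlt' : (F.biUnion T).card < (Finset.Ico (0 : ℤ) 8).card :=
      Finset.card_lt_card ⟨hsub, fun h => by
        obtain ⟨g, hg, hk⟩ := Finset.mem_biUnion.1 (h (Finset.mem_Ico.2 ⟨h1, h2⟩))
        exact hcon g hg hk⟩
    have h7 : (F.biUnion T).card ≤ 7 := by
      rw [Int.card_Ico] at hlt'
      omega
    have h7 : ((F.biUnion T).card : ℚ) ≤ 7 := by exact_mod_cast h7
    have := hkey (fun _ => 0) fun g hg => by simpa using (hbound g hg).1
    simp only [Finset.sum_const_zero] at this
    linarith
  have htype : ∀ g ∈ F, numCEdges emb C g = 2 ∨ (numCEdges emb C g = 3 ∧ (T g).card = 2) := by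
    intro g₀ hg₀
    by_contra hcon
    have := hkey (fun g => if g = g₀ then 2 / 3 else 0) fun g hg => by
      by_cases h : g = g₀
      · subst h
        simpa using (hbound g hg).2.2 hcon
      · simpa [h] using (hbound g hg).1
    rw [Finset.sum_ite_eq' F g₀ (fun _ => (2 / 3 : ℚ)), if_pos hg₀] at this
    linarith
  have huniq : ∀ g₁ ∈ F, ∀ g₂ ∈ F, numCEdges emb C g₁ = 3 → numCEdges emb C g₂ = 3 → g₁ = g₂ := by
    intro g₁ hg₁ g₂ hg₂ h₁ h₂
    by_contra hne
    have := hkey (fun g => (if g = g₁ then 1 / 3 else 0) + if g = g₂ then 1 / 3 else 0)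
      fun g hg => by
        by_cases h : g = g₁
        · subst h
          simpa [hne] using (hbound g hg).2.1 h₁
        · by_cases h' : g = g₂
          · subst h'
            simpa [h] using (hbound g hg).2.1 h₂
          · simpa [h, h'] using (hbound g hg).1
    rw [Finset.sum_add_distrib, Finset.sum_ite_eq' F g₁ (fun _ => (1 / 3 : ℚ)),
      Finset.sum_ite_eq' F g₂ (fun _ => (1 / 3 : ℚ)), if_pos hg₁, if_pos hg₂] at this
    linarith
  refine wf.false_of_tiling hu hC h3 hf.isFaceOf ?_ ?_
  · rintro ⟨⟨g₁, w₁, hg₁, hfg₁, hw₁⟩, g₂, w₂, hg₂, hfg₂, hw₂⟩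
    have hmem : ∀ {g w i k}, IsFaceOf (drawingOn emb (Hgraph C) Set.univ) g → f ≠ g →
        MinorWindow emb C u g w i 3 → 0 ≤ k → k < 8 → i ≤ k → k < i + 3 → g ∈ F := by
      intro g w i k hg hfg hw h1 h2 h4 h5
      obtain ⟨g', hg', hk⟩ := hcover k h1 h2
      rwa [wf.eq_of_mem_commonIndices hu hf.isFaceOf hg (hcases g' hg').1.isFaceOf hfg
        (hcases g' hg').2.1
        (mem_commonIndices.2 ⟨⟨h1, h2⟩, (hw.edge_iff k).2 ⟨k, h4, h5, by simp⟩⟩) hk]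
    have := huniq _ (hmem hg₁ hfg₁ hw₁ (k := 0) (by norm_num) (by norm_num) (by norm_num)
      (by norm_num)) _ (hmem hg₂ hfg₂ hw₂ (k := 6) (by norm_num) (by norm_num) (by norm_num)
      (by norm_num)) (by exact_mod_cast hw₁.numCEdges_eq hu) (by exact_mod_cast hw₂.numCEdges_eq hu)
    subst this
    obtain ⟨l, h1, h2, h4⟩ := (hw₁.edge_iff 6).1 ((hw₂.edge_iff 6).2 ⟨6, by norm_num, by norm_num,
      by simp⟩)
    have := Int.eq_zero_of_abs_lt_dvd h4 (abs_lt.2 ⟨by omega, by omega⟩)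
    omega
  · intro k hk hk8
    obtain ⟨g, hg, hkg⟩ := hcover k hk hk8
    have hgf := (hcases g hg).1.isFaceOf
    have hfg := (hcases g hg).2.1
    rcases htype g hg with h | ⟨h, hc⟩
    · obtain ⟨w, i, hw⟩ := hwin g hg (by omega)
      rw [h] at hw
      obtain ⟨i', h1, h2, hw'⟩ := hw.exists_start_of_mem hu (mem_commonIndices.1 hkg).2
      push_cast at h2 hw'
      rcases (show i' = k ∨ i' = k - 1 by omega) with rfl | rfl
      · exact Or.inl ⟨g, w, hgf, hfg, hw'⟩
      · exact Or.inr (Or.inl ⟨g, w, hgf, hfg, hw'⟩)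
    · obtain ⟨w, q, h1, h2, hw, hTg⟩ := hmid g hg h
      rw [hTg] at hc hkg
      rw [Int.card_Ico] at hc
      rw [Finset.mem_Ico] at hkg
      rcases (show q = 0 ∨ q = 7 by omega) with rfl | rfl
      · exact Or.inr (Or.inr (Or.inl ⟨by omega, g, w, hgf, hfg, hw⟩))
      · exact Or.inr (Or.inr (Or.inr ⟨by omega, g, w, hgf, hfg, hw⟩))

end MinorWindow

end Discharging

/-- After discharging by rules R1–R5, every minor 8-face of `H` has weight `≥ 10/3`. -/
theorem stmt14_minor_8face
    {V : Type*} [Fintype V] {G : SimpleGraph V}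
    (hn : 11 ≤ Fintype.card V) (h4 : EssentiallyFourConnected G)
    (emb : PlaneEmbedding G) {x : V} (C : G.Walk x x)
    (hC : IsLongestIsolatingCycle G C) (hc : 8 ≤ C.length)
    (hVm : (Vminus emb C).Nonempty) (hVp : (Vplus emb C).Nonempty) :
    ∀ f : Set (ℝ × ℝ), MinorFaceH emb C f → numCEdges emb C f = 8 →
      (10 : ℚ) / 3 ≤ wFace emb C f := by
  intro f hf h8
  obtain ⟨u, hu⟩ := exists_cycEnum hC.1
  obtain ⟨v, i, j, hw⟩ := hf.exists_window hu hC.2.1 (by omega)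
  have hj := hw.numCEdges_eq hu
  rw [h8] at hj
  subst hj
  have hw' := hw.reverse (i + 8)
  rw [show i + 8 - i - ((8 : ℕ) : ℤ) = 0 by push_cast; ring] at hw'
  have hsend := MinorWindow.sum_sendWeight_le (hu.reverse (i + 8)) hC h4.1 hf hw'
  have hrec : 0 ≤ ∑ᶠ f', sendWeight emb C f' f := finsum_nonneg fun _ => sendWeight_nonneg
  rw [wFace, h8]
  push_cast
  linarith

end
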